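/- arXiv:2006.07947 — 2 statements merged into one kernel-verified Lean document; each statement's English description precedes it below -/
import Mathlib

section
/- Let W be a 2-dimensional Coxeter group. Then its standard language 𝓛 satisfies condition (iii) of the definition of biautomaticity: there exists a constant C > 0 such that for all s ∈ S, all g, g' ∈ W with g' = sg, all words v, v' ∈ 𝓛 representing g, g' respectively, and all i ≥ 1, one has ℓ(v(i)⁻¹ s⁻¹ v'(i)) ≤ C. -/
namespace CoxeterPaper

open CoxeterSystem

attribute [local instance] Classical.propDecidable

variable {B : Type} [DecidableEq B] [Fintype B]
variable {W : Type} [Group W] {M : CoxeterMatrix B}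

/-- The right descent set `T(g) = {s ∈ S : ℓ(gs) < ℓ(g)}`, as a set of indices. -/
def descentSet (cs : CoxeterSystem M W) (g : W) : Set B :=
  {i | cs.IsRightDescent g i}

/-- The subgroup `⟨T(g)⟩` generated by the right descent set of `g`. -/
def descSubgroup (cs : CoxeterSystem M W) (g : W) : Subgroup W :=
  Subgroup.closure (cs.simple '' descentSet cs g)

/-- `w(g)`: the longest element of `⟨T(g)⟩` (defined via choice; for `g ≠ 1` the
subgroup `⟨T(g)⟩` is finite and has a unique longest element). -/
noncomputable def wg (cs : CoxeterSystem M W) (g : W) : W :=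
  if h : ∃ w₀ ∈ descSubgroup cs g, ∀ u ∈ descSubgroup cs g, cs.length u ≤ cs.length w₀
  then h.choose else 1

/-- `Π(g) = g · w(g)`. -/
noncomputable def PiMap (cs : CoxeterSystem M W) (g : W) : W := g * wg cs g

/-- The standard language `𝓛 ⊆ S*`: the empty word is in `𝓛` (and it is the only word of `𝓛`
representing the identity); a word `v` of length `n` representing `g ≠ 1` is in `𝓛` iff,
setting `k = ℓ(w(g))`, the prefix `v(n-k)` is in `𝓛` and `v(n-k+1, n)` represents `w(g)`. -/
inductive StdLang (cs : CoxeterSystem M W) : List B → Prop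
  | nil : StdLang cs []
  | step (v : List B) (hne : cs.wordProd v ≠ 1)
      (hpre : StdLang cs (v.take (v.length - cs.length (wg cs (cs.wordProd v)))))
      (hsuf : cs.wordProd (v.drop (v.length - cs.length (wg cs (cs.wordProd v))))
        = wg cs (cs.wordProd v)) : StdLang cs v

/-- A Coxeter group is 2-dimensional if every triple of distinct generators
generates an infinite subgroup. -/
def TwoDimensional (cs : CoxeterSystem M W) : Prop :=
  ∀ i j k : B, i ≠ j → i ≠ k → j ≠ k →
    Infinite (Subgroup.closure {cs.simple i, cs.simple j, cs.simple k} : Subgroup W)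

/-- The wall of the reflection `ρ` separates `g` and `h`. -/
def Separates (cs : CoxeterSystem M W) (ρ g h : W) : Prop :=
  Xor' (cs.length (ρ * g) < cs.length g) (cs.length (ρ * h) < cs.length h)

/-- `h` is adjacent to the wall of the reflection `ρ`. -/
def AdjacentWall (cs : CoxeterSystem M W) (ρ h : W) : Prop :=
  ∃ i : B, ρ = h * cs.simple i * h⁻¹

/-- The wall of `ρ'` separates `g` from the wall of `ρ`. -/
def SeparatesFromWall (cs : CoxeterSystem M W) (ρ' g ρ : W) : Prop :=
  ∀ h : W, AdjacentWall cs ρ h → Separates cs ρ' g h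

/-- `𝓦(g)`: the set of walls (identified with their reflections) separating `g` from the
identity and not separated from `g` by any other wall. -/
def WallsNear (cs : CoxeterSystem M W) (g : W) : Set W :=
  {ρ | cs.IsReflection ρ ∧ cs.length (ρ * g) < cs.length g ∧
    ∀ ρ' : W, cs.IsReflection ρ' → ρ' ≠ ρ → ¬ SeparatesFromWall cs ρ' g ρ}

set_option linter.unusedSectionVars false

/-- The sequence `sin (n θ) / sin θ` for `C = cos θ`, given by its recursion. -/
noncomputable def chebA (C : ℝ) : ℕ → ℝ
  | 0 => 0
  | 1 => 1
  | n + 2 => 2 * C * chebA C (n + 1) - chebA C n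

@[simp] theorem chebA_zero (C : ℝ) : chebA C 0 = 0 := rfl
@[simp] theorem chebA_one (C : ℝ) : chebA C 1 = 1 := rfl
theorem chebA_add_two (C : ℝ) (n : ℕ) :
    chebA C (n + 2) = 2 * C * chebA C (n + 1) - chebA C n := rfl
theorem chebA_two (C : ℝ) : chebA C 2 = 2 * C := by rw [chebA_add_two]; simp
theorem chebA_three (C : ℝ) : chebA C 3 = 4 * C ^ 2 - 1 := by
  rw [chebA_add_two, chebA_two]; simp; ring

theorem sin_mul_chebA (θ : ℝ) (n : ℕ) :
    Real.sin θ * chebA (Real.cos θ) n = Real.sin (n * θ) := by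
  induction n using Nat.twoStepInduction with
  | zero => simp
  | one => simp
  | more n h0 h1 =>
    rw [chebA_add_two]
    have e1 : ((n + 2 : ℕ) : ℝ) * θ = ((n + 1 : ℕ) : ℝ) * θ + θ := by push_cast; ring
    have e2 : (n : ℝ) * θ = ((n + 1 : ℕ) : ℝ) * θ - θ := by push_cast; ring
    rw [e2] at h0
    rw [e1, Real.sin_add]
    rw [Real.sin_sub] at h0
    linear_combination 2 * Real.cos θ * h1 - h0

theorem chebA_one_eq (n : ℕ) : chebA 1 n = n := by
  induction n using Nat.twoStepInduction with
  | zero => simp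
  | one => simp
  | more n h0 h1 => rw [chebA_add_two, h0, h1]; push_cast; ring

/-- `cos (π / M i j)`, which is `1` for `M i j = ∞` and `-1` for `i = j`. -/
noncomputable def cosM (M : CoxeterMatrix B) (i j : B) : ℝ := Real.cos (Real.pi / M i j)

theorem cosM_self (M : CoxeterMatrix B) (i : B) : cosM M i i = -1 := by
  simp [cosM]

theorem cosM_symm (M : CoxeterMatrix B) (i j : B) : cosM M i j = cosM M j i := by
  simp [cosM, M.symmetric i j]

theorem cosM_of_eq_zero {i j : B} (h : M i j = 0) : cosM M i j = 1 := by
  simp [cosM, h]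

theorem two_le_of_ne {i j : B} (h : i ≠ j) (h0 : M i j ≠ 0) : 2 ≤ M i j := by
  have := M.off_diagonal i j h
  omega

theorem sin_pi_div_pos {m : ℕ} (hm : 2 ≤ m) : 0 < Real.sin (Real.pi / m) := by
  have h2 : (2 : ℝ) ≤ m := by exact_mod_cast hm
  apply Real.sin_pos_of_pos_of_lt_pi
  · have := Real.pi_pos; positivity
  · rw [div_lt_iff₀ (by positivity)]
    nlinarith [Real.pi_pos]

theorem chebA_cosM {i j : B} (h : i ≠ j) (h0 : M i j ≠ 0) (n : ℕ) :
    chebA (cosM M i j) n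
      = Real.sin (n * (Real.pi / M i j)) / Real.sin (Real.pi / M i j) := by
  have hs := sin_pi_div_pos (two_le_of_ne h h0)
  rw [eq_div_iff hs.ne', mul_comm]
  exact sin_mul_chebA _ n

theorem chebA_cosM_self {i j : B} (h : i ≠ j) (h0 : M i j ≠ 0) :
    chebA (cosM M i j) (M i j) = 0 := by
  rw [chebA_cosM h h0]
  have : (M i j : ℝ) ≠ 0 := by exact_mod_cast h0
  rw [mul_div_cancel₀ _ this]; simp

theorem chebA_cosM_sub {i j : B} (h : i ≠ j) (h0 : M i j ≠ 0) {n : ℕ} (hn : n ≤ M i j) :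
    chebA (cosM M i j) (M i j - n) = chebA (cosM M i j) n := by
  rw [chebA_cosM h h0, chebA_cosM h h0]
  have : (M i j : ℝ) ≠ 0 := by exact_mod_cast h0
  congr 1
  rw [← Real.sin_pi_sub]
  congr 1
  push_cast [hn]
  field_simp
  ring

theorem chebA_cosM_mono {i j : B} (h : i ≠ j) (h0 : M i j ≠ 0) {k n : ℕ}
    (hk : k ≤ n) (hn : n + k ≤ M i j) :
    chebA (cosM M i j) k ≤ chebA (cosM M i j) n := by
  have key : ∀ n : ℕ, k ≤ n → 2 * n ≤ M i j →
      chebA (cosM M i j) k ≤ chebA (cosM M i j) n := by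
    intro n hk hn
    rw [chebA_cosM h h0, chebA_cosM h h0]
    have hs := sin_pi_div_pos (two_le_of_ne h h0)
    have hm : (0 : ℝ) < M i j := by exact_mod_cast Nat.pos_of_ne_zero h0
    have hkn : (k : ℝ) ≤ n := by exact_mod_cast hk
    have hnm : 2 * (n : ℝ) ≤ M i j := by exact_mod_cast hn
    have hp := Real.pi_pos
    gcongr
    apply Real.sin_le_sin_of_le_of_le_pi_div_two
    · have : 0 ≤ (k : ℝ) * (Real.pi / M i j) := by positivity
      linarith
    · rw [← mul_div_assoc, div_le_div_iff₀ hm (by norm_num)]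
      nlinarith
    · gcongr
  rcases le_total (2 * n) (M i j) with h2 | h2
  · exact key n hk h2
  · rw [← chebA_cosM_sub h h0 (by omega : n ≤ M i j)]
    exact key _ (by omega) (by omega)

theorem chebA_cosM_nonneg {i j : B} (h : i ≠ j) {n : ℕ} (hn : M i j ≠ 0 → n ≤ M i j) :
    0 ≤ chebA (cosM M i j) n := by
  by_cases h0 : M i j = 0
  · rw [cosM_of_eq_zero h0, chebA_one_eq]; positivity
  · simpa using chebA_cosM_mono h h0 (Nat.zero_le n) (by have := hn h0; omega)

theorem cosM_nonneg {i j : B} (h : i ≠ j) : 0 ≤ cosM M i j := by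
  have := chebA_cosM_nonneg (M := M) (n := 2) h (fun h0 => two_le_of_ne h h0)
  rw [chebA_two] at this
  linarith

theorem cosM_le_one (M : CoxeterMatrix B) (i j : B) : cosM M i j ≤ 1 := Real.cos_le_one _

theorem cosM_lt_one {i j : B} (h0 : M i j ≠ 0) : cosM M i j < 1 := by
  have hm : (1 : ℝ) ≤ M i j := by exact_mod_cast Nat.pos_of_ne_zero h0
  have hp := Real.pi_pos
  rw [cosM, ← Real.cos_zero]
  apply Real.cos_lt_cos_of_nonneg_of_le_pi le_rfl
  · rw [div_le_iff₀ (by linarith)]; nlinarith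
  · positivity

/-- The possible values of the cosine, as far as they are needed. -/
theorem cosM_cases {i j : B} (h : i ≠ j) :
    (M i j = 2 ∧ cosM M i j = 0) ∨ (M i j = 3 ∧ cosM M i j = 1 / 2) ∨
      (M i j ≠ 2 ∧ M i j ≠ 3 ∧ 1 / 2 ≤ cosM M i j ^ 2 ∧ 1 / 2 < cosM M i j) := by
  have hc := cosM_nonneg (M := M) h
  rcases eq_or_ne (M i j) 0 with h0 | h0
  · right; right
    rw [cosM_of_eq_zero h0, h0]; norm_num
  have h2 := two_le_of_ne h h0
  rcases eq_or_ne (M i j) 2 with h2 | h2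
  · left; simp [h2, cosM]
  rcases eq_or_ne (M i j) 3 with h3 | h3
  · right; left; simp [h3, cosM]
  right; right
  refine ⟨h2, h3, ?_⟩
  have := chebA_cosM_mono h h0 (k := 1) (n := 3) (by omega) (by omega)
  rw [chebA_three, chebA_one] at this
  constructor <;> nlinarith

theorem simple_comm_of_cosM_eq_zero (cs : CoxeterSystem M W) {i j : B} (h : i ≠ j)
    (h0 : cosM M i j = 0) : cs.simple i * cs.simple j = cs.simple j * cs.simple i := by
  rcases cosM_cases (M := M) h with ⟨h2, _⟩ | ⟨_, h2⟩ | ⟨_, _, _, h2⟩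
  · have := cs.simple_mul_simple_pow i j
    rw [h2, pow_two] at this
    have h3 := eq_inv_of_mul_eq_one_left this
    rw [h3]; simp
  · rw [h0] at h2; norm_num at h2
  · rw [h0] at h2; norm_num at h2

/-- The simple root indexed by `i`. -/
noncomputable def root (i : B) : B → ℝ := Pi.single i 1

theorem root_self (i : B) : root i i = 1 := by simp [root]
theorem root_of_ne {i j : B} (h : j ≠ i) : root i j = 0 := by simp [root, h]
theorem root_nonneg (i : B) : 0 ≤ root i := by
  intro j; by_cases h : j = i
  · subst h; simp [root_self]
  · simp [root_of_ne h]
theorem root_ne_zero (i : B) : root i ≠ 0 := by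
  intro h; have := congrFun h i; simp [root_self] at this

/-- The invariant symmetric bilinear form of the geometric representation. -/
noncomputable def bil (M : CoxeterMatrix B) : (B → ℝ) →ₗ[ℝ] (B → ℝ) →ₗ[ℝ] ℝ :=
  LinearMap.mk₂ ℝ (fun v w => ∑ i, ∑ j, v i * w j * (- cosM M i j))
    (fun v v' w => by simp only [Pi.add_apply, add_mul, Finset.sum_add_distrib])
    (fun c v w => by simp only [Pi.smul_apply, smul_eq_mul, Finset.mul_sum, mul_assoc])
    (fun v w w' => by simp only [Pi.add_apply, add_mul, mul_add, Finset.sum_add_distrib])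
    (fun c v w => by
      simp only [Pi.smul_apply, smul_eq_mul, Finset.mul_sum]
      refine Finset.sum_congr rfl fun i _ => Finset.sum_congr rfl fun j _ => ?_
      ring)

theorem bil_apply (v w : B → ℝ) :
    bil M v w = ∑ i, ∑ j, v i * w j * (- cosM M i j) := rfl

theorem bil_symm (v w : B → ℝ) : bil M v w = bil M w v := by
  rw [bil_apply, bil_apply, Finset.sum_comm]
  refine Finset.sum_congr rfl fun i _ => Finset.sum_congr rfl fun j _ => ?_
  rw [cosM_symm]; ring

@[simp] theorem bil_root_root (i j : B) : bil M (root i) (root j) = - cosM M i j := by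
  simp [bil_apply, root, Pi.single_apply]

@[simp] theorem bil_root_self (i : B) : bil M (root i) (root i) = 1 := by
  simp [cosM_self]

/-- The reflection in the simple root indexed by `i`. -/
noncomputable def refl (M : CoxeterMatrix B) (i : B) : Module.End ℝ (B → ℝ) :=
  LinearMap.id - (2 : ℝ) • ((bil M).flip (root i)).smulRight (root i)

theorem refl_apply (i : B) (v : B → ℝ) :
    refl M i v = v - (2 * bil M v (root i)) • root i := by
  simp [refl, mul_smul]

theorem refl_refl (i : B) (v : B → ℝ) : refl M i (refl M i v) = v := by
  rw [refl_apply, refl_apply]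
  simp only [map_sub, map_smul, LinearMap.sub_apply, LinearMap.smul_apply, smul_eq_mul,
    bil_root_self]
  ext j; simp; ring

theorem bil_refl_refl (i : B) (v w : B → ℝ) :
    bil M (refl M i v) (refl M i w) = bil M v w := by
  rw [refl_apply, refl_apply]
  simp only [map_sub, map_smul, LinearMap.sub_apply, LinearMap.smul_apply, smul_eq_mul,
    bil_root_self, bil_symm (M := M) (root i) w]
  ring

theorem refl_root_self (i : B) : refl M i (root i) = - root i := by
  rw [refl_apply, bil_root_self]; ext j; simp; ring

theorem refl_root (i j : B) :
    refl M i (root j) = root j + (2 * cosM M i j) • root i := by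
  rw [refl_apply, bil_root_root, cosM_symm]; ext k; simp

theorem refl_mul_refl_pow_root (i j : B) (n : ℕ) :
    ((refl M i * refl M j) ^ n) (root i)
        = chebA (cosM M i j) (2 * n + 1) • root i + chebA (cosM M i j) (2 * n) • root j ∧
    ((refl M i * refl M j) ^ n) (root j)
        = (- chebA (cosM M i j) (2 * n)) • root i
          + (chebA (cosM M i j) (2 * n + 1) - 2 * cosM M i j * chebA (cosM M i j) (2 * n))
            • root j := by
  induction n with
  | zero => simp
  | succ n ih =>
    have e2 : chebA (cosM M i j) (2 * (n + 1)) = 2 * cosM M i j * chebA (cosM M i j) (2 * n + 1)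
        - chebA (cosM M i j) (2 * n) := chebA_add_two _ _
    have e3 : chebA (cosM M i j) (2 * (n + 1) + 1) = 2 * cosM M i j
        * chebA (cosM M i j) (2 * (n + 1)) - chebA (cosM M i j) (2 * n + 1) := chebA_add_two _ _
    constructor
    · rw [pow_succ', Module.End.mul_apply, Module.End.mul_apply, ih.1]
      simp only [map_add, map_smul, refl_root, cosM_self, cosM_symm M j i]
      rw [e3, e2]; ext k; simp; ring
    · rw [pow_succ', Module.End.mul_apply, Module.End.mul_apply, ih.2]
      simp only [map_add, map_smul, refl_root, cosM_self, cosM_symm M j i]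
      rw [e3, e2]; ext k; simp; ring

theorem refl_mul_refl_pow_of_ne {i j : B} (h : i ≠ j) (h0 : M i j ≠ 0) :
    (refl M i * refl M j) ^ (M i j) = 1 := by
  have hc := cosM_lt_one h0
  have hc0 := cosM_nonneg (M := M) h
  have hm : (M i j : ℝ) ≠ 0 := by exact_mod_cast h0
  have ha : chebA (cosM M i j) (2 * M i j) = 0 := by
    rw [chebA_cosM h h0]
    have : ((2 * M i j : ℕ) : ℝ) * (Real.pi / M i j) = 2 * Real.pi := by
      push_cast; field_simp
    rw [this]; simp
  have hb : chebA (cosM M i j) (2 * M i j + 1) = 1 := by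
    rw [chebA_cosM h h0]
    have : ((2 * M i j + 1 : ℕ) : ℝ) * (Real.pi / M i j) = Real.pi / M i j + 2 * Real.pi := by
      push_cast; field_simp; ring
    rw [this, Real.sin_add_two_pi]
    exact div_self (sin_pi_div_pos (two_le_of_ne h h0)).ne'
  obtain ⟨h1, h2⟩ := refl_mul_refl_pow_root (M := M) i j (M i j)
  rw [ha, hb] at h1 h2
  have h1 : ((refl M i * refl M j) ^ (M i j)) (root i) = root i := by rw [h1]; simp
  have h2 : ((refl M i * refl M j) ^ (M i j)) (root j) = root j := by rw [h2]; simp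
  refine LinearMap.ext fun v => ?_
  set c := cosM M i j with hcdef
  set x := bil M v (root i) with hx
  set y := bil M v (root j) with hy
  have hd : 1 - c ^ 2 ≠ 0 := by nlinarith
  set p := (x + c * y) / (1 - c ^ 2) with hp
  set q := (y + c * x) / (1 - c ^ 2) with hq
  set v0 := v - p • root i - q • root j with hv0
  have o1 : bil M v0 (root i) = 0 := by
    simp only [hv0, map_sub, map_smul, LinearMap.sub_apply, LinearMap.smul_apply, smul_eq_mul,
      bil_root_self, bil_root_root, cosM_symm M j i, ← hx, ← hcdef]
    rw [hp, hq]; field_simp; ring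
  have o2 : bil M v0 (root j) = 0 := by
    simp only [hv0, map_sub, map_smul, LinearMap.sub_apply, LinearMap.smul_apply, smul_eq_mul,
      bil_root_self, bil_root_root, ← hy, ← hcdef]
    rw [hp, hq]; field_simp; ring
  have f0 : (refl M i * refl M j) v0 = v0 := by
    rw [Module.End.mul_apply, refl_apply j, o2]; simp [refl_apply, o1]
  have f1 : ∀ n : ℕ, ((refl M i * refl M j) ^ n) v0 = v0 := by
    intro n
    induction n with
    | zero => simp
    | succ n ih => rw [pow_succ', Module.End.mul_apply, ih, f0]
  have : v = v0 + p • root i + q • root j := by rw [hv0]; abel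
  rw [this, map_add, map_add, map_smul, map_smul, f1, h1, h2]; simp

theorem isLiftable_refl : M.IsLiftable (refl M) := by
  intro i j
  by_cases h : i = j
  · subst h
    refine LinearMap.ext fun v => ?_
    simp [refl_refl]
  by_cases h0 : M i j = 0
  · simp [h0]
  exact refl_mul_refl_pow_of_ne h h0

/-- The geometric representation. -/
noncomputable def act (cs : CoxeterSystem M W) : W →* Module.End ℝ (B → ℝ) :=
  cs.lift ⟨refl M, isLiftable_refl⟩

section representation
variable (cs : CoxeterSystem M W)

theorem act_simple (i : B) (v : B → ℝ) :
    act cs (cs.simple i) v = v - (2 * bil M v (root i)) • root i := by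
  rw [act, cs.lift_apply_simple, refl_apply]

theorem act_mul (g h : W) (v : B → ℝ) : act cs (g * h) v = act cs g (act cs h v) := by
  rw [map_mul]; rfl

@[simp] theorem act_one (v : B → ℝ) : act cs 1 v = v := by simp

@[simp] theorem act_inv_act (g : W) (v : B → ℝ) : act cs g⁻¹ (act cs g v) = v := by
  rw [← act_mul]; simp

@[simp] theorem act_act_inv (g : W) (v : B → ℝ) : act cs g (act cs g⁻¹ v) = v := by
  rw [← act_mul]; simp

theorem bil_act_simple (i : B) (v w : B → ℝ) :
    bil M (act cs (cs.simple i) v) (act cs (cs.simple i) w) = bil M v w := by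
  simp only [act, cs.lift_apply_simple, bil_refl_refl]

theorem bil_act (g : W) (v w : B → ℝ) : bil M (act cs g v) (act cs g w) = bil M v w := by
  induction g using cs.simple_induction_left with
  | one => simp
  | mul_simple_left g i ih => rw [act_mul, act_mul, bil_act_simple, ih]

theorem act_simple_root_self (i : B) : act cs (cs.simple i) (root i) = - root i := by
  rw [act, cs.lift_apply_simple, refl_root_self]

theorem act_simple_root (i j : B) :
    act cs (cs.simple i) (root j) = root j + (2 * cosM M i j) • root i := by
  rw [act, cs.lift_apply_simple, refl_root]

theorem act_mul_simple_root_self (g : W) (i : B) :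
    act cs (g * cs.simple i) (root i) = - act cs g (root i) := by
  rw [act_mul, act_simple_root_self, map_neg]

/-- The letters `s, t, s, t, …`. -/
def altLetter (s t : B) (n : ℕ) : B := if Even n then s else t

theorem altLetter_zero (s t : B) : altLetter s t 0 = s := by simp [altLetter]
theorem altLetter_one (s t : B) : altLetter s t 1 = t := by simp [altLetter]
theorem altLetter_add_two (s t : B) (n : ℕ) : altLetter s t (n + 2) = altLetter s t n := by
  simp [altLetter, Nat.even_add]
theorem cosM_altLetter (s t : B) (n : ℕ) :
    cosM M (altLetter s t n) (altLetter s t (n + 1)) = cosM M s t := by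
  by_cases h : Even n
  · simp [altLetter, h, Nat.even_add_one]
  · simp [altLetter, h, Nat.even_add_one, cosM_symm M t s]

theorem act_root_nonneg {s : B} {w : W} (hs : cs.length w < cs.length (w * cs.simple s)) :
    0 ≤ act cs w (root s) := by
  induction hn : cs.length w using Nat.strong_induction_on generalizing w s with
  | _ n ih =>
  by_cases hw : w = 1
  · subst hw; simpa using root_nonneg s
  obtain ⟨t, ht⟩ := cs.exists_rightDescent_of_ne_one hw
  have hst : s ≠ t := by
    rintro rfl
    exact absurd ht (by simp only [CoxeterSystem.IsRightDescent]; omega)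
  have hL := cs.length_mul_simple w s
  have inner : ∀ d v k, cs.length v = d → cs.length v + (k + 1) = cs.length w →
      cs.length v < cs.length (v * cs.simple (altLetter t s k)) →
      v⁻¹ * w * cs.simple s = cs.wordProd (alternatingWord t s (k + 2)) →
      act cs (v⁻¹ * w) (root s) = chebA (cosM M t s) (k + 2) • root (altLetter t s k)
        + chebA (cosM M t s) (k + 1) • root (altLetter t s (k + 1)) →
      0 ≤ act cs w (root s) := by
    intro d
    induction d using Nat.strong_induction_on with
    | _ d ihd =>
    intro v k hd hlen hasc hword hact
    by_cases hdesc : cs.length (v * cs.simple (altLetter t s (k + 1))) < cs.length v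
    · have h1 := cs.length_mul_simple v (altLetter t s (k + 1))
      refine ihd _ (by omega) (v * cs.simple (altLetter t s (k + 1))) (k + 1) rfl (by omega)
        ?_ ?_ ?_
      · rwa [cs.simple_mul_simple_cancel_right]
      · rw [alternatingWord_succ', cs.wordProd_cons, ← hword]
        have : (if Even (k + 2) then s else t) = altLetter t s (k + 1) := by
          by_cases h : Even k <;> simp [altLetter, h, Nat.even_add_one]
        rw [this]
        simp [mul_assoc]
      · rw [mul_inv_rev, cs.inv_simple, mul_assoc, act_mul, hact, map_add, map_smul, map_smul,
          act_simple_root_self, act_simple_root,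
          cosM_symm M (altLetter t s (k + 1)), cosM_altLetter, altLetter_add_two,
          chebA_add_two _ (k + 1)]
        ext j; simp; ring
    · have e : w = v * (v⁻¹ * w) := by group
      rw [e, act_mul, hact, map_add, map_smul, map_smul]
      have hred : M t s ≠ 0 → k + 2 ≤ M t s := by
        intro h0
        by_contra hlt
        have h1 := cs.not_isReduced_alternatingWord t s h0 (m := k + 2) (by omega)
        apply h1
        have h2 := cs.length_wordProd_le (alternatingWord t s (k + 2))
        rw [length_alternatingWord] at h2
        rw [CoxeterSystem.IsReduced, length_alternatingWord, ← hword]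
        rw [← hword] at h2
        have h3 := cs.length_mul_le v (v⁻¹ * w * cs.simple s)
        have h4 : v * (v⁻¹ * w * cs.simple s) = w * cs.simple s := by group
        rw [h4] at h3
        omega
      have hne := cs.length_mul_simple_ne v (altLetter t s (k + 1))
      have n1 := ih (cs.length v) (by omega) hasc rfl
      have n2 := ih (cs.length v) (by omega) (w := v) (s := altLetter t s (k + 1)) (by omega) rfl
      have a1 := chebA_cosM_nonneg (M := M) (Ne.symm hst) (n := k + 2) hred
      have a2 := chebA_cosM_nonneg (M := M) (Ne.symm hst) (n := k + 1)
        (fun h => by have := hred h; omega)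
      exact add_nonneg (smul_nonneg a1 n1) (smul_nonneg a2 n2)
  have h1 := cs.length_mul_simple w t
  have ht' : cs.length (w * cs.simple t) < cs.length w := ht
  refine inner _ (w * cs.simple t) 0 rfl (by omega) ?_ ?_ ?_
  · rw [altLetter_zero, cs.simple_mul_simple_cancel_right]; omega
  · simp [alternatingWord, cs.wordProd_cons]
  · rw [mul_inv_rev, cs.inv_simple, inv_mul_cancel_right, act_simple_root, altLetter_zero,
      altLetter_one, chebA_two, chebA_one]
    simp [add_comm]

end representation

section roots
variable (cs : CoxeterSystem M W)

theorem act_ne_zero (w : W) {v : B → ℝ} (hv : v ≠ 0) : act cs w v ≠ 0 := by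
  intro h
  apply hv
  rw [← act_inv_act cs w v, h, map_zero]

theorem act_root_nonpos {s : B} {w : W} (hs : cs.length (w * cs.simple s) < cs.length w) :
    act cs w (root s) ≤ 0 := by
  have h := act_root_nonneg cs (s := s) (w := w * cs.simple s)
    (by rwa [cs.simple_mul_simple_cancel_right])
  rw [act_mul_simple_root_self] at h
  simpa using h

theorem not_nonneg_of_nonpos {v : B → ℝ} (hv : v ≠ 0) (h : v ≤ 0) : ¬ 0 ≤ v :=
  fun h' => hv (le_antisymm h h')

theorem descent_iff {s : B} {w : W} :
    cs.length (w * cs.simple s) < cs.length w ↔ act cs w (root s) ≤ 0 := by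
  refine ⟨act_root_nonpos cs, fun h => ?_⟩
  by_contra hlt
  have := cs.length_mul_simple_ne w s
  exact not_nonneg_of_nonpos (act_ne_zero cs w (root_ne_zero s)) h
    (act_root_nonneg cs (by omega))

theorem ascent_iff {s : B} {w : W} :
    cs.length w < cs.length (w * cs.simple s) ↔ 0 ≤ act cs w (root s) := by
  refine ⟨act_root_nonneg cs, fun h => ?_⟩
  by_contra hlt
  have := cs.length_mul_simple_ne w s
  exact not_nonneg_of_nonpos (act_ne_zero cs w (root_ne_zero s))
    (act_root_nonpos cs (by omega)) h

/-- The roots of the geometric representation. -/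
def IsRt (β : B → ℝ) : Prop := ∃ w i, β = act cs w (root i)

variable {cs}

theorem isRt_root (i : B) : IsRt cs (root i) := ⟨1, i, by simp⟩

theorem IsRt.act {β : B → ℝ} (h : IsRt cs β) (w : W) : IsRt cs (act cs w β) := by
  obtain ⟨u, i, rfl⟩ := h
  exact ⟨w * u, i, by rw [act_mul]⟩

theorem IsRt.bil_self {β : B → ℝ} (h : IsRt cs β) : bil M β β = 1 := by
  obtain ⟨u, i, rfl⟩ := h
  rw [bil_act, bil_root_self]

theorem IsRt.ne_zero {β : B → ℝ} (h : IsRt cs β) : β ≠ 0 := by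
  intro h0
  have := h.bil_self
  rw [h0] at this
  simp at this

theorem IsRt.nonneg_or_nonpos {β : B → ℝ} (h : IsRt cs β) : 0 ≤ β ∨ β ≤ 0 := by
  obtain ⟨u, i, rfl⟩ := h
  rw [← descent_iff, ← ascent_iff]
  have := cs.length_mul_simple_ne u i
  omega

theorem IsRt.nonpos_of_neg {β : B → ℝ} (h : IsRt cs β) {j : B} (hj : β j < 0) : β ≤ 0 := by
  rcases h.nonneg_or_nonpos with h | h
  · exact absurd (h j) (not_le.mpr hj)
  · exact h

theorem IsRt.neg {β : B → ℝ} (h : IsRt cs β) : IsRt cs (-β) := by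
  obtain ⟨u, i, rfl⟩ := h
  exact ⟨u * cs.simple i, i, by rw [act_mul_simple_root_self]⟩

/-- A positive root supported on one simple root is simple. -/
theorem IsRt.eq_root {β : B → ℝ} (h : IsRt cs β) {i : B} (hj : ∀ j, j ≠ i → β j = 0)
    (hi : 0 ≤ β i) : β = root i := by
  have e : β = β i • root i := by
    ext j
    by_cases hji : j = i
    · subst hji; simp [root_self]
    · simp [root_of_ne hji, hj j hji]
  have h1 := h.bil_self
  rw [e] at h1
  simp only [map_smul, LinearMap.smul_apply, smul_eq_mul, bil_root_self] at h1
  have : β i = 1 := by nlinarith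
  rw [e, this, one_smul]

theorem act_simple_apply_of_ne {i j : B} (h : j ≠ i) (v : B → ℝ) :
    act cs (cs.simple i) v j = v j := by
  rw [act_simple]; simp [root_of_ne h]

/-- A simple reflection permutes the positive roots other than its own one. -/
theorem IsRt.eq_root_of_act_nonpos {β : B → ℝ} (h : IsRt cs β) {i : B} (h0 : 0 ≤ β)
    (hi : CoxeterPaper.act cs (cs.simple i) β ≤ 0) : β = root i := by
  refine h.eq_root (i := i) (fun j hj => le_antisymm ?_ (h0 j)) (h0 i)
  have := hi j
  rwa [act_simple_apply_of_ne hj] at this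

variable (cs) in
theorem act_conj_simple (g : W) (i : B) (v : B → ℝ) :
    act cs (g * cs.simple i * g⁻¹) v
      = v - (2 * bil M v (act cs g (root i))) • act cs g (root i) := by
  rw [act_mul, act_mul, act_simple, map_sub, map_smul, act_act_inv]
  congr 3
  rw [← bil_act cs g, act_act_inv]

theorem eq_one_of_act {g : W} (h : ∀ v, act cs g v = v) : g = 1 := by
  by_contra hg
  obtain ⟨t, ht⟩ := cs.exists_rightDescent_of_ne_one hg
  have := (descent_iff cs).1 ht
  rw [h] at this
  exact not_nonneg_of_nonpos (root_ne_zero t) this (root_nonneg t)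

theorem conj_simple_eq {g h : W} {i j : B}
    (e : act cs g (root i) = act cs h (root j) ∨ act cs g (root i) = - act cs h (root j)) :
    g * cs.simple i * g⁻¹ = h * cs.simple j * h⁻¹ := by
  have : (g * cs.simple i * g⁻¹) * (h * cs.simple j * h⁻¹)⁻¹ = 1 := by
    apply eq_one_of_act (cs := cs)
    intro v
    have key : ∀ v, act cs (g * cs.simple i * g⁻¹) v = act cs (h * cs.simple j * h⁻¹) v := by
      intro v
      rw [act_conj_simple, act_conj_simple]
      rcases e with e | e
      · rw [e]
      · rw [e]; simp
    rw [act_mul, key, act_act_inv]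
  exact mul_inv_eq_one.1 this

theorem simple_mul_eq_mul_simple {g : W} {i s : B}
    (e : act cs g (root i) = root s ∨ act cs g (root i) = - root s) :
    cs.simple s * g = g * cs.simple i := by
  have := conj_simple_eq (cs := cs) (g := g) (h := 1) (i := i) (j := s) (by simpa using e)
  rw [mul_inv_eq_iff_eq_mul] at this
  simpa using this.symm

theorem act_eq_of_simple_mul_eq {g : W} {i s : B} (h : cs.simple s * g = g * cs.simple i) :
    act cs g (root i) = root s ∨ act cs g (root i) = - root s := by
  have e1 : act cs (cs.simple s) (act cs g (root i)) = - act cs g (root i) := by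
    rw [← act_mul, h, act_mul_simple_root_self]
  have hr : IsRt cs (act cs g (root i)) := (isRt_root i).act g
  rcases hr.nonneg_or_nonpos with h0 | h0
  · left
    exact hr.eq_root_of_act_nonpos h0 (by rw [e1]; simpa using h0)
  · right
    rw [← neg_eq_iff_eq_neg]
    refine hr.neg.eq_root_of_act_nonpos (by simpa using h0) ?_
    rw [map_neg, e1]; simpa using h0

/-- Left multiplication by `s` only changes descents along the wall of `s`. -/
theorem descent_simple_mul_iff {g : W} {s y : B} (h : cs.simple s * g ≠ g * cs.simple y) :
    cs.length (cs.simple s * g * cs.simple y) < cs.length (cs.simple s * g) ↔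
      cs.length (g * cs.simple y) < cs.length g := by
  rw [descent_iff, descent_iff, act_mul]
  have hr : IsRt cs (act cs g (root y)) := (isRt_root y).act g
  constructor
  · intro h1
    rcases hr.nonneg_or_nonpos with h0 | h0
    · exact absurd (simple_mul_eq_mul_simple (Or.inl (hr.eq_root_of_act_nonpos h0 h1))) h
    · exact h0
  · intro h1
    rcases (hr.act (cs.simple s)).nonneg_or_nonpos with h0 | h0
    · have := hr.neg.eq_root_of_act_nonpos (i := s) (by simpa using h1)
        (by rw [map_neg]; simpa using h0)
      exact absurd (simple_mul_eq_mul_simple (Or.inr (neg_eq_iff_eq_neg.1 this))) h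
    · exact h0

/-- The exchange property. -/
theorem exists_eraseIdx (l : List B) (i : B) (h : act cs (cs.wordProd l) (root i) ≤ 0) :
    ∃ j, j < l.length ∧ cs.wordProd l * cs.simple i = cs.wordProd (l.eraseIdx j) := by
  induction l with
  | nil =>
    simp only [cs.wordProd_nil, act_one] at h
    exact absurd (root_nonneg i) (not_nonneg_of_nonpos (root_ne_zero i) h)
  | cons a l ih =>
    have hr : IsRt cs (act cs (cs.wordProd l) (root i)) := (isRt_root i).act _
    rw [cs.wordProd_cons, act_mul] at h
    rcases hr.nonneg_or_nonpos with h0 | h0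
    · refine ⟨0, by simp, ?_⟩
      have := simple_mul_eq_mul_simple (Or.inl (hr.eq_root_of_act_nonpos h0 h))
      rw [cs.wordProd_cons, mul_assoc, ← this]
      simp
    · obtain ⟨j, hj, e⟩ := ih h0
      refine ⟨j + 1, by simpa using hj, ?_⟩
      rw [cs.wordProd_cons, mul_assoc, e]
      simp [cs.wordProd_cons]

/-- Deletion: a word contains a reduced word with the same product and no new letters. -/
theorem exists_reduced_sublist (l : List B) :
    ∃ l' : List B, (∀ i ∈ l', i ∈ l) ∧ cs.IsReduced l' ∧ cs.wordProd l' = cs.wordProd l := by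
  induction l using List.reverseRecOn with
  | nil => exact ⟨[], by simp, by simp [CoxeterSystem.IsReduced], rfl⟩
  | append_singleton l a ih =>
    obtain ⟨l', hl, hr, e⟩ := ih
    have he : cs.wordProd (l ++ [a]) = cs.wordProd l' * cs.simple a := by
      rw [cs.wordProd_append, e]; simp
    rw [he]
    rcases lt_or_ge (cs.length (cs.wordProd l' * cs.simple a)) (cs.length (cs.wordProd l'))
      with hd | hd
    · obtain ⟨j, hj, e2⟩ := exists_eraseIdx l' a (act_root_nonpos cs hd)
      refine ⟨l'.eraseIdx j, fun i hi => ?_, ?_, e2.symm⟩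
      · have := hl i (List.mem_of_mem_eraseIdx hi)
        simp [this]
      · have h1 := cs.length_mul_simple (cs.wordProd l') a
        have h2 := List.length_eraseIdx_add_one hj
        rw [CoxeterSystem.IsReduced] at hr ⊢
        rw [← e2]
        omega
    · refine ⟨l' ++ [a], fun i hi => ?_, ?_, by rw [cs.wordProd_append]; simp⟩
      · rcases List.mem_append.1 hi with h | h
        · simp [hl i h]
        · simp [h]
      · have h1 := cs.length_mul_simple (cs.wordProd l') a
        rw [CoxeterSystem.IsReduced] at hr ⊢
        rw [cs.wordProd_append, List.length_append]
        simp only [cs.wordProd_cons, cs.wordProd_nil, mul_one, List.length_cons, List.length_nil]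
        omega

theorem exists_reduced_of_mem_closure {J : Set B} {u : W}
    (hu : u ∈ Subgroup.closure (cs.simple '' J)) :
    ∃ l : List B, (∀ i ∈ l, i ∈ J) ∧ cs.IsReduced l ∧ cs.wordProd l = u := by
  suffices h : ∃ l : List B, (∀ i ∈ l, i ∈ J) ∧ cs.wordProd l = u by
    obtain ⟨l, hl, rfl⟩ := h
    obtain ⟨l', h1, h2, h3⟩ := exists_reduced_sublist (cs := cs) l
    exact ⟨l', fun i hi => hl i (h1 i hi), h2, h3⟩
  induction hu using Subgroup.closure_induction with
  | mem x hx =>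
    obtain ⟨i, hi, rfl⟩ := hx
    exact ⟨[i], by simpa using hi, by simp⟩
  | one => exact ⟨[], by simp, by simp⟩
  | mul x y _ _ hx hy =>
    obtain ⟨l, hl, rfl⟩ := hx
    obtain ⟨l', hl', rfl⟩ := hy
    refine ⟨l ++ l', fun i hi => ?_, by rw [cs.wordProd_append]⟩
    rcases List.mem_append.1 hi with h | h
    · exact hl i h
    · exact hl' i h
  | inv x _ hx =>
    obtain ⟨l, hl, rfl⟩ := hx
    exact ⟨l.reverse, fun i hi => hl i (by simpa using hi), by rw [cs.wordProd_reverse]⟩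

/-- The set of positive roots made negative by an element is finite. -/
theorem finite_inversions (x : W) :
    {γ : B → ℝ | IsRt cs γ ∧ 0 ≤ γ ∧ act cs x γ ≤ 0}.Finite := by
  induction x using cs.simple_induction_right with
  | one =>
    refine Set.Finite.subset Set.finite_empty ?_
    rintro γ ⟨h, h0, h1⟩
    rw [act_one] at h1
    exact h.ne_zero (le_antisymm h1 h0)
  | mul_simple_right x i ih =>
    refine ((ih.image (act cs (cs.simple i))).union (Set.finite_singleton (root i))).subset ?_
    rintro γ ⟨h, h0, h1⟩
    rw [act_mul] at h1
    rcases (h.act (cs.simple i)).nonneg_or_nonpos with h2 | h2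
    · left
      refine ⟨act cs (cs.simple i) γ, ⟨h.act _, h2, h1⟩, ?_⟩
      rw [← act_mul]; simp
    · right
      exact h.eq_root_of_act_nonpos h0 h2

end roots

section cone
variable {cs : CoxeterSystem M W}

theorem bil_comb (i j k l : B) (a b c : ℝ) :
    bil M (a • root i + b • root j + c • root k) (root l)
      = -(a * cosM M i l + b * cosM M j l + c * cosM M k l) := by
  simp; ring

theorem bil_comb_nonpos {i j k : B} {a b c : ℝ}
    (ha : 0 ≤ a) (hb : 0 ≤ b) (hc : 0 ≤ c)
    (hi : a ≤ b * cosM M i j + c * cosM M i k)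
    (hj : b ≤ a * cosM M i j + c * cosM M j k)
    (hk : c ≤ a * cosM M i k + b * cosM M j k) (l : B) :
    bil M (a • root i + b • root j + c • root k) (root l) ≤ 0 := by
  rw [bil_comb]
  by_cases h1 : i = l
  · subst h1
    rw [cosM_self, cosM_symm M j i, cosM_symm M k i]; linarith
  by_cases h2 : j = l
  · subst h2
    rw [cosM_self, cosM_symm M k j]; linarith
  by_cases h3 : k = l
  · subst h3
    rw [cosM_self]; linarith
  have := mul_nonneg ha (cosM_nonneg (M := M) h1)
  have := mul_nonneg hb (cosM_nonneg (M := M) h2)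
  have := mul_nonneg hc (cosM_nonneg (M := M) h3)
  linarith

theorem le_act_of_bil_nonpos {ω : B → ℝ} (hω : ∀ i, bil M ω (root i) ≤ 0) (x : W) :
    ω ≤ act cs x ω := by
  induction hn : cs.length x using Nat.strong_induction_on generalizing x with
  | _ n ih =>
  by_cases hx : x = 1
  · simp [hx]
  obtain ⟨t, ht⟩ := cs.exists_rightDescent_of_ne_one hx
  have ht' : cs.length (x * cs.simple t) < cs.length x := ht
  have h1 := ih _ (by omega) (x * cs.simple t) rfl
  have h2 := act_root_nonneg cs (s := t) (w := x * cs.simple t)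
    (by rwa [cs.simple_mul_simple_cancel_right])
  have e : act cs x ω = act cs (x * cs.simple t) ω
      + (-(2 * bil M ω (root t))) • act cs (x * cs.simple t) (root t) := by
    conv_lhs => rw [← cs.simple_mul_simple_cancel_right (w := x) t, act_mul, act_simple]
    rw [map_sub, map_smul, neg_smul, sub_eq_add_neg]
  rw [e]
  have h3 : 0 ≤ -(2 * bil M ω (root t)) := by have := hω t; linarith
  exact h1.trans (le_add_of_nonneg_right (smul_nonneg h3 h2))

/-- A vector of the closed fundamental chamber is not in the cone spanned by `β` and the
descents of `x`, when `x β` is simple. -/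
theorem not_mem_cone {x : W} {β ω : B → ℝ} {s y₁ y₂ : B} {a b₁ b₂ : ℝ}
    (hx : act cs x β = root s) (h₁ : act cs x (root y₁) ≤ 0) (h₂ : act cs x (root y₂) ≤ 0)
    (hb₁ : 0 ≤ b₁) (hb₂ : 0 ≤ b₂) (e : ω = a • β + b₁ • root y₁ + b₂ • root y₂)
    (hω : ∀ i, bil M ω (root i) ≤ 0) {i j : B} (hij : i ≠ j) (hi : 0 < ω i) (hj : 0 < ω j) :
    False := by
  have key : ∀ l, l ≠ s → 0 < ω l → False := by
    intro l hl hpos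
    have h1 := le_act_of_bil_nonpos (cs := cs) hω x l
    rw [e, map_add, map_add, map_smul, map_smul, map_smul, hx, ← e] at h1
    have h2 := mul_nonpos_of_nonneg_of_nonpos hb₁ (h₁ l)
    have h3 := mul_nonpos_of_nonneg_of_nonpos hb₂ (h₂ l)
    simp only [Pi.add_apply, Pi.smul_apply, smul_eq_mul, root_of_ne hl] at h1 h2 h3
    linarith
  by_cases his : i = s
  · exact key j (fun h => hij (his.trans h.symm)) hj
  · exact key i his hi

/-- The coefficients of the roots of an infinite dihedral reflection group. -/
noncomputable def dihStep (κ : ℝ) (p : ℝ × ℝ) : ℝ × ℝ :=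
  (2 * κ * (2 * κ * p.1 - p.2) - p.1, 2 * κ * p.1 - p.2)

theorem neg_one_lt_bil {x : W} {β : B → ℝ} {s y : B} (hβ : IsRt cs β) (h0 : 0 ≤ β)
    (hx : act cs x β = root s) (hy : act cs x (root y) ≤ 0) : -1 < bil M β (root y) := by
  by_contra hcon
  set κ := - bil M β (root y) with hκ
  have hκ1 : 1 ≤ κ := by linarith
  have hi : ∃ i, i ≠ s ∧ act cs x (root y) i < 0 := by
    by_contra hno
    push Not at hno
    have hr : IsRt cs (- act cs x (root y)) := ((isRt_root y).act x).neg
    have h1 := hr.eq_root (i := s)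
      (fun j hj => by
        have h1 := hno j hj
        have h2 := hy j
        simp only [Pi.zero_apply] at h2
        simp; linarith)
      (by have h2 := hy s; simp only [Pi.zero_apply] at h2; simp; linarith)
    have h2 : act cs x⁻¹ (act cs x β) = act cs x⁻¹ (- act cs x (root y)) := by rw [hx, h1]
    rw [map_neg, act_inv_act, act_inv_act] at h2
    rw [h2] at h0
    exact not_nonneg_of_nonpos (neg_ne_zero.2 (root_ne_zero y))
      (by simpa using root_nonneg y) h0
  obtain ⟨i, his, hineg⟩ := hi
  let p : ℕ → ℝ × ℝ := fun n => (dihStep κ)^[n] (1, 0)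
  have hp : ∀ n, p (n + 1) = dihStep κ (p n) := fun n => Function.iterate_succ_apply' _ _ _
  have hinv : ∀ n, 0 ≤ (p n).2 ∧ (p n).2 + 1 ≤ (p n).1 := by
    intro n
    induction n with
    | zero => simp [p]
    | succ n ih =>
      rw [hp]
      obtain ⟨h1, h2⟩ := ih
      simp only [dihStep]
      have h3 : (p n).1 + 1 ≤ 2 * κ * (p n).1 - (p n).2 := by nlinarith
      constructor
      · linarith
      · nlinarith
  have hmono : StrictMono fun n => (p n).1 := by
    apply strictMono_nat_of_lt_succ
    intro n
    have h1 := hinv n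
    rw [hp]
    simp only [dihStep]
    have h3 : (p n).1 + 1 ≤ 2 * κ * (p n).1 - (p n).2 := by nlinarith
    nlinarith
  have hact : ∀ v, act cs (x⁻¹ * cs.simple s * x) v = v - (2 * bil M v β) • β := by
    intro v
    have h := act_conj_simple cs x⁻¹ s v
    rw [inv_inv] at h
    rw [h, ← hx, act_inv_act]
  let γ : ℕ → B → ℝ := fun n => (p n).1 • root y + (p n).2 • β
  have hγ : ∀ n, IsRt cs (γ n) := by
    intro n
    induction n with
    | zero => simpa [γ, p] using isRt_root y
    | succ n ih =>
      have h := (ih.act (x⁻¹ * cs.simple s * x)).act (cs.simple y)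
      convert h using 1
      simp only [γ]
      rw [hact, hp, act_simple]
      simp only [map_add, map_sub, map_smul, LinearMap.sub_apply, LinearMap.smul_apply,
        LinearMap.add_apply, smul_eq_mul, bil_root_self, hβ.bil_self,
        bil_symm (M := M) (root y) β]
      rw [show bil M β (root y) = -κ by rw [hκ]; ring]
      ext j
      simp [dihStep]
      ring
  have hinf : (Set.range γ).Infinite := by
    apply Set.infinite_range_of_injective
    intro n m hnm
    have h1 : act cs x (γ n) i = act cs x (γ m) i := by rw [hnm]
    simp only [γ, map_add, map_smul, hx, Pi.add_apply, Pi.smul_apply, smul_eq_mul,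
      root_of_ne his, mul_zero, add_zero] at h1
    exact hmono.injective (mul_right_cancel₀ hineg.ne h1)
  apply hinf
  refine (finite_inversions (cs := cs) x).subset ?_
  rintro _ ⟨n, rfl⟩
  have h1 := hinv n
  refine ⟨hγ n, add_nonneg (smul_nonneg (by linarith) (root_nonneg y)) (smul_nonneg h1.1 h0), ?_⟩
  refine ((hγ n).act x).nonpos_of_neg (j := i) ?_
  simp only [γ, map_add, map_smul, hx, Pi.add_apply, Pi.smul_apply, smul_eq_mul,
      root_of_ne his, mul_zero, add_zero]
  exact mul_neg_of_pos_of_neg (by linarith) hineg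

/-- The span of three simple roots. -/
def InSpan (i j k : B) (v : B → ℝ) : Prop :=
  ∃ a b c : ℝ, v = a • root i + b • root j + c • root k

theorem InSpan.act_simple {i j k l : B} {v : B → ℝ} (h : InSpan i j k v)
    (hl : l = i ∨ l = j ∨ l = k) : InSpan i j k (act cs (cs.simple l) v) := by
  obtain ⟨a, b, c, rfl⟩ := h
  rw [CoxeterPaper.act_simple]
  set t := 2 * bil M (a • root i + b • root j + c • root k) (root l)
  rcases hl with rfl | rfl | rfl
  · exact ⟨a - t, b, c, by ext m; simp; ring⟩
  · exact ⟨a, b - t, c, by ext m; simp; ring⟩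
  · exact ⟨a, b, c - t, by ext m; simp; ring⟩

theorem InSpan.act_wordProd {i j k : B} {v : B → ℝ} (h : InSpan i j k v) (l : List B)
    (hl : ∀ m ∈ l, m = i ∨ m = j ∨ m = k) : InSpan i j k (act cs (cs.wordProd l) v) := by
  induction l with
  | nil => simpa using h
  | cons m l ih =>
    rw [cs.wordProd_cons, act_mul]
    exact (ih fun n hn => hl n (by simp [hn])).act_simple (hl m (by simp))

theorem one_le_of_twoDimensional (h2 : TwoDimensional cs) {i j k : B} (hij : i ≠ j) (hik : i ≠ k)
    (hjk : j ≠ k) :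
    1 ≤ cosM M j k ^ 2 + cosM M i k ^ 2 + cosM M i j ^ 2
      + 2 * cosM M j k * cosM M i k * cosM M i j := by
  by_contra hlt
  push Not at hlt
  have p1 := cosM_nonneg (M := M) hjk
  have p2 := cosM_nonneg (M := M) hik
  have p3 := cosM_nonneg (M := M) hij
  set c1 := cosM M j k with hc1
  set c2 := cosM M i k with hc2
  set c3 := cosM M i j with hc3
  set d := 1 - (c1 ^ 2 + c2 ^ 2 + c3 ^ 2 + 2 * c1 * c2 * c3) with hd
  have hdpos : 0 < d := by linarith
  have hQ : ∀ a b c : ℝ, bil M (a • root i + b • root j + c • root k)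
      (a • root i + b • root j + c • root k)
      = a ^ 2 + b ^ 2 + c ^ 2 - 2 * c3 * a * b - 2 * c2 * a * c - 2 * c1 * b * c := by
    intro a b c
    simp only [map_add, map_smul, LinearMap.smul_apply,
        LinearMap.add_apply, smul_eq_mul, bil_root_root, cosM_self, cosM_symm M j i,
        cosM_symm M k i, cosM_symm M k j, ← hc1, ← hc2, ← hc3]
    ring
  have h3 : 0 < 1 - c3 ^ 2 := by nlinarith [mul_nonneg (mul_nonneg p1 p2) p3]
  have hpsd : ∀ v, InSpan i j k v → 0 ≤ bil M v v := by
    rintro v ⟨a, b, c, rfl⟩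
    rw [hQ]
    have h4 : (1 - c3 ^ 2) * (a ^ 2 + b ^ 2 + c ^ 2 - 2 * c3 * a * b - 2 * c2 * a * c
        - 2 * c1 * b * c) = (1 - c3 ^ 2) * (a - c3 * b - c2 * c) ^ 2
        + ((1 - c3 ^ 2) * b - (c1 + c2 * c3) * c) ^ 2 + d * c ^ 2 := by rw [hd]; ring
    have h5 : 0 ≤ (1 - c3 ^ 2) * (a ^ 2 + b ^ 2 + c ^ 2 - 2 * c3 * a * b - 2 * c2 * a * c
        - 2 * c1 * b * c) := by rw [h4]; positivity
    exact nonneg_of_mul_nonneg_right h5 h3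
  set ρ : B → ℝ := ((1 - c1 ^ 2) + (c3 + c1 * c2) + (c2 + c1 * c3)) • root i
    + ((1 - c2 ^ 2) + (c3 + c1 * c2) + (c1 + c2 * c3)) • root j
    + ((1 - c3 ^ 2) + (c2 + c1 * c3) + (c1 + c2 * c3)) • root k with hρ
  have hρs : InSpan i j k ρ := ⟨_, _, _, rfl⟩
  have hρb : ∀ l, (l = i ∨ l = j ∨ l = k) → bil M ρ (root l) = d := by
    rintro l (rfl | rfl | rfl)
    · rw [hρ, bil_comb, cosM_self, cosM_symm M j l, cosM_symm M k l, ← hc2, ← hc3, hd]; ring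
    · rw [hρ, bil_comb, cosM_self, cosM_symm M k l, ← hc1, ← hc3, hd]; ring
    · rw [hρ, bil_comb, cosM_self, ← hc1, ← hc2, hd]; ring
  have hroot : ∀ v, InSpan i j k v → IsRt cs v → 0 ≤ v → d ≤ bil M ρ v := by
    rintro v ⟨a, b, c, rfl⟩ hv h0
    have hn := hv.bil_self
    rw [hQ] at hn
    have ha : 0 ≤ a := by
      have := h0 i
      simpa [root_self, root_of_ne hij, root_of_ne hik] using this
    have hb : 0 ≤ b := by
      have := h0 j
      simpa [root_self, root_of_ne hij.symm, root_of_ne hjk] using this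
    have hc : 0 ≤ c := by
      have := h0 k
      simpa [root_self, root_of_ne hik.symm, root_of_ne hjk.symm] using this
    simp only [map_add, map_smul, smul_eq_mul]
    rw [hρb i (by simp), hρb j (by simp), hρb k (by simp)]
    have h5 : 1 ≤ a + b + c := by
      have := mul_nonneg (mul_nonneg p3 ha) hb
      have := mul_nonneg (mul_nonneg p2 ha) hc
      have := mul_nonneg (mul_nonneg p1 hb) hc
      have := mul_nonneg ha hb
      have := mul_nonneg ha hc
      have := mul_nonneg hb hc
      nlinarith
    nlinarith
  have hword : ∀ l : List B, (∀ m ∈ l, m = i ∨ m = j ∨ m = k) → cs.IsReduced l →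
      bil M ρ (act cs (cs.wordProd l) ρ) ≤ bil M ρ ρ - 2 * l.length * d ^ 2 := by
    intro l
    induction l using List.reverseRecOn with
    | nil => intro _ _; simp
    | append_singleton l m ih =>
      intro hl hr
      have hl' : ∀ n ∈ l, n = i ∨ n = j ∨ n = k := fun n hn => hl n (by simp [hn])
      have hr' : cs.IsReduced l := by
        have := hr.take l.length
        simpa using this
      have hm := hl m (by simp)
      have h6 := ih hl' hr'
      have e : cs.wordProd (l ++ [m]) = cs.wordProd l * cs.simple m := by
        rw [cs.wordProd_append]; simp
      have hasc : cs.length (cs.wordProd l) < cs.length (cs.wordProd l * cs.simple m) := by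
        rw [← e, hr.eq, hr'.eq]; simp
      have hms : InSpan i j k (root m) := by
        rcases hm with rfl | rfl | rfl
        · exact ⟨1, 0, 0, by simp⟩
        · exact ⟨0, 1, 0, by simp⟩
        · exact ⟨0, 0, 1, by simp⟩
      have h7 := hroot _ (hms.act_wordProd l hl') ((isRt_root m).act (cs.wordProd l))
        (act_root_nonneg cs hasc)
      rw [e, act_mul, act_simple, hρb m hm, map_sub, map_sub, map_smul, map_smul, smul_eq_mul,
        List.length_append, List.length_singleton]
      push_cast
      nlinarith
  have hbound : ∀ l : List B, (∀ m ∈ l, m = i ∨ m = j ∨ m = k) → cs.IsReduced l →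
      (l.length : ℝ) ≤ bil M ρ ρ / d ^ 2 := by
    intro l hl hr
    have h6 := hword l hl hr
    have h7 := hpsd (ρ + act cs (cs.wordProd l) ρ) (by
      obtain ⟨a, b, c, e⟩ := hρs.act_wordProd (cs := cs) l hl
      obtain ⟨a', b', c', e'⟩ := hρs
      refine ⟨a' + a, b' + b, c' + c, ?_⟩
      rw [e, e']
      ext m; simp; ring)
    simp only [map_add, LinearMap.add_apply] at h7
    rw [bil_act, bil_symm (act cs (cs.wordProd l) ρ) ρ] at h7
    rw [le_div_iff₀ (by positivity)]
    linarith
  obtain ⟨N, hN⟩ := exists_nat_ge (bil M ρ ρ / d ^ 2)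
  have hinf := h2 i j k hij hik hjk
  apply Set.infinite_coe_iff.1 hinf
  refine ((List.finite_length_le B N).image cs.wordProd).subset ?_
  intro u hu
  have himg : ({cs.simple i, cs.simple j, cs.simple k} : Set W) = cs.simple '' {i, j, k} := by
    simp [Set.image_insert_eq]
  rw [SetLike.mem_coe, himg] at hu
  obtain ⟨l, hl, hr, e⟩ := exists_reduced_of_mem_closure hu
  refine ⟨l, ?_, e⟩
  have := (hbound l (by simpa using hl) hr).trans hN
  simpa using this

theorem not_three_descents (h2 : TwoDimensional cs) {x : W} {i j k : B} (hij : i ≠ j)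
    (hik : i ≠ k) (hjk : j ≠ k) (hi : act cs x (root i) ≤ 0) (hj : act cs x (root j) ≤ 0)
    (hk : act cs x (root k) ≤ 0) : False := by
  have hdet := one_le_of_twoDimensional h2 hij hik hjk
  have p1 := cosM_nonneg (M := M) hjk
  have p2 := cosM_nonneg (M := M) hik
  have p3 := cosM_nonneg (M := M) hij
  have q3 := cosM_le_one M i j
  have key : ∀ a b c : ℝ, 0 ≤ a → 0 ≤ b → 0 ≤ c →
      a ≤ b * cosM M i j + c * cosM M i k →
      b ≤ a * cosM M i j + c * cosM M j k →
      c ≤ a * cosM M i k + b * cosM M j k → a = 0 ∧ c = 0 := by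
    intro a b c ha hb hc h1 h2 h3
    have h4 := le_act_of_bil_nonpos (cs := cs) (bil_comb_nonpos ha hb hc h1 h2 h3) x
    have e1 := h4 i
    have e3 := h4 k
    have m1 := fun l => mul_nonpos_of_nonneg_of_nonpos ha (hi l)
    have m2 := fun l => mul_nonpos_of_nonneg_of_nonpos hb (hj l)
    have m3 := fun l => mul_nonpos_of_nonneg_of_nonpos hc (hk l)
    simp only [map_add, map_smul, Pi.add_apply, Pi.smul_apply, smul_eq_mul, root_self,
      root_of_ne hij, root_of_ne hik, root_of_ne hik.symm, root_of_ne hjk.symm] at e1 e3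
    constructor
    · linarith [m1 i, m2 i, m3 i]
    · linarith [m1 k, m2 k, m3 k]
  rcases q3.lt_or_eq with h | h
  · have := (key (cosM M i k + cosM M i j * cosM M j k) (cosM M j k + cosM M i j * cosM M i k)
      (1 - cosM M i j ^ 2) (by positivity) (by positivity) (by nlinarith)
      (by linarith) (by linarith) (by linarith)).2
    nlinarith
  · have := (key 1 1 0 (by norm_num) (by norm_num) le_rfl (by rw [h]; simp) (by rw [h]; simp)
      (by linarith)).1
    norm_num at this

end cone

section weak
variable {cs : CoxeterSystem M W}

/-- The right weak order. -/
def WeakLe (cs : CoxeterSystem M W) (z x : W) : Prop :=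
  cs.length z + cs.length (z⁻¹ * x) = cs.length x

theorem WeakLe.refl (x : W) : WeakLe cs x x := by simp [WeakLe]

theorem length_le_add_inv_mul (z x : W) :
    cs.length x ≤ cs.length z + cs.length (z⁻¹ * x) := by
  have := cs.length_mul_le z (z⁻¹ * x)
  rwa [mul_inv_cancel_left] at this

theorem WeakLe.trans {z y x : W} (h₁ : WeakLe cs z y) (h₂ : WeakLe cs y x) : WeakLe cs z x := by
  have h3 := cs.length_mul_le (z⁻¹ * y) (y⁻¹ * x)
  rw [mul_assoc, mul_inv_cancel_left] at h3
  have h4 := length_le_add_inv_mul (cs := cs) z x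
  rw [WeakLe] at *
  omega

theorem weakLe_of_length {z x : W} (w : List B) (hz : z = x * cs.wordProd w)
    (hl : cs.length z + w.length ≤ cs.length x) : WeakLe cs z x := by
  have h1 := length_le_add_inv_mul (cs := cs) z x
  have h2 : z⁻¹ * x = (cs.wordProd w)⁻¹ := by rw [hz]; group
  have h3 := cs.length_wordProd_le w
  have h4 : cs.length (z⁻¹ * x) = cs.length (cs.wordProd w) := by rw [h2, cs.length_inv]
  rw [WeakLe]
  omega

theorem WeakLe.eq_or {z x : W} (h : WeakLe cs z x) :
    z = x ∨ ∃ y, cs.IsRightDescent x y ∧ WeakLe cs z (x * cs.simple y) := by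
  by_cases h1 : z⁻¹ * x = 1
  · left; exact inv_mul_eq_one.1 h1
  right
  obtain ⟨y, hy⟩ := cs.exists_rightDescent_of_ne_one h1
  rw [cs.isRightDescent_iff] at hy
  have h2 := length_le_add_inv_mul (cs := cs) z (x * cs.simple y)
  have h3 := cs.length_mul_simple x y
  rw [← mul_assoc] at h2
  rw [WeakLe] at h
  refine ⟨y, ?_, ?_⟩
  · rw [cs.isRightDescent_iff]; omega
  · rw [WeakLe, ← mul_assoc]; omega

theorem weakLe_take {l : List B} (hl : cs.IsReduced l) (n : ℕ) :
    WeakLe cs (cs.wordProd (l.take n)) (cs.wordProd l) := by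
  have h : cs.wordProd l = cs.wordProd (l.take n) * cs.wordProd (l.drop n) := by
    rw [← cs.wordProd_append, List.take_append_drop]
  rw [WeakLe, h, inv_mul_cancel_left, ← h, hl.eq, (hl.take n).eq, (hl.drop n).eq, ← List.length_append,
    List.take_append_drop]

theorem not_isRightDescent_mul_self {x : W} {y : B} (h : cs.IsRightDescent x y) :
    ¬ cs.IsRightDescent (x * cs.simple y) y :=
  cs.isRightDescent_iff_not_isRightDescent_mul.1 h

theorem isRightDescent_iff_act {x : W} {y : B} :
    cs.IsRightDescent x y ↔ act cs x (root y) ≤ 0 := descent_iff cs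

theorem two_dim_descents (h2 : TwoDimensional cs) {x : W} {p t y : B} (hpt : p ≠ t)
    (hp : cs.IsRightDescent x p) (ht : cs.IsRightDescent x t) (hy : cs.IsRightDescent x y) :
    y = p ∨ y = t := by
  by_contra h
  push Not at h
  rw [isRightDescent_iff_act] at hp ht hy
  exact not_three_descents h2 hpt h.1.symm h.2.symm hp ht hy

end weak

section deviation
variable {cs : CoxeterSystem M W}

theorem braid_of_three {i j : B} (h : M i j = 3) :
    cs.simple i * cs.simple j * cs.simple i = cs.simple j * cs.simple i * cs.simple j := by
  have h1 := cs.wordProd_braidWord_eq i j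
  rw [braidWord, braidWord, ← M.symmetric i j, h] at h1
  simp [alternatingWord, cs.wordProd_cons] at h1
  simpa [mul_assoc] using h1.symm

theorem isRightDescent_mul_simple_of_cosM {x : W} {u p : B} (hc : cosM M u p = 0) :
    cs.IsRightDescent (x * cs.simple p) u ↔ cs.IsRightDescent x u := by
  rw [isRightDescent_iff_act, isRightDescent_iff_act, act_mul, act_simple_root, cosM_symm, hc]
  simp

variable {x : W} {s u v p : B} {U V P : ℝ}

theorem state_isRt (hx : act cs x (U • root u + V • root v + P • root p) = root s) :
    IsRt cs (U • root u + V • root v + P • root p) :=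
  ⟨x⁻¹, s, by rw [← hx, act_inv_act]⟩

theorem state_dom (hx : act cs x (U • root u + V • root v + P • root p) = root s)
    (hU : 0 ≤ U) (hV : 0 ≤ V) (hP : 0 ≤ P) {y : B} (hy : cs.IsRightDescent x y) :
    U * cosM M u y + V * cosM M v y + P * cosM M p y < 1 := by
  rw [isRightDescent_iff_act] at hy
  have h0 : 0 ≤ U • root u + V • root v + P • root p :=
    add_nonneg (add_nonneg (smul_nonneg hU (root_nonneg u)) (smul_nonneg hV (root_nonneg v)))
      (smul_nonneg hP (root_nonneg p))
  have := neg_one_lt_bil (state_isRt hx) h0 hx hy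
  rw [bil_comb] at this
  linarith

theorem state_new_letter (h2 : TwoDimensional cs)
    (hx : act cs x (U • root u + V • root v + P • root p) = root s) (hup : u ≠ p)
    (hc : cosM M u p = 0) (hU : 1 ≤ U) (hV : 0 ≤ V) (hP : 1 ≤ P) {y : B}
    (hy : cs.IsRightDescent x y) : y = u ∨ y = v ∨ y = p := by
  by_contra hno
  push Not at hno
  obtain ⟨h1, h3, h4⟩ := hno
  have hd := state_dom hx (by linarith) hV (by linarith) hy
  have hdet := one_le_of_twoDimensional h2 h1 h4 hup
  rw [hc, cosM_symm M y p, cosM_symm M y u] at hdet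
  have p1 := cosM_nonneg (M := M) h1.symm
  have p3 := cosM_nonneg (M := M) h3.symm
  have p4 := cosM_nonneg (M := M) h4.symm
  have q1 := cosM_le_one M u y
  have q4 := cosM_le_one M p y
  have := mul_nonneg hV p3
  nlinarith

theorem state_step_first (hx : act cs x (U • root u + V • root v + P • root p) = root s)
    (hc : cosM M u p = 0) :
    act cs (x * cs.simple u)
      ((2 * cosM M u v * V - U) • root u + V • root v + P • root p) = root s := by
  rw [act_mul, ← hx]
  congr 1
  rw [act_simple, bil_comb, cosM_self, cosM_symm M v u, cosM_symm M p u, hc]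
  ext j; simp; ring

theorem state_step_second (hx : act cs x (U • root u + V • root v + P • root p) = root s) :
    act cs (x * cs.simple v)
      (U • root u + (2 * cosM M u v * U + 2 * cosM M v p * P - V) • root v + P • root p)
      = root s := by
  rw [act_mul, ← hx]
  congr 1
  rw [act_simple, bil_comb, cosM_self, cosM_symm M p v]
  ext j; simp; ring

theorem state_step_third (hx : act cs x (U • root u + V • root v + P • root p) = root s)
    (hc : cosM M u p = 0) :
    act cs (x * cs.simple p)
      (U • root u + V • root v + (2 * cosM M v p * V - P) • root p) = root s := by
  rw [act_mul, ← hx]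
  congr 1
  rw [act_simple, bil_comb, cosM_self, hc]
  ext j; simp; ring

theorem state_cone (huv : u ≠ v) (hup : u ≠ p) (hvp : v ≠ p)
    (hx : act cs x (U • root u + V • root v + P • root p) = root s)
    {y₁ y₂ : B} (h₁ : cs.IsRightDescent x y₁) (h₂ : cs.IsRightDescent x y₂)
    {a b₁ b₂ U' V' P' : ℝ} (hb₁ : 0 ≤ b₁) (hb₂ : 0 ≤ b₂)
    (e : U' • root u + V' • root v + P' • root p
      = a • (U • root u + V • root v + P • root p) + b₁ • root y₁ + b₂ • root y₂)
    (hU : 0 < U') (hV : 0 < V') (hP : 0 ≤ P')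
    (hu' : U' ≤ V' * cosM M u v + P' * cosM M u p)
    (hv' : V' ≤ U' * cosM M u v + P' * cosM M v p)
    (hp' : P' ≤ U' * cosM M u p + V' * cosM M v p) : False := by
  rw [isRightDescent_iff_act] at h₁ h₂
  refine not_mem_cone hx h₁ h₂ hb₁ hb₂ e (bil_comb_nonpos hU.le hV.le hP hu' hv' hp') huv ?_ ?_
  · simpa [root_self, root_of_ne huv, root_of_ne hup] using hU
  · simpa [root_self, root_of_ne huv.symm, root_of_ne hvp] using hV

theorem weakLe_swap {z : W} (hc : cosM M u p = 0) (hup : u ≠ p)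
    (hu : cs.IsRightDescent x u) (hp : cs.IsRightDescent x p)
    (hz : WeakLe cs z (x * cs.simple p * cs.simple u)) : WeakLe cs z (x * cs.simple u) := by
  have hpu := (isRightDescent_mul_simple_of_cosM (cs := cs) (x := x) hc).2 hu
  rw [cs.isRightDescent_iff] at hu hp hpu
  refine hz.trans (weakLe_of_length [p] ?_ ?_)
  · simp [mul_assoc, simple_comm_of_cosM_eq_zero cs hup hc]
  · simp only [List.length_singleton]; omega

theorem deviation_last (h2 : TwoDimensional cs) (huv : u ≠ v) (hup : u ≠ p) (hvp : v ≠ p)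
    (hc : cosM M u p = 0)
    (hx : act cs x ((2 * cosM M u v) • root u + (1 : ℝ) • root v + (0 : ℝ) • root p) = root s)
    (hC : 1 / 2 ≤ cosM M u v) (hcv : 1 / 2 ≤ cosM M v p)
    (hdet : 1 ≤ cosM M u v ^ 2 + cosM M v p ^ 2)
    (hu : cs.IsRightDescent x u) (hp : cs.IsRightDescent x p) {z : W}
    (hz : WeakLe cs z (x * cs.simple p)) :
    WeakLe cs z (x * cs.simple u) ∨ z = x * cs.simple p := by
  rcases hz.eq_or with h | ⟨y, hy, hzy⟩
  · exact Or.inr h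
  left
  have hx' := state_step_third hx hc
  rcases state_new_letter h2 hx' hup hc (by linarith) (by linarith) (by linarith) hy with
    rfl | rfl | rfl
  · exact weakLe_swap hc hup hu hp hzy
  · exfalso
    refine state_cone huv hup hvp hx' hy hy (a := 1) (b₁ := 1) (b₂ := 0)
      (U' := 2 * cosM M u y) (V' := 2) (P' := 2 * cosM M y p) (by norm_num) (by norm_num)
      ?_ ?_ ?_ ?_ ?_ ?_ ?_
    · ext j; simp; ring
    · linarith
    · linarith
    · linarith
    · rw [hc]; linarith
    · nlinarith
    · rw [hc]; linarith
  · exact absurd hy (not_isRightDescent_mul_self hp)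

theorem deviation_second_last (h2 : TwoDimensional cs) (huv : u ≠ v) (hup : u ≠ p)
    (hvp : v ≠ p) (hc : cosM M u p = 0)
    (hx : act cs x ((4 * cosM M u v ^ 2 - 1) • root u + (2 * cosM M u v) • root v
      + (0 : ℝ) • root p) = root s)
    (hC0 : 0 < cosM M u v) (hC : 3 / 4 ≤ cosM M u v ^ 2) (hcv : cosM M v p = 1 / 2)
    (hu : cs.IsRightDescent x u) (hp : cs.IsRightDescent x p) {z : W}
    (hz : WeakLe cs z (x * cs.simple p)) :
    WeakLe cs z (x * cs.simple u) ∨ z = x * cs.simple p := by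
  rcases hz.eq_or with h | ⟨y, hy, hzy⟩
  · exact Or.inr h
  left
  have hx' := state_step_third hx hc
  have h1 : 1 / 2 ≤ cosM M u v := by nlinarith
  rcases state_new_letter h2 hx' hup hc (by linarith) (by linarith) (by rw [hcv]; linarith) hy with
    rfl | rfl | rfl
  · exact weakLe_swap hc hup hu hp hzy
  · exfalso
    refine state_cone huv hup hvp hx'
      ((isRightDescent_mul_simple_of_cosM (cs := cs) (x := x) hc).2 hu) hy
      (a := 1) (b₁ := 1) (b₂ := 2 * cosM M u y)
      (U' := 4 * cosM M u y ^ 2) (V' := 4 * cosM M u y) (P' := 2 * cosM M u y)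
      (by norm_num) (by linarith) ?_ ?_ ?_ ?_ ?_ ?_ ?_
    · rw [hcv]; ext j; simp; ring
    · linarith
    · linarith
    · linarith
    · rw [hc]; linarith
    · rw [hcv]; nlinarith
    · rw [hc, hcv]; linarith
  · exact absurd hy (not_isRightDescent_mul_self hp)

theorem deviation_first_false (huv : u ≠ v) (hup : u ≠ p)
    (hvp : v ≠ p) (hc : cosM M u p = 0)
    (hx : act cs x ((1 : ℝ) • root u + (2 * cosM M u v) • root v
      + (0 : ℝ) • root p) = root s)
    (hC0 : 0 < cosM M u v) (hC : 3 / 4 ≤ cosM M u v ^ 2) (hcv : cosM M v p = 1 / 2)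
    (hu : cs.IsRightDescent x u) (hp : cs.IsRightDescent x p) : False := by
  refine state_cone huv hup hvp hx hu hp
    (a := 1) (b₁ := 2 * cosM M u v ^ 2 - 1) (b₂ := cosM M u v)
    (U' := 2 * cosM M u v ^ 2) (V' := 2 * cosM M u v) (P' := cosM M u v)
    (by linarith) (by linarith) ?_ ?_ ?_ ?_ ?_ ?_ ?_
  · ext j; simp; ring
  · linarith
  · linarith
  · linarith
  · rw [hc]; linarith
  · rw [hcv]; nlinarith
  · rw [hc, hcv]; linarith

theorem deviation_second_false (huv : u ≠ v) (hup : u ≠ p)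
    (hvp : v ≠ p) (hc : cosM M u p = 0)
    (hx : act cs x ((4 * cosM M u v ^ 2 - 1) • root u + (2 * cosM M u v) • root v
      + (0 : ℝ) • root p) = root s)
    (hC0 : 0 < cosM M u v) (hC : 3 / 4 ≤ cosM M u v ^ 2) (hcv : cosM M v p = 1 / 2)
    (hv : cs.IsRightDescent x v) (hp : cs.IsRightDescent x p) : False := by
  refine state_cone huv hup hvp hx hv hp
    (a := 2 * cosM M u v) (b₁ := 4 * cosM M u v ^ 2 - 2) (b₂ := 4 * cosM M u v ^ 2 - 1)
    (U' := 2 * cosM M u v * (4 * cosM M u v ^ 2 - 1)) (V' := 2 * (4 * cosM M u v ^ 2 - 1))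
    (P' := 4 * cosM M u v ^ 2 - 1)
    (by linarith) (by linarith) ?_ ?_ ?_ ?_ ?_ ?_ ?_
  · ext j; simp; ring
  · have : 0 < 4 * cosM M u v ^ 2 - 1 := by linarith
    positivity
  · linarith
  · linarith
  · rw [hc]; linarith
  · rw [hcv]; nlinarith
  · rw [hc, hcv]; linarith

theorem deviation_crossed (h2 : TwoDimensional cs) (huv : u ≠ v) (hup : u ≠ p)
    (hvp : v ≠ p) (hc : cosM M u p = 0)
    (hx : act cs x ((1 : ℝ) • root u + (2 * cosM M u v) • root v
      + (0 : ℝ) • root p) = root s)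
    (hC0 : 0 < cosM M u v) (hC : 3 / 4 ≤ cosM M u v ^ 2) (hcv : cosM M v p = 1 / 2)
    (h3 : M v p = 3) (hv : cs.IsRightDescent x v) (hp : cs.IsRightDescent x p) {z : W}
    (hz : WeakLe cs z (x * cs.simple p)) :
    WeakLe cs z (x * cs.simple v) ∨ cs.length x ≤ cs.length z + 5 := by
  have hC2 : 1 / 2 ≤ cosM M u v := by nlinarith
  have comm : cs.simple u * cs.simple p = cs.simple p * cs.simple u :=
    simple_comm_of_cosM_eq_zero cs hup hc
  have braid := braid_of_three (cs := cs) h3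
  have lv := (cs.isRightDescent_iff).1 hv
  have lp := (cs.isRightDescent_iff).1 hp
  have hx1 := state_step_third hx hc
  rw [show 2 * cosM M v p * (2 * cosM M u v) - 0 = 2 * cosM M u v by rw [hcv]; ring] at hx1
  rcases hz.eq_or with h | ⟨y, hy, hz⟩
  · right; rw [h]; omega
  have ly := (cs.isRightDescent_iff).1 hy
  rcases state_new_letter h2 hx1 hup hc le_rfl (by linarith) (by linarith) hy with
    rfl | rfl | rfl
  · rcases two_dim_descents h2 hvp hv hp ((isRightDescent_mul_simple_of_cosM hc).1 hy) with h | h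
    · exact absurd h huv
    · exact absurd h hup
  swap
  · exact absurd hy (not_isRightDescent_mul_self hp)
  have hx2 := state_step_second hx1
  rw [show 2 * cosM M u y * 1 + 2 * cosM M y p * (2 * cosM M u y) - 2 * cosM M u y
    = 2 * cosM M u y by rw [hcv]; ring] at hx2
  rcases hz.eq_or with h | ⟨w, hw, hz⟩
  · right; rw [h]; omega
  have lw := (cs.isRightDescent_iff).1 hw
  rcases state_new_letter h2 hx2 hup hc le_rfl (by linarith) (by linarith) hw with
    rfl | rfl | rfl
  rotate_left
  · exact absurd hw (not_isRightDescent_mul_self hy)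
  · left
    refine hz.trans (weakLe_of_length [w, y] ?_ (by simp; omega))
    simp only [cs.wordProd_cons, cs.wordProd_nil, mul_one]
    simp only [mul_assoc] at braid ⊢
    rw [braid]
  have hx3 := state_step_first hx2 hc
  rw [show 2 * cosM M w y * (2 * cosM M w y) - 1 = 4 * cosM M w y ^ 2 - 1 by ring] at hx3
  rcases hz.eq_or with h | ⟨a, ha, hz⟩
  · right; rw [h]; omega
  have la := (cs.isRightDescent_iff).1 ha
  rcases state_new_letter h2 hx3 hup hc (by linarith) (by linarith) (by linarith) ha with
    rfl | rfl | rfl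
  · exact absurd ha (not_isRightDescent_mul_self hw)
  swap
  · left
    refine hz.trans (weakLe_of_length [a, y, w] ?_ (by simp; omega))
    simp only [cs.wordProd_cons, cs.wordProd_nil, mul_one]
    rw [mul_assoc _ (cs.simple w), comm]
    simp only [← mul_assoc] at braid ⊢
    rw [mul_assoc x, mul_assoc x, ← braid]
    simp only [← mul_assoc]
  have hx4 := state_step_second hx3
  rw [show 2 * cosM M w a * (4 * cosM M w a ^ 2 - 1) + 2 * cosM M a p * (2 * cosM M w a)
    - 2 * cosM M w a = 8 * cosM M w a ^ 3 - 2 * cosM M w a by rw [hcv]; ring] at hx4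
  have hV4 : 0 ≤ 8 * cosM M w a ^ 3 - 2 * cosM M w a := by nlinarith
  have hP5 : 1 ≤ 8 * cosM M w a ^ 3 - 4 * cosM M w a := by nlinarith
  have hdomu : ∀ P : ℝ, ¬ ((4 * cosM M w a ^ 2 - 1) * cosM M w w
      + (8 * cosM M w a ^ 3 - 2 * cosM M w a) * cosM M a w + P * cosM M p w < 1) := by
    intro P
    rw [cosM_self, cosM_symm M p w, hc, cosM_symm M a w]
    nlinarith
  rcases hz.eq_or with h | ⟨b, hb, hz⟩
  · right; rw [h]; omega
  have lb := (cs.isRightDescent_iff).1 hb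
  rcases state_new_letter h2 hx4 hup hc (by linarith) hV4 (by linarith) hb with
    rfl | rfl | rfl
  · exact absurd (state_dom hx4 (by linarith) hV4 (by linarith) hb) (hdomu _)
  · exact absurd hb (not_isRightDescent_mul_self ha)
  have hx5 := state_step_third hx4 hc
  rw [show 2 * cosM M a b * (8 * cosM M w a ^ 3 - 2 * cosM M w a) - 2 * cosM M w a
    = 8 * cosM M w a ^ 3 - 4 * cosM M w a by rw [hcv]; ring] at hx5
  rcases hz.eq_or with h | ⟨d, hd, hz⟩
  · right; rw [h]; omega
  have ld := (cs.isRightDescent_iff).1 hd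
  rcases state_new_letter h2 hx5 hup hc (by linarith) hV4 (by linarith) hd with
    rfl | rfl | rfl
  · exact absurd (state_dom hx5 (by linarith) hV4 (by linarith) hd) (hdomu _)
  swap
  · exact absurd hd (not_isRightDescent_mul_self hb)
  left
  refine hz.trans (weakLe_of_length [b, d, w, d, b] ?_ (by simp; omega))
  simp only [cs.wordProd_cons, cs.wordProd_nil, mul_one, mul_assoc] at braid ⊢
  have comm' : ∀ g, cs.simple w * (cs.simple b * g) = cs.simple b * (cs.simple w * g) := by
    intro g; rw [← mul_assoc, comm, mul_assoc]
  have braid' : ∀ g, cs.simple d * (cs.simple b * (cs.simple d * g))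
      = cs.simple b * (cs.simple d * (cs.simple b * g)) := by
    intro g; simp only [← mul_assoc] at braid ⊢; rw [braid]
  rw [braid, comm', ← braid']

theorem deviation (h2 : TwoDimensional cs) {t t' : B} {k : ℕ} (htt : t ≠ t') (hpt : p ≠ t)
    (hpt' : p ≠ t') (hk : 1 ≤ k) (hm0 : M t t' ≠ 0) (hkm : k + 2 ≤ M t t')
    (hx : act cs x (chebA (cosM M t t') k • root t + chebA (cosM M t t') (k + 1) • root t')
      = root s)
    (ht : cs.IsRightDescent x t) (hp : cs.IsRightDescent x p)
    (hfirst : k = 1 → ¬ cs.IsRightDescent (x * cs.simple t') p) {z : W}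
    (hz : WeakLe cs z (x * cs.simple p)) :
    WeakLe cs z (x * cs.simple t) ∨ cs.length x ≤ cs.length z + 5 := by
  have lp := (cs.isRightDescent_iff).1 hp
  have hC1 := cosM_lt_one hm0
  have hC0 := cosM_nonneg (M := M) htt
  have mono := fun i j => chebA_cosM_mono htt hm0 (k := i) (n := j)
  have ak := mono 1 k hk (by omega)
  have ak1 := mono 1 (k + 1) (by omega) (by omega)
  have a2 := chebA_two (cosM M t t')
  have a3 := chebA_three (cosM M t t')
  rw [chebA_one] at ak ak1
  have hC : 1 / 2 ≤ cosM M t t' := by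
    have := mono 1 2 (by omega) (by omega)
    rw [chebA_one, a2] at this
    linarith
  have hC4 : 4 ≤ M t t' → 1 / 2 ≤ cosM M t t' ^ 2 := by
    intro h
    have := mono 1 3 (by omega) (by omega)
    rw [chebA_one, a3] at this
    linarith
  have hx0 : act cs x (chebA (cosM M t t') k • root t + chebA (cosM M t t') (k + 1) • root t'
      + (0 : ℝ) • root p) = root s := by simpa using hx
  have hdom := state_dom hx0 (by linarith) (by linarith) le_rfl hp
  rw [zero_mul, add_zero] at hdom
  have hdet := one_le_of_twoDimensional h2 htt hpt.symm hpt'.symm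
  have n1 := cosM_nonneg (M := M) hpt.symm
  have n2 := cosM_nonneg (M := M) hpt'.symm
  have hsum : cosM M t p + cosM M t' p < 1 := by nlinarith
  -- the possible values of `c = cosM v p` once the coefficient of `v` is not `1`
  have small : ∀ V c : ℝ, 0 ≤ c → 4 ≤ M t t' → 2 * cosM M t t' ≤ V → V * c < 1 →
      1 ≤ c ^ 2 + cosM M t t' ^ 2 → ¬ (1 / 2 ≤ c ^ 2) := by
    intro V c hc0 h4 hV hVc hd hc
    have h5 := hC4 h4
    have h6 : 2 * cosM M t t' * c < 1 := by nlinarith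
    have h7 : 1 ≤ (2 * cosM M t t' * c) ^ 2 := by nlinarith
    have h8 : 0 ≤ 2 * cosM M t t' * c := by positivity
    nlinarith
  have large : 3 / 4 ≤ cosM M t t' ^ 2 → ∀ i, 3 ≤ i → i + 3 ≤ M t t' →
      2 ≤ chebA (cosM M t t') i := by
    intro h i h3 h4
    have := mono 3 i h3 h4
    rw [a3] at this
    linarith
  have sub := fun i => chebA_cosM_sub htt hm0 (n := i)
  rcases cosM_cases (M := M) hpt.symm with ⟨_, h0⟩ | ht0
  -- `p` commutes with the next letter
  · rw [h0] at hdet hdom hsum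
    have hd : 1 ≤ cosM M t' p ^ 2 + cosM M t t' ^ 2 := by linarith
    rcases eq_or_ne (k + 2) (M t t') with hkm2 | hkm2
    · have e1 : chebA (cosM M t t') k = 2 * cosM M t t' := by
        rw [← a2, ← sub 2 (by omega)]; congr 1; omega
      have e2 : chebA (cosM M t t') (k + 1) = 1 := by
        rw [← chebA_one (cosM M t t'), ← sub 1 (by omega)]; congr 1; omega
      rw [e1, e2] at hx0
      have hcv : 1 / 2 ≤ cosM M t' p := by
        rcases cosM_cases (M := M) hpt'.symm with ⟨_, h⟩ | ⟨_, h⟩ | ⟨_, _, _, h⟩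
        · rw [h] at hd; nlinarith
        · linarith
        · linarith
      rcases deviation_last h2 htt hpt.symm hpt'.symm h0 hx0 hC hcv (by linarith) ht hp hz with h | h
      · exact Or.inl h
      · right; rw [h]; omega
    · have hV : 2 * cosM M t t' ≤ chebA (cosM M t t') (k + 1) := by
        rw [← a2]; exact mono 2 (k + 1) (by omega) (by omega)
      have hVc : chebA (cosM M t t') (k + 1) * cosM M t' p < 1 := by linarith
      rcases cosM_cases (M := M) hpt'.symm with ⟨_, h⟩ | ⟨_, h⟩ | ⟨_, _, h, _⟩
      · rw [h] at hd; nlinarith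
      · have hC34 : 3 / 4 ≤ cosM M t t' ^ 2 := by rw [h] at hd; linarith
        by_cases hk1 : k = 1
        · subst hk1
          rw [chebA_one, show 1 + 1 = 2 from rfl, a2] at hx0
          exact (deviation_first_false htt hpt.symm hpt'.symm h0 hx0 (by linarith) hC34 h
            ht hp).elim
        by_cases hk3 : k + 3 = M t t'
        · have e1 : chebA (cosM M t t') k = 4 * cosM M t t' ^ 2 - 1 := by
            rw [← a3, ← sub 3 (by omega)]; congr 1; omega
          have e2 : chebA (cosM M t t') (k + 1) = 2 * cosM M t t' := by
            rw [← a2, ← sub 2 (by omega)]; congr 1; omega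
          rw [e1, e2] at hx0
          rcases deviation_second_last h2 htt hpt.symm hpt'.symm h0 hx0 (by linarith) hC34 h ht hp hz
            with h | h
          · exact Or.inl h
          · right; rw [h]; omega
        · have := large hC34 (k + 1) (by omega) (by omega)
          rw [h] at hVc
          linarith
      · exact (small _ _ n2 (by omega) hV hVc hd h).elim
  -- `p` commutes with the last letter
  · have ht1 : 1 / 2 ≤ cosM M t p := by
      rcases ht0 with ⟨_, h⟩ | ⟨_, _, _, h⟩ <;> linarith
    have h0 : cosM M t' p = 0 := by
      rcases cosM_cases (M := M) hpt'.symm with ⟨_, h⟩ | ⟨_, h⟩ | ⟨_, _, _, h⟩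
      · exact h
      · linarith
      · linarith
    rw [h0] at hdet hdom hsum
    have hd : 1 ≤ cosM M t p ^ 2 + cosM M t t' ^ 2 := by linarith
    by_cases hk1 : k = 1
    · exfalso
      apply hfirst hk1
      exact (isRightDescent_mul_simple_of_cosM (by rw [cosM_symm, h0])).2 hp
    have hV : 2 * cosM M t t' ≤ chebA (cosM M t t') k := by
      rw [← a2]; exact mono 2 k (by omega) (by omega)
    have hVc : chebA (cosM M t t') k * cosM M t p < 1 := by linarith
    rcases ht0 with ⟨h3, h⟩ | ⟨_, _, h, _⟩
    · have hC34 : 3 / 4 ≤ cosM M t t' ^ 2 := by rw [h] at hd; linarith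
      rw [add_comm (_ • root t), cosM_symm M t t'] at hx0
      rw [cosM_symm M t t'] at hC34 hC
      by_cases hk2 : k = 2
      · subst hk2
        rw [show 2 + 1 = 3 from rfl, chebA_two, chebA_three] at hx0
        exact (deviation_second_false htt.symm hpt'.symm hpt.symm h0 hx0 (by linarith) hC34 h
          ht hp).elim
      by_cases hkm2 : k + 2 = M t t'
      · have e1 : chebA (cosM M t' t) k = 2 * cosM M t' t := by
          rw [cosM_symm M t' t, ← a2, ← sub 2 (by omega)]; congr 1; omega
        have e2 : chebA (cosM M t' t) (k + 1) = 1 := by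
          rw [cosM_symm M t' t, ← chebA_one (cosM M t t'), ← sub 1 (by omega)]; congr 1; omega
        rw [e1, e2] at hx0
        exact deviation_crossed h2 htt.symm hpt'.symm hpt.symm h0 hx0 (by linarith) hC34 h h3
          ht hp hz
      · have := large (by rwa [cosM_symm]) k (by omega) (by omega)
        rw [h] at hVc
        linarith
    · exact (small _ _ n1 (by omega) hV hVc hd h).elim

end deviation

section longest
variable {cs : CoxeterSystem M W}

theorem act_wordProd_apply_of_not_mem {J : Set B} {l : List B} (hl : ∀ i ∈ l, i ∈ J)
    {v : B → ℝ} {j : B} (hj : j ∉ J) : act cs (cs.wordProd l) v j = v j := by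
  induction l with
  | nil => simp
  | cons a l ih =>
    rw [cs.wordProd_cons, act_mul, act_simple_apply_of_ne, ih fun i hi => hl i (by simp [hi])]
    rintro rfl
    exact hj (hl j (by simp))

theorem eq_sum_root (v : B → ℝ) : v = ∑ i, v i • root i := by
  ext j
  simp [root, Pi.single_apply]

theorem act_nonpos_of_support {g : W} {v : B → ℝ} (h0 : 0 ≤ v)
    (hv : ∀ j, j ∉ descentSet cs g → v j = 0) : act cs g v ≤ 0 := by
  rw [eq_sum_root v, map_sum]
  refine Finset.sum_nonpos fun i _ => ?_
  rw [map_smul]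
  by_cases hi : i ∈ descentSet cs g
  · exact smul_nonpos_of_nonneg_of_nonpos (h0 i) ((descent_iff cs).1 hi)
  · rw [hv i hi, zero_smul]

theorem length_mul_wordProd {g : W} {l : List B} (hl : ∀ i ∈ l, i ∈ descentSet cs g)
    (hr : cs.IsReduced l) : cs.length (g * cs.wordProd l) + l.length = cs.length g := by
  induction l using List.reverseRecOn with
  | nil => simp
  | append_singleton l a ih =>
    have hl' : ∀ i ∈ l, i ∈ descentSet cs g := fun i hi => hl i (by simp [hi])
    have hr' : cs.IsReduced l := by simpa using hr.take l.length
    have h1 := ih hl' hr'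
    have e : cs.wordProd (l ++ [a]) = cs.wordProd l * cs.simple a := by
      rw [cs.wordProd_append]; simp
    have h2 : 0 ≤ act cs (cs.wordProd l) (root a) := by
      rw [← ascent_iff, ← e, hr.eq, hr'.eq]; simp
    have h3 : act cs g (act cs (cs.wordProd l) (root a)) ≤ 0 := by
      refine act_nonpos_of_support h2 fun j hj => ?_
      rw [act_wordProd_apply_of_not_mem hl' hj, root_of_ne]
      rintro rfl
      exact hj (hl j (by simp))
    rw [← act_mul, ← descent_iff] at h3
    have h4 := cs.length_mul_simple (g * cs.wordProd l) a
    rw [e, ← mul_assoc, List.length_append, List.length_singleton]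
    omega

theorem length_mul_of_mem_descSubgroup {g u : W} (hu : u ∈ descSubgroup cs g) :
    cs.length (g * u) + cs.length u = cs.length g := by
  obtain ⟨l, hl, hr, rfl⟩ := exists_reduced_of_mem_closure hu
  rw [hr.eq, length_mul_wordProd hl hr]

theorem wg_spec (g : W) :
    wg cs g ∈ descSubgroup cs g ∧ ∀ u ∈ descSubgroup cs g, cs.length u ≤ cs.length (wg cs g) := by
  have h : ∃ w₀ ∈ descSubgroup cs g, ∀ u ∈ descSubgroup cs g, cs.length u ≤ cs.length w₀ := by
    have hb : BddAbove (cs.length '' (descSubgroup cs g : Set W)) := by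
      refine ⟨cs.length g, ?_⟩
      rintro _ ⟨u, hu, rfl⟩
      have := length_mul_of_mem_descSubgroup hu
      omega
    have hn : (descSubgroup cs g : Set W).Nonempty := ⟨1, one_mem _⟩
    obtain ⟨w, hw, e⟩ := Nat.sSup_mem (hn.image cs.length) hb
    exact ⟨w, hw, fun u hu => e ▸ le_csSup hb ⟨u, hu, rfl⟩⟩
  rw [wg, dif_pos h]
  exact h.choose_spec

theorem simple_mem_descSubgroup {g : W} {r : B} (hr : cs.IsRightDescent g r) :
    cs.simple r ∈ descSubgroup cs g :=
  Subgroup.subset_closure ⟨r, hr, rfl⟩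

theorem length_mul_wg_inv (g : W) :
    cs.length (g * (wg cs g)⁻¹) + cs.length (wg cs g) = cs.length g := by
  have := length_mul_of_mem_descSubgroup (inv_mem (wg_spec (cs := cs) g).1)
  rwa [cs.length_inv] at this

theorem length_wg_pos {g : W} (hg : g ≠ 1) : 1 ≤ cs.length (wg cs g) := by
  obtain ⟨r, hr⟩ := cs.exists_rightDescent_of_ne_one hg
  have := (wg_spec g).2 _ (simple_mem_descSubgroup hr)
  rwa [cs.length_simple] at this

theorem wg_congr {g h : W} (e : descentSet cs g = descentSet cs h) : wg cs g = wg cs h := by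
  have e' : descSubgroup cs g = descSubgroup cs h := by rw [descSubgroup, e, descSubgroup]
  unfold wg
  rw [e']

variable (cs) in
theorem exists_length_wg_le : ∃ K, ∀ g, cs.length (wg cs g) ≤ K := by
  have hf : ∀ J : Set B, ∃ K, ∀ g, descentSet cs g = J → cs.length (wg cs g) ≤ K := by
    intro J
    by_cases h : ∃ g, descentSet cs g = J
    · obtain ⟨g, hg⟩ := h
      exact ⟨cs.length (wg cs g), fun g' hg' => (wg_congr (hg'.trans hg.symm)) ▸ le_rfl⟩
    · push Not at h
      exact ⟨0, fun g hg => absurd hg (h g)⟩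
  choose F hF using hf
  obtain ⟨K, hK⟩ := (Set.finite_range F).bddAbove
  exact ⟨K, fun g => (hF _ g rfl).trans (hK ⟨_, rfl⟩)⟩

theorem weakLe_mul_wg_inv {h : W} {r : B} (hr : cs.IsRightDescent h r) :
    WeakLe cs (h * (wg cs h)⁻¹) (h * cs.simple r) := by
  have h1 := (wg_spec h).2 _ (mul_mem (wg_spec h).1 (simple_mem_descSubgroup hr))
  have h2 := cs.length_mul_simple (wg cs h) r
  have h3 := length_mul_wg_inv (cs := cs) h
  rw [cs.isRightDescent_iff] at hr
  have e : (h * (wg cs h)⁻¹)⁻¹ * (h * cs.simple r) = wg cs h * cs.simple r := by group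
  rw [WeakLe, e]
  omega

theorem StdLang.isReduced {v : List B} (hv : StdLang cs v) : cs.IsReduced v := by
  induction hv with
  | nil => simp [CoxeterSystem.IsReduced]
  | step v hne hpre hsuf ih =>
    set k := cs.length (wg cs (cs.wordProd v)) with hk
    have e : cs.wordProd (v.take (v.length - k)) = cs.wordProd v * (wg cs (cs.wordProd v))⁻¹ := by
      rw [eq_mul_inv_iff_mul_eq, ← hsuf, ← cs.wordProd_append, List.take_append_drop]
    have h1 := length_mul_wg_inv (cs := cs) (cs.wordProd v)
    have h2 := cs.length_wordProd_le v
    rw [CoxeterSystem.IsReduced, e, List.length_take] at ih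
    rw [CoxeterSystem.IsReduced]
    omega

theorem StdLang.exists_prefix {v : List B} (hv : StdLang cs v) (h1 : cs.wordProd v ≠ 1) :
    ∃ m, m + cs.length (wg cs (cs.wordProd v)) = cs.length (cs.wordProd v) ∧
      StdLang cs (v.take m) ∧
      cs.wordProd (v.take m) = cs.wordProd v * (wg cs (cs.wordProd v))⁻¹ := by
  have hr := hv.isReduced
  cases hv with
  | nil => simp at h1
  | step _ hne hpre hsuf =>
    refine ⟨_, ?_, hpre, ?_⟩
    · have h1 := length_mul_wg_inv (cs := cs) (cs.wordProd v)
      rw [hr.eq] at *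
      omega
    · have e := congrArg (cs.wordProd (v.take (v.length - cs.length (wg cs (cs.wordProd v)))) * ·)
        hsuf
      simp only [← cs.wordProd_append, List.take_append_drop] at e
      rw [eq_mul_inv_iff_mul_eq, ← e]

end longest

section chain
variable {cs : CoxeterSystem M W}

/-- A position, at depth `k`, on the gallery that goes down around a residue of type `{t, t'}`
from one panel of the wall of `s` to the opposite one. -/
structure GalleryState (cs : CoxeterSystem M W) (s : B) (C : ℝ) (m : ℕ) (X Y : B → ℝ) (k : ℕ)
    (f : W) (t t' : B) : Prop where
  ne : t ≠ t'
  cosM_eq : cosM M t t' = C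
  order_eq : M t t' = m
  next : act cs f (root t) = chebA C (k + 1) • X + chebA C (k + 2) • Y
  last : act cs f (root t') = -(chebA C k • X + chebA C (k + 1) • Y)
  wall : act cs f (chebA C k • root t + chebA C (k + 1) • root t') = root s

variable {s t t' : B} {C : ℝ} {m k : ℕ} {X Y : B → ℝ} {f : W}

theorem GalleryState.step (h : GalleryState cs s C m X Y k f t t') :
    GalleryState cs s C m X Y (k + 1) (f * cs.simple t) t' t where
  ne := h.ne.symm
  cosM_eq := by rw [cosM_symm, h.cosM_eq]
  order_eq := by rw [M.symmetric, h.order_eq]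
  next := by
    rw [act_mul, act_simple_root, h.cosM_eq, map_add, map_smul, h.next, h.last,
      chebA_add_two C (k + 1), chebA_add_two C k]
    module
  last := by rw [act_mul_simple_root_self, h.next]
  wall := by
    rw [← h.wall, act_mul]
    rw [map_add, map_smul, map_smul, act_simple_root, act_simple_root_self, h.cosM_eq]
    congr 1
    rw [chebA_add_two C k]
    module

theorem GalleryState.chebA_nonneg (h : GalleryState cs s C m X Y k f t t') {n : ℕ}
    (hn : m ≠ 0 → n ≤ m) : 0 ≤ chebA C n := by
  rw [← h.cosM_eq]
  exact chebA_cosM_nonneg h.ne (by rw [h.order_eq]; exact hn)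

theorem GalleryState.isRightDescent (h : GalleryState cs s C m X Y k f t t') (hX : X ≤ 0)
    (hY : Y ≤ 0) (hk : m ≠ 0 → k + 2 ≤ m) : cs.IsRightDescent f t := by
  rw [isRightDescent_iff_act, h.next]
  have h1 : 0 ≤ chebA C (k + 1) := h.chebA_nonneg fun h0 => by have := hk h0; omega
  have h2 : 0 ≤ chebA C (k + 2) := h.chebA_nonneg hk
  exact add_nonpos (smul_nonpos_of_nonneg_of_nonpos h1 hX)
    (smul_nonpos_of_nonneg_of_nonpos h2 hY)

theorem GalleryState.not_isRightDescent (h : GalleryState cs s C m X Y k f t t') (hX : X ≤ 0)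
    (hY : Y ≤ 0) (hk : m ≠ 0 → k + 1 ≤ m) : ¬ cs.IsRightDescent f t' := by
  rw [isRightDescent_iff_act]
  refine fun h0 => not_nonneg_of_nonpos (act_ne_zero cs f (root_ne_zero t')) h0 ?_
  rw [h.last, neg_nonneg]
  have h1 : 0 ≤ chebA C k := h.chebA_nonneg fun h0 => by have := hk h0; omega
  have h2 : 0 ≤ chebA C (k + 1) := h.chebA_nonneg hk
  exact add_nonpos (smul_nonpos_of_nonneg_of_nonpos h1 hX)
    (smul_nonpos_of_nonneg_of_nonpos h2 hY)

theorem GalleryState.order_ne_zero (h : GalleryState cs s C m X Y k f t t') (hX : X ≤ 0)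
    (hY : Y ≤ 0) : m ≠ 0 := by
  intro hm
  induction hl : cs.length f using Nat.strong_induction_on generalizing k f t t' with
  | _ n ih =>
    subst hl
    exact ih _ (h.isRightDescent hX hY (absurd hm)) h.step rfl

theorem GalleryState.exists_opposite (h2 : TwoDimensional cs) (hX : X ≤ 0) (hY : Y ≤ 0)
    {n : ℕ} (h : GalleryState cs s C m X Y k f t t') (hn : k + n + 1 = m)
    (h0 : k = 0 → ∀ p, cs.IsRightDescent f p → p = t)
    (h1 : k = 1 → ∀ p, cs.IsRightDescent (f * cs.simple t') p → p = t') :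
    ∃ c p, act cs c (root p) = root s ∧ cs.length c + n = cs.length f ∧
      ∀ z, WeakLe cs z f → WeakLe cs z c ∨ cs.length f ≤ cs.length z + n + 5 := by
  have hm0 : M t t' ≠ 0 := by rw [h.order_eq]; omega
  induction n generalizing k f t t' with
  | zero =>
    refine ⟨f, t, ?_, by simp, fun z hz => Or.inl hz⟩
    have e1 := chebA_cosM_self h.ne hm0
    have e2 := chebA_cosM_sub h.ne hm0 (n := 1) (by rw [h.order_eq]; omega)
    rw [h.order_eq, h.cosM_eq] at e1 e2
    rw [chebA_one, show m - 1 = k by omega] at e2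
    rw [← hn] at e1
    simpa [e1, e2] using h.wall
  | succ n ih =>
    have ht := h.isRightDescent hX hY (by omega)
    have ht' := h.not_isRightDescent hX hY (by omega)
    have hl := cs.isRightDescent_iff.1 ht
    obtain ⟨c, p, hc, hlc, hz⟩ := ih h.step (by omega) (by omega)
      (fun hk p => by
        rw [cs.simple_mul_simple_cancel_right]
        exact h0 (by omega) p) (by rwa [M.symmetric])
    have key : ∀ z, WeakLe cs z (f * cs.simple t) →
        WeakLe cs z c ∨ cs.length f ≤ cs.length z + (n + 1) + 5 := by
      intro z hzt
      rcases hz z hzt with h3 | h3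
      · exact Or.inl h3
      · right; omega
    refine ⟨c, p, hc, by omega, fun z hzf => ?_⟩
    rcases hzf.eq_or with rfl | ⟨y, hy, hzy⟩
    · right; omega
    by_cases hyt : y = t
    · subst hyt
      exact key z hzy
    have hyt' : y ≠ t' := fun e => ht' (e ▸ hy)
    have hk : k ≠ 0 := fun e => hyt (h0 e y hy)
    rcases deviation h2 h.ne hyt hyt' (k := k) (by omega) hm0 (by rw [h.order_eq]; omega)
      (by rw [h.cosM_eq]; exact h.wall) ht hy (fun e hd => hyt' (h1 e y hd)) hzy with h3 | h3
    · exact key z h3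
    · right; omega

variable (M) in
theorem exists_order_le : ∃ K : ℕ, ∀ i j : B, M i j ≤ K := by
  obtain ⟨K, hK⟩ := (Set.finite_range fun p : B × B => M p.1 p.2).bddAbove
  exact ⟨K, fun i j => hK ⟨(i, j), rfl⟩⟩

theorem act_root_of_simple_mul_eq {e : W} {r : B} (h : cs.simple s * e = e * cs.simple r)
    (hr : ¬ cs.IsRightDescent e r) : act cs e (root r) = root s := by
  rcases act_eq_of_simple_mul_eq h with h1 | h1
  · exact h1
  · refine absurd (isRightDescent_iff_act.2 ?_) hr
    rw [h1]
    simpa using root_nonneg s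

/-- Going down along a wall: an element adjacent to the wall of `s` lies below-adjacent, through
a finite residue, to another such element, and the elements below the first that are not below the
second are close to it. -/
theorem exists_opposite (h2 : TwoDimensional cs) {K : ℕ} (hK : ∀ i j : B, M i j ≤ K) {e : W} {r : B}
    (h : cs.simple s * e = e * cs.simple r) (hr : ¬ cs.IsRightDescent e r) (he : e ≠ 1) :
    ∃ c p, cs.simple s * c = c * cs.simple p ∧ ¬ cs.IsRightDescent c p ∧
      cs.length c < cs.length e ∧
      ∀ z, WeakLe cs z e → WeakLe cs z c ∨ cs.length e ≤ cs.length z + (K + 5) := by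
  have hrs := act_root_of_simple_mul_eq h hr
  have up : ∀ y, cs.IsRightDescent e y → cs.IsRightDescent (e * cs.simple r) y := by
    intro y hy
    have hne : cs.simple s * e ≠ e * cs.simple y := by
      rw [h, Ne, mul_right_inj]
      intro e'
      rw [CoxeterSystem.IsRightDescent, ← e'] at hy
      exact hr hy
    rw [← h]
    exact (descent_simple_mul_iff hne).2 hy
  have hrr : cs.IsRightDescent (e * cs.simple r) r := by
    rw [cs.isRightDescent_iff_not_isRightDescent_mul, cs.simple_mul_simple_cancel_right]
    exact hr
  obtain ⟨q, hq⟩ := cs.exists_rightDescent_of_ne_one he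
  have hqr : q ≠ r := by rintro rfl; exact hr hq
  have uniq : ∀ y, cs.IsRightDescent e y → y = q := by
    intro y hy
    rcases two_dim_descents h2 hqr (up q hq) hrr (up y hy) with h3 | rfl
    · exact h3
    · exact absurd hy hr
  have hX := isRightDescent_iff_act.1 (up q hq)
  have hY := isRightDescent_iff_act.1 hrr
  have st : GalleryState cs s (cosM M q r) (M q r) (act cs (e * cs.simple r) (root q))
      (act cs (e * cs.simple r) (root r)) 0 e q r := by
    refine ⟨hqr, rfl, rfl, ?_, ?_, ?_⟩
    · rw [act_mul_simple_root_self, act_mul, act_simple_root, cosM_symm M r q, map_add, map_smul,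
        zero_add, zero_add, chebA_one, chebA_two]
      module
    · rw [act_mul_simple_root_self]; simp
    · simpa using hrs
  have hm := st.order_ne_zero hX hY
  have hm2 := two_le_of_ne (M := M) hqr
  obtain ⟨c, p, hc, hl, hz⟩ := st.exists_opposite h2 hX hY (n := M q r - 1) (by omega)
    (fun _ => uniq) (by simp)
  refine ⟨c, p, simple_mul_eq_mul_simple (Or.inl hc), ?_, ?_, fun z hze => ?_⟩
  · rw [isRightDescent_iff_act, hc]
    exact fun h0 => not_nonneg_of_nonpos (root_ne_zero s) h0 (root_nonneg s)
  · have := hm2 hm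
    omega
  · have := hK q r
    rcases hz z hze with h3 | h3
    · exact Or.inl h3
    · right; omega

theorem length_mul_three_le (a b c : W) :
    cs.length (a * b * c) ≤ cs.length a + cs.length b + cs.length c :=
  (cs.length_mul_le _ _).trans (Nat.add_le_add_right (cs.length_mul_le _ _) _)

theorem length_le_of_weakLe_adjacent (h2 : TwoDimensional cs) {K : ℕ} (hK : ∀ i j : B, M i j ≤ K)
    {e : W} {r : B} (h : cs.simple s * e = e * cs.simple r) (hr : ¬ cs.IsRightDescent e r)
    {x z : W} (hx : WeakLe cs x e) (hz : WeakLe cs z e) (hxz : cs.length x = cs.length z) :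
    cs.length (x⁻¹ * cs.simple s * z) ≤ 2 * (K + 5) + 1 := by
  induction hn : cs.length e using Nat.strong_induction_on generalizing e r with
  | _ n ih =>
    subst hn
    have direct : cs.length e ≤ cs.length x + (K + 5) →
        cs.length (x⁻¹ * cs.simple s * z) ≤ 2 * (K + 5) + 1 := by
      intro h3
      have e1 : x⁻¹ * cs.simple s * z = (x⁻¹ * e) * cs.simple r * (z⁻¹ * e)⁻¹ := by
        have : cs.simple s = e * cs.simple r * e⁻¹ := by rw [← h]; group
        rw [this]; group
      have h4 := length_mul_three_le (cs := cs) (x⁻¹ * e) (cs.simple r) (z⁻¹ * e)⁻¹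
      rw [cs.length_inv, cs.length_simple] at h4
      rw [e1]
      rw [WeakLe] at hx hz
      omega
    by_cases he : e = 1
    · exact direct (by simp [he])
    obtain ⟨c, p, hc, hp, hl, hd⟩ := exists_opposite h2 hK h hr he
    rcases hd x hx with h3 | h3
    · rcases hd z hz with h4 | h4
      · exact ih _ hl hc hp h3 h4 rfl
      · exact direct (by omega)
    · exact direct h3

end chain

section main
variable {cs : CoxeterSystem M W}

theorem length_fellow_of_near_end {v v' : List B} {s : B} (hv : cs.IsReduced v)
    (hv' : cs.IsReduced v') (hs : cs.wordProd v' = cs.simple s * cs.wordProd v) {n a b : ℕ}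
    (ha : v.length ≤ n + a) (hb : v'.length ≤ n + b) :
    cs.length ((cs.wordProd (v.take n))⁻¹ * cs.simple s * cs.wordProd (v'.take n)) ≤ a + b := by
  have h1 := weakLe_take hv n
  have h2 := weakLe_take hv' n
  rw [WeakLe, hv.eq, (hv.take n).eq, List.length_take] at h1
  rw [WeakLe, hv'.eq, (hv'.take n).eq, List.length_take] at h2
  have e : (cs.wordProd (v.take n))⁻¹ * cs.simple s * cs.wordProd (v'.take n)
      = ((cs.wordProd (v.take n))⁻¹ * cs.wordProd v) *
        ((cs.wordProd (v'.take n))⁻¹ * cs.wordProd v')⁻¹ := by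
    rw [hs]
    simp [mul_assoc]
  have h3 := cs.length_mul_le ((cs.wordProd (v.take n))⁻¹ * cs.wordProd v)
    ((cs.wordProd (v'.take n))⁻¹ * cs.wordProd v')⁻¹
  rw [cs.length_inv] at h3
  rw [e]
  omega

theorem length_fellow_of_wall (h2 : TwoDimensional cs) {K L : ℕ} (hK : ∀ i j : B, M i j ≤ K)
    (hL : ∀ g, cs.length (wg cs g) ≤ L) {v v' : List B} (hv : StdLang cs v) (hv' : StdLang cs v')
    {s r : B} (hs : cs.wordProd v' = cs.simple s * cs.wordProd v)
    (hr : cs.wordProd v' = cs.wordProd v * cs.simple r)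
    (hd : cs.IsRightDescent (cs.wordProd v) r) (n : ℕ) :
    cs.length ((cs.wordProd (v.take n))⁻¹ * cs.simple s * cs.wordProd (v'.take n))
      ≤ 2 * (K + 5) + 1 + 2 * (L + 1) := by
  have h1 : cs.wordProd v ≠ 1 := by
    intro h1
    rw [h1, CoxeterSystem.IsRightDescent] at hd
    simp at hd
  obtain ⟨m, hm, -, hp⟩ := hv.exists_prefix h1
  have hw := length_wg_pos (cs := cs) h1
  have hle := weakLe_mul_wg_inv hd
  have hl := cs.isRightDescent_iff.1 hd
  rw [← hr] at hle hl
  rw [hv.isReduced.eq] at hm hl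
  rw [hv'.isReduced.eq] at hl
  have hb := hL (cs.wordProd v)
  rcases le_or_gt n m with hn | hn
  · refine (length_le_of_weakLe_adjacent h2 hK (e := cs.wordProd v') (r := r) ?_ ?_ ?_
      (weakLe_take hv'.isReduced n) ?_).trans (by omega)
    · rw [hr, cs.simple_mul_simple_cancel_right, ← hr, hs, cs.simple_mul_simple_cancel_left]
    · rw [hr]
      exact not_isRightDescent_mul_self hd
    · refine WeakLe.trans ?_ hle
      rw [← hp]
      have := weakLe_take (hv.isReduced.take m) n
      rwa [List.take_take, min_eq_left hn] at this
    · rw [(hv.isReduced.take n).eq, (hv'.isReduced.take n).eq, List.length_take, List.length_take]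
      omega
  · exact (length_fellow_of_near_end hv.isReduced hv'.isReduced hs (a := L) (b := L) (by omega)
      (by omega)).trans (by omega)

theorem length_fellow (h2 : TwoDimensional cs) {K L : ℕ} (hK : ∀ i j : B, M i j ≤ K)
    (hL : ∀ g, cs.length (wg cs g) ≤ L) {v v' : List B} (hv : StdLang cs v) (hv' : StdLang cs v')
    {s : B} (hs : cs.wordProd v' = cs.simple s * cs.wordProd v) (n : ℕ) :
    cs.length ((cs.wordProd (v.take n))⁻¹ * cs.simple s * cs.wordProd (v'.take n))
      ≤ 2 * (K + 5) + 1 + 2 * (L + 1) := by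
  induction hN : v.length using Nat.strong_induction_on generalizing v v' with
  | _ N ih =>
    subst hN
    have hs' : cs.wordProd v = cs.simple s * cs.wordProd v' := by
      rw [hs, cs.simple_mul_simple_cancel_left]
    by_cases hwall : ∃ r, cs.wordProd v' = cs.wordProd v * cs.simple r
    · obtain ⟨r, hr⟩ := hwall
      have hr' : cs.wordProd v = cs.wordProd v' * cs.simple r := by
        rw [hr, cs.simple_mul_simple_cancel_right]
      by_cases hd : cs.IsRightDescent (cs.wordProd v) r
      · exact length_fellow_of_wall h2 hK hL hv hv' hs hr hd n
      · have hd' : cs.IsRightDescent (cs.wordProd v') r := by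
          rw [cs.isRightDescent_iff_not_isRightDescent_mul, ← hr']
          exact hd
        have := length_fellow_of_wall h2 hK hL hv' hv hs' hr' hd' n
        rw [← cs.length_inv]
        simpa [mul_assoc] using this
    · push Not at hwall
      have hT : descentSet cs (cs.wordProd v') = descentSet cs (cs.wordProd v) := by
        ext y
        rw [hs]
        exact descent_simple_mul_iff (hs ▸ hwall y)
      have h1 : cs.wordProd v ≠ 1 := by
        intro h1
        refine hwall s ?_
        rw [hs, h1, one_mul, mul_one]
      have h1' : cs.wordProd v' ≠ 1 := by
        intro h1'
        refine hwall s ?_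
        rw [hs', h1', mul_one, cs.simple_mul_simple_self]
      obtain ⟨m, hm, hpv, hp⟩ := hv.exists_prefix h1
      obtain ⟨m', hm', hpv', hp'⟩ := hv'.exists_prefix h1'
      rw [wg_congr hT] at hm' hp'
      have hw := length_wg_pos (cs := cs) h1
      have hb := hL (cs.wordProd v)
      have hl := cs.length_simple_mul (cs.wordProd v) s
      rw [← hs] at hl
      rw [hv.isReduced.eq] at hm hl
      rw [hv'.isReduced.eq] at hm' hl
      by_cases hn : n ≤ m ∧ n ≤ m'
      · have := ih _ (by rw [List.length_take]; omega) hpv hpv'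
          (by rw [hp, hp', hs, mul_assoc]) rfl
        rwa [List.take_take, List.take_take, min_eq_left hn.1, min_eq_left hn.2] at this
      · exact (length_fellow_of_near_end hv.isReduced hv'.isReduced hs (a := L + 1) (b := L + 1)
          (by omega) (by omega)).trans (by omega)

end main

/-- **Lemma.** For a 2-dimensional Coxeter group, the standard language satisfies
condition (iii) of the definition of biautomaticity. -/
theorem standard_language_part_iii
    (cs : CoxeterSystem M W) (h2 : TwoDimensional cs) :
    ∃ C : ℕ, 0 < C ∧
      (∀ (i : B) (g g' : W), g' = cs.simple i * g →
        ∀ v v' : List B, StdLang cs v → StdLang cs v' →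
          cs.wordProd v = g → cs.wordProd v' = g' →
          ∀ n : ℕ, 1 ≤ n →
            cs.length ((cs.wordProd (v.take n))⁻¹ * (cs.simple i)⁻¹ * cs.wordProd (v'.take n)) ≤ C) := by
  obtain ⟨K, hK⟩ := exists_order_le M
  obtain ⟨L, hL⟩ := exists_length_wg_le cs
  refine ⟨2 * (K + 5) + 1 + 2 * (L + 1), by omega, ?_⟩
  rintro i _ _ hg v v' hv hv' rfl rfl n -
  rw [cs.inv_simple]
  exact length_fellow h2 hK hL hv hv' hg n

end CoxeterPaper
end

section
/- Let W be a 2-dimensional Coxeter group. There is a constant D = D(W) > 0 such that for any s ∈ S, any f ∈ W adjacent to the wall of s (i.e., f⁻¹ s f ∈ S), and any elements h, h' ∈ W lying on geodesics from the identity to f (i.e., ℓ(h) + ℓ(h⁻¹f) = ℓ(f) and ℓ(h') + ℓ(h'⁻¹f) = ℓ(f)) with ℓ(h) = ℓ(h'), one has ℓ(h⁻¹ h') < D. -/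
namespace CoxeterPaper

open CoxeterSystem

attribute [local instance] Classical.propDecidable

variable {B : Type} [DecidableEq B] [Fintype B]
variable {W : Type} [Group W] {M : CoxeterMatrix B}

section Geometric

set_option linter.unusedSectionVars false

variable {I : Type} [Fintype I] {G : Type} [Group G] {N : CoxeterMatrix I}

/-- The Gram matrix `-cos (π / m)` of the canonical form of a Coxeter matrix. -/
noncomputable def gramMatrix (N : CoxeterMatrix I) : Matrix I I ℝ :=
  fun i j => -Real.cos (Real.pi / (N i j : ℝ))

/-- The canonical symmetric bilinear form of a Coxeter matrix. -/
noncomputable def form (N : CoxeterMatrix I) : LinearMap.BilinForm ℝ (I → ℝ) :=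
  Matrix.toBilin' (gramMatrix N)

/-- The simple roots. -/
noncomputable def simpleRoot (i : I) : I → ℝ := Pi.single i 1

theorem form_simpleRoot (i j : I) :
    form N (simpleRoot i) (simpleRoot j) = -Real.cos (Real.pi / (N i j : ℝ)) :=
  Matrix.toBilin'_single _ _ _

theorem form_simpleRoot_self (i : I) : form N (simpleRoot i) (simpleRoot i) = 1 := by
  rw [form_simpleRoot, N.diagonal]; simp

theorem form_comm (x y : I → ℝ) : form N x y = form N y x := by
  simp only [form, Matrix.toBilin'_apply]
  rw [Finset.sum_comm]
  refine Finset.sum_congr rfl fun i _ => Finset.sum_congr rfl fun j _ => ?_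
  simp only [gramMatrix, N.symmetric j i]
  ring

theorem one_le_cast_of_ne {i j : I} (h : i ≠ j) : N i j = 0 ∨ 2 ≤ N i j := by
  have := N.off_diagonal i j h
  omega

theorem form_simpleRoot_nonpos {i j : I} (h : i ≠ j) :
    form N (simpleRoot i) (simpleRoot j) ≤ 0 := by
  rw [form_simpleRoot, neg_nonpos]
  rcases one_le_cast_of_ne (N := N) h with h0 | h2
  · simp [h0]
  · have h2' : (2 : ℝ) ≤ N i j := by exact_mod_cast h2
    apply Real.cos_nonneg_of_mem_Icc
    have hp := Real.pi_pos
    constructor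
    · have : 0 ≤ Real.pi / (N i j : ℝ) := by positivity
      linarith
    · exact div_le_div_of_nonneg_left hp.le (by norm_num) h2'

theorem reflection_condition (i : I) :
    ((2 : ℝ) • form N (simpleRoot i)) (simpleRoot i) = 2 := by
  simp [form_simpleRoot_self]

/-- The simple reflections of the geometric representation. -/
noncomputable def simpleReflection (N : CoxeterMatrix I) (i : I) : (I → ℝ) ≃ₗ[ℝ] (I → ℝ) :=
  Module.reflection (reflection_condition (N := N) i)

theorem simpleReflection_apply (i : I) (x : I → ℝ) :
    simpleReflection N i x = x - (2 * form N (simpleRoot i) x) • simpleRoot i := by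
  simp [simpleReflection, Module.reflection_apply]

theorem simpleReflection_isLiftable : N.IsLiftable (simpleReflection N) := by
  intro i j
  by_cases hij : i = j
  · subst hij
    rw [N.diagonal, pow_one]
    ext1 x
    exact Module.involutive_reflection _ x
  rcases one_le_cast_of_ne (N := N) hij with h0 | h2
  · rw [h0, pow_zero]
  set m := N i j with hm
  have hk : form N (simpleRoot i) (simpleRoot j) = -Real.cos (Real.pi / (m : ℝ)) :=
    form_simpleRoot i j
  have hk' : form N (simpleRoot j) (simpleRoot i) = -Real.cos (Real.pi / (m : ℝ)) := by
    rw [form_comm, hk]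
  ext1 z
  set φ := 2 * (Real.pi / (m : ℝ)) with hφ
  have ht : 2 * Real.cos φ = ((2 : ℝ) • form N (simpleRoot i)) (simpleRoot j) *
      ((2 : ℝ) • form N (simpleRoot j)) (simpleRoot i) - 2 := by
    simp only [LinearMap.smul_apply, hk, hk', smul_eq_mul, hφ, Real.cos_two_mul]
    ring
  have key := Module.reflection_mul_reflection_pow_apply (reflection_condition (N := N) i)
    (reflection_condition (N := N) j) m z (2 * Real.cos φ) ht
  refine Eq.trans key ?_
  rcases Nat.eq_or_lt_of_le h2 with h2 | h3
  · have hp : Real.cos (Real.pi / (m : ℝ)) = 0 := by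
      rw [← h2]; simp
    have hφ' : Real.cos φ = -1 := by
      rw [hφ, ← h2]; simp [mul_div_cancel₀]
    rw [hp, neg_zero] at hk hk'
    simp only [LinearMap.smul_apply, hk, hk', ← h2, hφ']
    have e1 : Polynomial.Chebyshev.S ℝ 1 = Polynomial.X := Polynomial.Chebyshev.S_one ℝ
    norm_num
    module
  · have hm3 : (3 : ℝ) ≤ m := by exact_mod_cast h3
    have hpi := Real.pi_pos
    have hsin : Real.sin φ ≠ 0 := by
      apply ne_of_gt
      apply Real.sin_pos_of_pos_of_lt_pi
      · rw [hφ]; positivity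
      · rw [hφ, ← mul_div_assoc, div_lt_iff₀ (by linarith)]
        nlinarith
    have hm0 : (m : ℝ) ≠ 0 := by linarith
    have hS : ∀ n : ℤ, (Polynomial.Chebyshev.S ℝ n).eval (2 * Real.cos φ) * Real.sin φ =
        Real.sin ((n + 1) * φ) := fun n => Polynomial.Chebyshev.S_two_mul_real_cos φ n
    rcases Nat.even_or_odd' m with ⟨l, hl | hl⟩
    · have e1 : ((m : ℤ) - 2) / 2 = (l : ℤ) - 1 := by omega
      have e2 : ((m : ℤ) - 1) / 2 = (l : ℤ) - 1 := by omega
      have hml : (m : ℝ) = 2 * l := by exact_mod_cast hl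
      have h0 : (Polynomial.Chebyshev.S ℝ ((l : ℤ) - 1)).eval (2 * Real.cos φ) = 0 := by
        have := hS ((l : ℤ) - 1)
        have e : (((((l : ℤ) - 1 : ℤ) : ℝ)) + 1) * φ = Real.pi := by
          push_cast
          rw [hφ]; field_simp; rw [hml]; ring
        rw [e, Real.sin_pi] at this
        exact (mul_eq_zero.mp this).resolve_right hsin
      rw [e1, e2, h0]
      simp
    · have e1 : ((m : ℤ) - 2) / 2 = (l : ℤ) - 1 := by omega
      have e2 : ((m : ℤ) - 1) / 2 = (l : ℤ) := by omega
      have e3 : ((m : ℤ) - 3) / 2 = (l : ℤ) - 1 := by omega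
      have e4 : (m : ℤ) / 2 = (l : ℤ) := by omega
      have hml : (m : ℝ) = 2 * l + 1 := by exact_mod_cast hl
      have h0 : (Polynomial.Chebyshev.S ℝ (l : ℤ)).eval (2 * Real.cos φ) +
          (Polynomial.Chebyshev.S ℝ ((l : ℤ) - 1)).eval (2 * Real.cos φ) = 0 := by
        have h1 := hS ((l : ℤ) - 1)
        have h2 := hS (l : ℤ)
        have e : ((((l : ℤ) - 1 : ℤ) : ℝ) + 1) * φ = 2 * Real.pi - (((l : ℤ) : ℝ) + 1) * φ := by
          push_cast
          rw [hφ]; field_simp; rw [hml]; ring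
        rw [e, Real.sin_two_pi_sub] at h1
        have : ((Polynomial.Chebyshev.S ℝ (l : ℤ)).eval (2 * Real.cos φ) +
          (Polynomial.Chebyshev.S ℝ ((l : ℤ) - 1)).eval (2 * Real.cos φ)) * Real.sin φ = 0 := by
          rw [add_mul, h1, h2]; ring
        exact (mul_eq_zero.mp this).resolve_right hsin
      rw [e1, e2, e3, e4, h0]
      simp

/-- The geometric representation of a Coxeter group. -/
noncomputable def rep (cs : CoxeterSystem N G) : G →* ((I → ℝ) ≃ₗ[ℝ] (I → ℝ)) :=
  cs.lift ⟨simpleReflection N, simpleReflection_isLiftable⟩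

theorem rep_simple (cs : CoxeterSystem N G) (i : I) :
    rep cs (cs.simple i) = simpleReflection N i :=
  cs.lift_apply_simple simpleReflection_isLiftable i

theorem rep_simple_apply (cs : CoxeterSystem N G) (i : I) (x : I → ℝ) :
    rep cs (cs.simple i) x = x - (2 * form N (simpleRoot i) x) • simpleRoot i := by
  rw [rep_simple, simpleReflection_apply]

theorem rep_mul_apply (cs : CoxeterSystem N G) (g h : G) (x : I → ℝ) :
    rep cs (g * h) x = rep cs g (rep cs h x) := by
  rw [map_mul]; rfl

theorem rep_one_apply (cs : CoxeterSystem N G) (x : I → ℝ) : rep cs 1 x = x := by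
  rw [map_one]; rfl

theorem rep_inv_apply_self (cs : CoxeterSystem N G) (g : G) (x : I → ℝ) :
    rep cs g⁻¹ (rep cs g x) = x := by
  rw [← rep_mul_apply, inv_mul_cancel, rep_one_apply]

theorem rep_apply_inv_self (cs : CoxeterSystem N G) (g : G) (x : I → ℝ) :
    rep cs g (rep cs g⁻¹ x) = x := by
  rw [← rep_mul_apply, mul_inv_cancel, rep_one_apply]

theorem form_rep (cs : CoxeterSystem N G) (g : G) (x y : I → ℝ) :
    form N (rep cs g x) (rep cs g y) = form N x y := by
  induction g using cs.simple_induction_left generalizing x y with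
  | one => simp
  | mul_simple_left w i ih =>
    rw [rep_mul_apply, rep_mul_apply, rep_simple_apply, rep_simple_apply]
    simp only [map_sub, map_smul, LinearMap.sub_apply, LinearMap.smul_apply, smul_eq_mul,
      form_simpleRoot_self, ih, form_comm (rep cs w x) (simpleRoot i)]
    ring

theorem rep_simple_simpleRoot (cs : CoxeterSystem N G) (i : I) :
    rep cs (cs.simple i) (simpleRoot i) = -simpleRoot i := by
  rw [rep_simple_apply, form_simpleRoot_self]; module

end Geometric

section Positivity

set_option linter.unusedSectionVars false

variable {I : Type} [Fintype I] {G : Type} [Group G] {N : CoxeterMatrix I}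

/-- The rescaled Chebyshev sequence `sin (k θ) / sin θ` of the dihedral angle `π / m`. -/
noncomputable def dihedralCoeff (m : ℕ) : ℕ → ℝ
  | 0 => 0
  | 1 => 1
  | k + 2 => 2 * Real.cos (Real.pi / (m : ℝ)) * dihedralCoeff m (k + 1) - dihedralCoeff m k

theorem dihedralCoeff_zero_left (k : ℕ) : dihedralCoeff 0 k = k := by
  induction k using Nat.twoStepInduction with
  | zero => simp [dihedralCoeff]
  | one => simp [dihedralCoeff]
  | more k h1 h2 =>
    rw [dihedralCoeff, h1, h2]
    push_cast
    simp
    ring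

theorem dihedralCoeff_mul_sin (m k : ℕ) :
    dihedralCoeff m k * Real.sin (Real.pi / (m : ℝ)) = Real.sin (k * (Real.pi / (m : ℝ))) := by
  induction k using Nat.twoStepInduction with
  | zero => simp [dihedralCoeff]
  | one => simp [dihedralCoeff]
  | more k h1 h2 =>
    set θ := Real.pi / (m : ℝ)
    rw [dihedralCoeff, sub_mul, mul_assoc, h1, h2]
    have e1 : ((k + 2 : ℕ) : ℝ) * θ = ((k + 1 : ℕ) : ℝ) * θ + θ := by push_cast; ring
    have e2 : (k : ℝ) * θ = ((k + 1 : ℕ) : ℝ) * θ - θ := by push_cast; ring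
    rw [e1, e2, Real.sin_add, Real.sin_sub]
    ring

theorem dihedralCoeff_nonneg {m k : ℕ} (hm : m = 0 ∨ 2 ≤ m) (hk : m ≠ 0 → k ≤ m) :
    0 ≤ dihedralCoeff m k := by
  rcases hm with rfl | hm
  · rw [dihedralCoeff_zero_left]; positivity
  · have h := dihedralCoeff_mul_sin m k
    have hpi := Real.pi_pos
    have hm' : (2 : ℝ) ≤ m := by exact_mod_cast hm
    have hs : 0 < Real.sin (Real.pi / (m : ℝ)) := by
      apply Real.sin_pos_of_pos_of_lt_pi
      · positivity
      · rw [div_lt_iff₀ (by linarith)]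
        nlinarith
    have hk' : (k : ℝ) ≤ m := by exact_mod_cast hk (by omega)
    have h2 : 0 ≤ Real.sin (k * (Real.pi / (m : ℝ))) := by
      apply Real.sin_nonneg_of_nonneg_of_le_pi
      · positivity
      · rw [← mul_div_assoc, div_le_iff₀ (by linarith)]
        nlinarith
    rw [← h] at h2
    exact nonneg_of_mul_nonneg_left h2 hs

theorem rep_alternatingWord_apply (cs : CoxeterSystem N G) (s t : I) (p : ℕ) :
    rep cs (cs.wordProd (alternatingWord s t p)) (simpleRoot s) =
      if Even p then dihedralCoeff (N s t) (p + 1) • simpleRoot s +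
          dihedralCoeff (N s t) p • simpleRoot t
        else dihedralCoeff (N s t) p • simpleRoot s +
          dihedralCoeff (N s t) (p + 1) • simpleRoot t := by
  induction p with
  | zero => simp [alternatingWord, dihedralCoeff]
  | succ p ih =>
    have hst : form N (simpleRoot s) (simpleRoot t) = -Real.cos (Real.pi / (N s t : ℝ)) :=
      form_simpleRoot s t
    have hts : form N (simpleRoot t) (simpleRoot s) = -Real.cos (Real.pi / (N s t : ℝ)) := by
      rw [form_comm, hst]
    rw [alternatingWord_succ', cs.wordProd_cons, rep_mul_apply, ih]
    by_cases hp : Even p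
    · have hp' : ¬ Even (p + 1) := by simpa [Nat.even_add_one] using hp
      rw [if_pos hp, if_pos hp, if_neg hp', rep_simple_apply]
      simp only [map_add, map_smul, smul_eq_mul, form_simpleRoot_self, hts, dihedralCoeff]
      module
    · have hp' : Even (p + 1) := by simpa [Nat.even_add_one] using hp
      rw [if_neg hp, if_neg hp, if_pos hp', rep_simple_apply]
      simp only [map_add, map_smul, smul_eq_mul, form_simpleRoot_self, hst, dihedralCoeff]
      module

theorem simpleRoot_nonneg (i : I) : 0 ≤ simpleRoot i := by
  simp [simpleRoot]

theorem exists_maximal_alternatingWord_suffix (cs : CoxeterSystem N G) (w : G) (s t : I)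
    (ht : cs.IsRightDescent w t) :
    ∃ (p : ℕ) (v : G), p ≠ 0 ∧ w = v * cs.wordProd (alternatingWord s t p) ∧
      cs.length v + p = cs.length w ∧ ¬ cs.IsRightDescent v s ∧ ¬ cs.IsRightDescent v t := by
  let P : ℕ → Prop := fun p => ∃ v : G, w = v * cs.wordProd (alternatingWord s t p) ∧
      cs.length v + p = cs.length w
  have h1 : P 1 := by
    refine ⟨w * cs.simple t, by simp [alternatingWord], ?_⟩
    exact cs.isRightDescent_iff.mp ht
  have hb : ∀ p, P p → p ≤ cs.length w := by
    rintro p ⟨v, -, h⟩; omega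
  set p := Nat.findGreatest P (cs.length w) with hp
  have hPp : P p := Nat.findGreatest_spec (P := P) (hb 1 h1) h1
  have hp1 : 1 ≤ p := Nat.le_findGreatest (P := P) (hb 1 h1) h1
  have hmax : ¬ P (p + 1) := by
    intro h
    have := Nat.le_findGreatest (P := P) (hb _ h) h
    omega
  obtain ⟨v, hv, hlen⟩ := hPp
  have key : ∀ y, (y = s ∨ y = t) → ¬ cs.IsRightDescent v y := by
    intro y hy hd
    rw [cs.isRightDescent_iff] at hd
    have hstart : (if Even p then t else s) = y ∨
        ∃ q, p = q + 1 ∧ (if Even q then t else s) = y := by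
      rcases hy with rfl | rfl
      · rcases Nat.even_or_odd' p with ⟨l, h | h⟩
        · rcases l with _ | l
          · omega
          · right
            exact ⟨2 * l + 1, by omega, by simp⟩
        · left; rw [h]; simp
      · rcases Nat.even_or_odd' p with ⟨l, h | h⟩
        · left; rw [h]; simp
        · right; exact ⟨2 * l, by omega, by simp⟩
    rcases hstart with h | ⟨q, hq, h⟩
    · apply hmax
      refine ⟨v * cs.simple y, ?_, by omega⟩
      rw [alternatingWord_succ', h, cs.wordProd_cons, mul_assoc,
        cs.simple_mul_simple_cancel_left, ← hv]
    · rw [hq, alternatingWord_succ', h, cs.wordProd_cons, ← mul_assoc] at hv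
      have h1 := cs.length_mul_le (v * cs.simple y) (cs.wordProd (alternatingWord s t q))
      have h2 := cs.length_wordProd_le (alternatingWord s t q)
      rw [length_alternatingWord] at h2
      rw [← hv] at h1
      omega
  exact ⟨p, v, by omega, hv, hlen, key s (Or.inl rfl), key t (Or.inr rfl)⟩

theorem rep_simpleRoot_nonneg (cs : CoxeterSystem N G) (w : G) (s : I)
    (h : ¬ cs.IsRightDescent w s) : 0 ≤ rep cs w (simpleRoot s) := by
  induction hn : cs.length w using Nat.strong_induction_on generalizing w s with
  | _ n ih =>
  by_cases hw : w = 1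
  · subst hw; rw [rep_one_apply]; exact simpleRoot_nonneg s
  obtain ⟨t, ht⟩ := cs.exists_rightDescent_of_ne_one hw
  have hst : s ≠ t := by rintro rfl; exact h ht
  obtain ⟨p, v, hp, hv, hlen, hvs, hvt⟩ := exists_maximal_alternatingWord_suffix cs w s t ht
  have h1 := ih (cs.length v) (by omega) v s hvs rfl
  have h2 := ih (cs.length v) (by omega) v t hvt rfl
  have hpm : N s t ≠ 0 → p + 1 ≤ N s t := by
    intro hm
    by_contra hlt
    have hnr := cs.not_isReduced_alternatingWord t s (m := p + 1)
      (by rwa [N.symmetric t s]) (by rw [N.symmetric t s]; omega)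
    have hle := cs.length_wordProd_le (alternatingWord t s (p + 1))
    rw [CoxeterSystem.IsReduced] at hnr
    rw [length_alternatingWord] at hle hnr
    have e : w * cs.simple s = v * cs.wordProd (alternatingWord t s (p + 1)) := by
      rw [alternatingWord_succ, cs.wordProd_concat, ← mul_assoc, ← hv]
    have h3 := cs.length_mul_le v (cs.wordProd (alternatingWord t s (p + 1)))
    rw [← e] at h3
    rw [cs.not_isRightDescent_iff] at h
    omega
  have hm := one_le_cast_of_ne (N := N) hst
  have c1 := dihedralCoeff_nonneg (k := p) hm (by omega)
  have c2 := dihedralCoeff_nonneg (k := p + 1) hm hpm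
  rw [hv, rep_mul_apply, rep_alternatingWord_apply]
  split_ifs
  · rw [map_add, map_smul, map_smul]
    exact add_nonneg (smul_nonneg c2 h1) (smul_nonneg c1 h2)
  · rw [map_add, map_smul, map_smul]
    exact add_nonneg (smul_nonneg c1 h1) (smul_nonneg c2 h2)

end Positivity

section Inversions

set_option linter.unusedSectionVars false

variable {I : Type} [Fintype I] {G : Type} [Group G] {N : CoxeterMatrix I}

/-- The roots of a Coxeter system: the orbit of the simple roots. -/
def IsRoot (cs : CoxeterSystem N G) (β : I → ℝ) : Prop :=
  ∃ (w : G) (i : I), β = rep cs w (simpleRoot i)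

theorem isRoot_simpleRoot (cs : CoxeterSystem N G) (i : I) : IsRoot cs (simpleRoot i) :=
  ⟨1, i, (rep_one_apply cs _).symm⟩

theorem IsRoot.rep {cs : CoxeterSystem N G} {β : I → ℝ} (h : IsRoot cs β) (g : G) :
    IsRoot cs (rep cs g β) := by
  obtain ⟨w, i, rfl⟩ := h
  exact ⟨g * w, i, (rep_mul_apply cs g w _).symm⟩

theorem IsRoot.neg {cs : CoxeterSystem N G} {β : I → ℝ} (h : IsRoot cs β) :
    IsRoot cs (-β) := by
  obtain ⟨w, i, rfl⟩ := h
  exact ⟨w * cs.simple i, i, by rw [rep_mul_apply, rep_simple_simpleRoot, map_neg]⟩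

theorem IsRoot.form_self {cs : CoxeterSystem N G} {β : I → ℝ} (h : IsRoot cs β) :
    form N β β = 1 := by
  obtain ⟨w, i, rfl⟩ := h
  rw [form_rep, form_simpleRoot_self]

theorem IsRoot.ne_zero {cs : CoxeterSystem N G} {β : I → ℝ} (h : IsRoot cs β) : β ≠ 0 := by
  rintro rfl
  simpa using h.form_self

theorem IsRoot.not_nonpos {cs : CoxeterSystem N G} {β : I → ℝ} (h : IsRoot cs β)
    (h0 : 0 ≤ β) : ¬ β ≤ 0 := fun h1 => h.ne_zero (le_antisymm h1 h0)

theorem IsRoot.not_nonneg {cs : CoxeterSystem N G} {β : I → ℝ} (h : IsRoot cs β)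
    (h0 : β ≤ 0) : ¬ 0 ≤ β := fun h1 => h.ne_zero (le_antisymm h0 h1)

theorem IsRoot.nonneg_or_nonpos {cs : CoxeterSystem N G} {β : I → ℝ} (h : IsRoot cs β) :
    0 ≤ β ∨ β ≤ 0 := by
  obtain ⟨w, i, rfl⟩ := h
  by_cases hd : cs.IsRightDescent w i
  · right
    rw [cs.isRightDescent_iff_not_isRightDescent_mul] at hd
    have := rep_simpleRoot_nonneg cs _ _ hd
    rw [rep_mul_apply, rep_simple_simpleRoot, map_neg] at this
    exact neg_nonneg.mp this
  · exact Or.inl (rep_simpleRoot_nonneg cs w i hd)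

theorem IsRoot.nonneg_of_not_nonpos {cs : CoxeterSystem N G} {β : I → ℝ} (h : IsRoot cs β)
    (h0 : ¬ β ≤ 0) : 0 ≤ β := h.nonneg_or_nonpos.resolve_right h0

theorem IsRoot.exists_pos_apply {cs : CoxeterSystem N G} {β : I → ℝ} (h : IsRoot cs β)
    (h0 : 0 ≤ β) {i : I} (hi : β ≠ simpleRoot i) : ∃ j, j ≠ i ∧ 0 < β j := by
  by_contra hcon
  push Not at hcon
  have hβ : β = β i • simpleRoot i := by
    ext j
    by_cases hji : j = i
    · subst hji; simp [simpleRoot]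
    · have := le_antisymm (hcon j hji) (h0 j)
      simp [simpleRoot, hji, this]
  have h1 := h.form_self
  rw [hβ, map_smul, map_smul, LinearMap.smul_apply, form_simpleRoot_self, smul_eq_mul,
    smul_eq_mul, mul_one] at h1
  have h2 : β i = 1 := by
    have : 0 ≤ β i := h0 i
    nlinarith
  rw [h2, one_smul] at hβ
  exact hi hβ

theorem IsRoot.rep_simple_nonneg {cs : CoxeterSystem N G} {β : I → ℝ} (h : IsRoot cs β)
    (h0 : 0 ≤ β) {i : I} (hi : β ≠ simpleRoot i) :
    0 ≤ CoxeterPaper.rep cs (cs.simple i) β := by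
  obtain ⟨j, hji, hj⟩ := h.exists_pos_apply h0 hi
  apply (h.rep (cs.simple i)).nonneg_of_not_nonpos
  intro hle
  have := hle j
  rw [rep_simple_apply] at this
  simp [simpleRoot, hji] at this
  linarith

/-- The inversion set of `w`: the positive roots made negative by `w⁻¹`. -/
def inversions (cs : CoxeterSystem N G) (w : G) : Set (I → ℝ) :=
  {β | IsRoot cs β ∧ 0 ≤ β ∧ rep cs w⁻¹ β ≤ 0}

theorem inversions_one (cs : CoxeterSystem N G) : inversions cs 1 = ∅ := by
  ext β
  simp only [inversions, Set.mem_ofPred_eq, Set.mem_empty_iff_false, iff_false, inv_one,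
    rep_one_apply]
  rintro ⟨h, h0, h1⟩
  exact h.not_nonpos h0 h1

theorem rep_simpleRoot_notMem_inversions (cs : CoxeterSystem N G) (w : G) (i : I) :
    rep cs w (simpleRoot i) ∉ inversions cs w := by
  rintro ⟨-, -, h⟩
  rw [rep_inv_apply_self] at h
  exact (isRoot_simpleRoot cs i).not_nonpos (simpleRoot_nonneg i) h

theorem inversions_mul_simple (cs : CoxeterSystem N G) (w : G) (i : I)
    (h : 0 ≤ rep cs w (simpleRoot i)) :
    inversions cs (w * cs.simple i) = insert (rep cs w (simpleRoot i)) (inversions cs w) := by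
  ext β
  simp only [inversions, Set.mem_ofPred_eq, Set.mem_insert_iff, mul_inv_rev, cs.inv_simple,
    rep_mul_apply]
  constructor
  · rintro ⟨hr, h0, h1⟩
    by_cases hγ : rep cs w⁻¹ β ≤ 0
    · exact Or.inr ⟨hr, h0, hγ⟩
    · left
      have hγ' := (hr.rep w⁻¹).nonneg_of_not_nonpos hγ
      by_cases hα : rep cs w⁻¹ β = simpleRoot i
      · rw [← hα, rep_apply_inv_self]
      · exact absurd h1 (((hr.rep w⁻¹).rep _).not_nonpos ((hr.rep w⁻¹).rep_simple_nonneg hγ' hα))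
  · rintro (rfl | ⟨hr, h0, h1⟩)
    · refine ⟨(isRoot_simpleRoot cs i).rep w, h, ?_⟩
      rw [rep_inv_apply_self, rep_simple_simpleRoot]
      exact neg_nonpos.mpr (simpleRoot_nonneg i)
    · refine ⟨hr, h0, ?_⟩
      have hn := (hr.rep w⁻¹).neg
      have hα : -rep cs w⁻¹ β ≠ simpleRoot i := by
        intro hα
        rw [← hα, map_neg, rep_apply_inv_self] at h
        exact hr.not_nonpos h0 (neg_nonneg.mp h)
      have := hn.rep_simple_nonneg (neg_nonneg.mpr h1) hα
      rw [map_neg] at this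
      exact neg_nonneg.mp this

theorem inversions_mul_simple_subset (cs : CoxeterSystem N G) (w : G) (i : I)
    (h : rep cs w (simpleRoot i) ≤ 0) :
    inversions cs w =
      insert (-rep cs w (simpleRoot i)) (inversions cs (w * cs.simple i)) := by
  have := inversions_mul_simple cs (w * cs.simple i) i
  rw [rep_mul_apply, rep_simple_simpleRoot, map_neg, cs.simple_mul_simple_cancel_right] at this
  exact this (neg_nonneg.mpr h)

theorem finite_inversions_and_ncard (cs : CoxeterSystem N G) (w : G) :
    (inversions cs w).Finite ∧ (inversions cs w).ncard = cs.length w := by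
  induction hn : cs.length w generalizing w with
  | zero =>
    rw [cs.length_eq_zero_iff] at hn
    subst hn
    simp [inversions_one]
  | succ n ih =>
    have hw : w ≠ 1 := by rintro rfl; simp at hn
    obtain ⟨i, hi⟩ := cs.exists_rightDescent_of_ne_one hw
    have hl := cs.isRightDescent_iff.mp hi
    obtain ⟨h1, h2⟩ := ih (w * cs.simple i) (by omega)
    have h3 := rep_simpleRoot_nonneg cs _ _ (cs.isRightDescent_iff_not_isRightDescent_mul.mp hi)
    have h4 := inversions_mul_simple cs _ i h3
    rw [cs.simple_mul_simple_cancel_right] at h4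
    rw [h4]
    refine ⟨h1.insert _, ?_⟩
    rw [Set.ncard_insert_of_notMem (rep_simpleRoot_notMem_inversions cs _ _) h1, h2]

theorem finite_inversions_s5 (cs : CoxeterSystem N G) (w : G) : (inversions cs w).Finite :=
  (finite_inversions_and_ncard cs w).1

theorem ncard_inversions (cs : CoxeterSystem N G) (w : G) :
    (inversions cs w).ncard = cs.length w :=
  (finite_inversions_and_ncard cs w).2

theorem length_inv_mul_eq (cs : CoxeterSystem N G) (g w : G) :
    cs.length (g⁻¹ * w) = (inversions cs w \ inversions cs g).ncard +
      (inversions cs g \ inversions cs w).ncard := by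
  rw [← ncard_inversions]
  have hinj : Function.Injective (rep cs g) := (rep cs g).injective
  have hneg : Function.Injective (fun x : I → ℝ => -x) := neg_injective
  have himg : rep cs g '' inversions cs (g⁻¹ * w) = (inversions cs w \ inversions cs g) ∪
      (fun x : I → ℝ => -x) '' (inversions cs g \ inversions cs w) := by
    ext β
    simp only [Set.mem_image, Set.mem_union, Set.mem_sdiff, inversions, Set.mem_ofPred_eq]
    constructor
    · rintro ⟨γ, ⟨hr, h0, h1⟩, rfl⟩
      rw [mul_inv_rev, inv_inv, rep_mul_apply] at h1
      rcases (hr.rep g).nonneg_or_nonpos with h | h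
      · left
        refine ⟨⟨hr.rep g, h, h1⟩, ?_⟩
        rintro ⟨-, -, h2⟩
        rw [rep_inv_apply_self] at h2
        exact hr.not_nonpos h0 h2
      · right
        refine ⟨-rep cs g γ, ⟨⟨(hr.rep g).neg, neg_nonneg.mpr h, ?_⟩, ?_⟩, neg_neg _⟩
        · rw [map_neg, rep_inv_apply_self]; exact neg_nonpos.mpr h0
        · rintro ⟨-, -, h2⟩
          rw [map_neg, neg_nonpos] at h2
          exact ((hr.rep g).rep w⁻¹).not_nonneg h1 h2
    · rintro (⟨⟨hr, h0, h1⟩, h2⟩ | ⟨γ, ⟨⟨hr, h0, h1⟩, h2⟩, rfl⟩)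
      · refine ⟨rep cs g⁻¹ β, ⟨hr.rep _, ?_, ?_⟩, rep_apply_inv_self cs g β⟩
        · exact (hr.rep _).nonneg_of_not_nonpos fun h => h2 ⟨hr, h0, h⟩
        · rwa [mul_inv_rev, inv_inv, rep_mul_apply, rep_apply_inv_self]
      · refine ⟨rep cs g⁻¹ (-γ), ⟨hr.neg.rep _, ?_, ?_⟩, rep_apply_inv_self cs g _⟩
        · rw [map_neg]; exact neg_nonneg.mpr h1
        · rw [mul_inv_rev, inv_inv, rep_mul_apply, rep_apply_inv_self, map_neg, neg_nonpos]
          exact (hr.rep _).nonneg_of_not_nonpos fun h => h2 ⟨hr, h0, h⟩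
  have hdisj : Disjoint (inversions cs w \ inversions cs g)
      ((fun x : I → ℝ => -x) '' (inversions cs g \ inversions cs w)) := by
    rw [Set.disjoint_left]
    rintro β ⟨⟨hr, h0, -⟩, -⟩ ⟨γ, ⟨⟨hr', h0', -⟩, -⟩, rfl⟩
    exact hr.not_nonneg (neg_nonpos.mpr h0') h0
  rw [← Set.ncard_image_of_injective _ hinj, himg,
    Set.ncard_union_eq hdisj (finite_inversions_s5 cs w).sdiff
      ((finite_inversions_s5 cs g).sdiff.image _),
    Set.ncard_image_of_injective _ hneg]

theorem length_add_ncard_diff (cs : CoxeterSystem N G) (g w : G) :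
    cs.length w + (inversions cs g \ inversions cs w).ncard =
      cs.length g + (inversions cs w \ inversions cs g).ncard := by
  have h1 := Set.ncard_inter_add_ncard_sdiff_eq_ncard (inversions cs w) (inversions cs g)
    (finite_inversions_s5 cs w)
  have h2 := Set.ncard_inter_add_ncard_sdiff_eq_ncard (inversions cs g) (inversions cs w)
    (finite_inversions_s5 cs g)
  rw [Set.inter_comm] at h2
  rw [ncard_inversions] at h1 h2
  omega

theorem inversions_subset_of_length_add (cs : CoxeterSystem N G) {h f : G}
    (hf : cs.length h + cs.length (h⁻¹ * f) = cs.length f) :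
    inversions cs h ⊆ inversions cs f := by
  have h1 := length_inv_mul_eq cs h f
  have h2 := length_add_ncard_diff cs h f
  have h3 : (inversions cs h \ inversions cs f).ncard = 0 := by omega
  rw [Set.ncard_eq_zero (finite_inversions_s5 cs h).sdiff] at h3
  exact Set.sdiff_eq_empty.mp h3

theorem inversions_injective (cs : CoxeterSystem N G) : Function.Injective (inversions cs) := by
  intro g w h
  have h1 := length_inv_mul_eq cs g w
  rw [h, Set.sdiff_self, Set.ncard_empty, cs.length_eq_zero_iff] at h1
  exact inv_mul_eq_one.mp h1

end Inversions

section RankTwo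

set_option linter.unusedSectionVars false

variable {I : Type} [Fintype I] {G : Type} [Group G] {N : CoxeterMatrix I}

theorem IsRoot.exists_reflection {cs : CoxeterSystem N G} {β : I → ℝ} (h : IsRoot cs β) :
    ∃ r : G, ∀ x, CoxeterPaper.rep cs r x = x - (2 * form N β x) • β := by
  obtain ⟨w, i, rfl⟩ := h
  refine ⟨w * cs.simple i * w⁻¹, fun x => ?_⟩
  have e : form N (simpleRoot i) (CoxeterPaper.rep cs w⁻¹ x) =
      form N (CoxeterPaper.rep cs w (simpleRoot i)) x := by
    rw [← form_rep cs w, rep_apply_inv_self]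
  rw [rep_mul_apply, rep_mul_apply, rep_simple_apply, map_sub, map_smul, rep_apply_inv_self, e]

/-- The sum of the coordinates. -/
noncomputable def height : (I → ℝ) →ₗ[ℝ] ℝ := ∑ i, LinearMap.proj i

theorem height_apply (x : I → ℝ) : height x = ∑ i, x i := by
  simp [height]

theorem height_nonneg {x : I → ℝ} (h : 0 ≤ x) : 0 ≤ height x := by
  rw [height_apply]; exact Finset.sum_nonneg fun i _ => h i

theorem height_pos {x : I → ℝ} (h : 0 ≤ x) (h0 : x ≠ 0) : 0 < height x := by
  refine lt_of_le_of_ne (height_nonneg h) fun hz => h0 ?_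
  rw [height_apply, eq_comm, Finset.sum_eq_zero_iff_of_nonneg fun i _ => h i] at hz
  ext i
  exact hz i (Finset.mem_univ i)

/-- The sequence of vectors defined by `e (n + 2) = 2 c e (n + 1) - e n`. -/
def ladder (c : ℝ) (a b : I → ℝ) : ℕ → I → ℝ
  | 0 => a
  | 1 => b
  | n + 2 => (2 * c) • ladder c a b (n + 1) - ladder c a b n

theorem isRoot_ladder {cs : CoxeterSystem N G} {a b : I → ℝ} (ha : IsRoot cs a)
    (hb : IsRoot cs b) {c : ℝ} (hc : form N a b = c) (n : ℕ) :
    IsRoot cs (ladder c a b n) ∧ IsRoot cs (ladder c a b (n + 1)) ∧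
      form N (ladder c a b n) (ladder c a b (n + 1)) = c := by
  induction n with
  | zero => exact ⟨ha, hb, hc⟩
  | succ n ih =>
    obtain ⟨h1, h2, h3⟩ := ih
    refine ⟨h2, ?_, ?_⟩
    · obtain ⟨r, hr⟩ := h2.exists_reflection
      have := (h1.rep r).neg
      rwa [hr, form_comm, h3, neg_sub] at this
    · rw [ladder, map_sub, map_smul, h2.form_self, form_comm _ (ladder c a b n), h3, smul_eq_mul]
      ring

theorem neg_one_lt_form_of_mem_inversions {cs : CoxeterSystem N G} {g : G} {β γ : I → ℝ}
    (hβ : β ∈ inversions cs g) (hγ : γ ∈ inversions cs g) : -1 < form N β γ := by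
  by_contra! hcon
  obtain ⟨hβr, hβ0, hβ1⟩ := hβ
  obtain ⟨hγr, hγ0, hγ1⟩ := hγ
  set c := form N (-γ) β with hc
  have hc1 : 1 ≤ c := by
    rw [hc, map_neg, LinearMap.neg_apply, form_comm]; linarith
  set e := ladder c (-γ) β with he
  have key : ∀ n, (0 ≤ e (n + 1) ∧ rep cs g⁻¹ (e (n + 1)) ≤ 0) ∧
      (0 ≤ e (n + 1) - e n ∧ rep cs g⁻¹ (e (n + 1) - e n) ≤ 0) ∧ e n < e (n + 1) := by
    intro n
    induction n with
    | zero =>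
      have e0 : e (0 + 1) - e 0 = β + γ := by simp [he, ladder]
      have h0 : 0 ≤ e (0 + 1) - e 0 := by rw [e0]; exact add_nonneg hβ0 hγ0
      refine ⟨⟨hβ0, hβ1⟩, ⟨h0, ?_⟩, lt_of_le_of_ne (sub_nonneg.mp h0) ?_⟩
      · rw [e0, map_add]; exact add_nonpos hβ1 hγ1
      · intro h
        rw [h, sub_self] at e0
        have hh : β = 0 := le_antisymm (by rw [e0]; exact le_add_of_nonneg_right hγ0) hβ0
        exact hβr.ne_zero hh
    | succ n ih =>
      obtain ⟨⟨h1, h2⟩, ⟨h3, h4⟩, h5⟩ := ih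
      have hd : e (n + 1 + 1) - e (n + 1) = (2 * c - 2) • e (n + 1) + (e (n + 1) - e n) := by
        simp only [he, ladder]
        module
      have hc2 : 0 ≤ 2 * c - 2 := by linarith
      have d1 : 0 ≤ e (n + 1 + 1) - e (n + 1) := by
        rw [hd]; exact add_nonneg (smul_nonneg hc2 h1) h3
      have d2 : rep cs g⁻¹ (e (n + 1 + 1) - e (n + 1)) ≤ 0 := by
        rw [hd, map_add, map_smul]
        exact add_nonpos (smul_nonpos_of_nonneg_of_nonpos hc2 h2) h4
      have d3 : e (n + 1 + 1) = e (n + 1) + (e (n + 1 + 1) - e (n + 1)) := by abel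
      refine ⟨⟨?_, ?_⟩, ⟨d1, d2⟩, lt_of_le_of_ne (sub_nonneg.mp d1) ?_⟩
      · rw [d3]; exact add_nonneg h1 d1
      · rw [d3, map_add]; exact add_nonpos h2 d2
      · intro h
        rw [← h, sub_self] at hd
        have : e (n + 1) - e n = 0 :=
          le_antisymm (by
            have := le_add_of_nonneg_left (a := e (n + 1) - e n) (smul_nonneg hc2 h1)
            rwa [← hd] at this) h3
        exact h5.ne (sub_eq_zero.mp this).symm
  have hmono : StrictMono e := strictMono_nat_of_lt_succ fun n => (key n).2.2
  refine Set.infinite_of_injective_forall_mem (f := fun n => e (n + 1))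
    (fun a b h => by simpa using hmono.injective h) (fun n => ?_) (finite_inversions_s5 cs g)
  exact ⟨(isRoot_ladder hγr.neg hβr hc.symm n).2.1, (key n).1.1, (key n).1.2⟩

theorem not_forall_pos_of_recurrence {c : ℝ} (hc : c < 1) {x : ℕ → ℝ}
    (hx : ∀ n, x (n + 2) = 2 * c * x (n + 1) - x n) : ¬ ∀ n, 0 < x n := by
  intro hpos
  have hanti : ∀ k m, x (k + m + 1) - x (k + m) ≤ x (k + 1) - x k := by
    intro k m
    induction m with
    | zero => simp
    | succ m ih =>
      have h1 := hx (k + m)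
      have h2 := hpos (k + m + 1)
      have e1 : k + (m + 1) + 1 = k + m + 2 := by ring
      have e2 : k + (m + 1) = k + m + 1 := by ring
      rw [e1, e2]
      nlinarith
  have hd : ∀ k, x k ≤ x (k + 1) := by
    intro k
    by_contra! hk
    have hle : ∀ m : ℕ, x (k + m) ≤ x k + m * (x (k + 1) - x k) := by
      intro m
      induction m with
      | zero => simp
      | succ m ih =>
        have := hanti k m
        rw [← add_assoc]; push_cast; linarith
    obtain ⟨m, hm⟩ := exists_nat_gt (x k / (x k - x (k + 1)))
    rw [div_lt_iff₀ (by linarith)] at hm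
    have := hle m
    have := hpos (k + m)
    nlinarith
  have hmono : Monotone x := monotone_nat_of_le_succ hd
  have hle : ∀ m : ℕ, x (m + 1) - x m ≤ x 1 - x 0 - m * ((2 - 2 * c) * x 0) := by
    intro m
    induction m with
    | zero => simp
    | succ m ih =>
      have h1 := hx m
      have h2 : x 0 ≤ x (m + 1) := hmono (Nat.zero_le _)
      have h3 : (2 - 2 * c) * x 0 ≤ (2 - 2 * c) * x (m + 1) :=
        mul_le_mul_of_nonneg_left h2 (by linarith)
      push_cast
      linarith
  have hp : 0 < (2 - 2 * c) * x 0 := mul_pos (by linarith) (hpos 0)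
  obtain ⟨m, hm⟩ := exists_nat_gt ((x 1 - x 0) / ((2 - 2 * c) * x 0))
  rw [div_lt_iff₀ hp] at hm
  have := hle m
  have := hd m
  linarith

theorem exists_rep_nonpos_nonpos {cs : CoxeterSystem N G} {β γ : I → ℝ} (hβ : IsRoot cs β)
    (hγ : IsRoot cs γ) (hβ0 : 0 ≤ β) (h1 : -1 < form N β γ) :
    ∃ g, rep cs g β ≤ 0 ∧ rep cs g γ ≤ 0 := by
  by_contra! hcon
  set c := form N (-γ) β with hc
  have hc1 : c < 1 := by
    rw [hc, map_neg, LinearMap.neg_apply, form_comm]; linarith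
  set e := ladder c (-γ) β with he
  have hroot := isRoot_ladder hγ.neg hβ hc.symm
  have hg : ∀ n, ∃ g, (rep cs g β = e (n + 1) ∧ rep cs g γ = -e n) ∨
      (rep cs g γ = e (n + 1) ∧ rep cs g β = -e n) := by
    intro n
    induction n with
    | zero => exact ⟨1, Or.inl ⟨rep_one_apply cs β, by simp [he, ladder]⟩⟩
    | succ n ih =>
      obtain ⟨r, hr⟩ := (hroot n).2.1.exists_reflection
      have e1 : rep cs r (e (n + 1)) = -e (n + 1) := by
        rw [hr, (hroot n).2.1.form_self]; module
      have e2 : rep cs r (-e n) = e (n + 2) := by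
        rw [hr, map_neg, form_comm, (hroot n).2.2]
        simp only [he, ladder]
        module
      obtain ⟨g, ⟨ha, hb⟩ | ⟨ha, hb⟩⟩ := ih
      · exact ⟨r * g, Or.inr ⟨by rw [rep_mul_apply, hb, e2], by rw [rep_mul_apply, ha, e1]⟩⟩
      · exact ⟨r * g, Or.inl ⟨by rw [rep_mul_apply, hb, e2], by rw [rep_mul_apply, ha, e1]⟩⟩
  have hpos : ∀ n, 0 ≤ e (n + 1) := by
    intro n
    induction n with
    | zero => exact hβ0
    | succ n ih =>
      apply (hroot (n + 1)).2.1.nonneg_of_not_nonpos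
      intro hle
      obtain ⟨g, ⟨ha, hb⟩ | ⟨ha, hb⟩⟩ := hg (n + 1)
      · refine hcon g (by rw [ha]; exact hle) ?_
        rw [hb]; exact neg_nonpos.mpr ih
      · refine hcon g ?_ (by rw [ha]; exact hle)
        rw [hb]; exact neg_nonpos.mpr ih
  refine not_forall_pos_of_recurrence hc1 (x := fun n => height (e (n + 1))) ?_ ?_
  · intro n
    simp only [he, ladder, map_sub, map_smul, smul_eq_mul]
  · intro n
    exact height_pos (hpos n) (hroot n).2.1.ne_zero

/-- All four combinations of signs are realised on the pair of roots `β`, `γ`. -/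
def HasAllSigns (cs : CoxeterSystem N G) (β γ : I → ℝ) : Prop :=
  (∃ g, 0 ≤ rep cs g β ∧ 0 ≤ rep cs g γ) ∧ (∃ g, 0 ≤ rep cs g β ∧ rep cs g γ ≤ 0) ∧
    (∃ g, rep cs g β ≤ 0 ∧ 0 ≤ rep cs g γ) ∧ (∃ g, rep cs g β ≤ 0 ∧ rep cs g γ ≤ 0)

theorem hasAllSigns_of_form {cs : CoxeterSystem N G} {β γ : I → ℝ} (hβ : IsRoot cs β)
    (hγ : IsRoot cs γ) (hβ0 : 0 ≤ β) (hγ0 : 0 ≤ γ) (h1 : -1 < form N β γ)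
    (h2 : form N β γ ≤ 0) : HasAllSigns cs β γ := by
  refine ⟨⟨1, by rwa [rep_one_apply], by rwa [rep_one_apply]⟩, ?_, ?_,
    exists_rep_nonpos_nonpos hβ hγ hβ0 h1⟩
  · obtain ⟨r, hr⟩ := hγ.exists_reflection
    refine ⟨r, ?_, ?_⟩
    · rw [hr, sub_eq_add_neg, ← neg_smul]
      exact add_nonneg hβ0 (smul_nonneg (by rw [form_comm]; linarith) hγ0)
    · rw [hr, hγ.form_self]
      have : γ - (2 * (1 : ℝ)) • γ = -γ := by module
      rw [this]; exact neg_nonpos.mpr hγ0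
  · obtain ⟨r, hr⟩ := hβ.exists_reflection
    refine ⟨r, ?_, ?_⟩
    · rw [hr, hβ.form_self]
      have : β - (2 * (1 : ℝ)) • β = -β := by module
      rw [this]; exact neg_nonpos.mpr hβ0
    · rw [hr, sub_eq_add_neg, ← neg_smul]
      exact add_nonneg hγ0 (smul_nonneg (by linarith) hβ0)

end RankTwo

section TitsCone

set_option linter.unusedSectionVars false

variable {I : Type} [Fintype I] {G : Type} [Group G] {N : CoxeterMatrix I}

/-- The positive roots on which a functional is nonpositive. -/
def nonposRoots (cs : CoxeterSystem N G) (μ : (I → ℝ) →ₗ[ℝ] ℝ) : Set (I → ℝ) :=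
  {ε | IsRoot cs ε ∧ 0 ≤ ε ∧ μ ε ≤ 0}

/-- The roots supported on two given coordinates. -/
def pairRoots (cs : CoxeterSystem N G) (i j : I) : Set (I → ℝ) :=
  {ε | IsRoot cs ε ∧ ∀ k, k ≠ i → k ≠ j → ε k = 0}

theorem functional_apply_eq_sum (μ : (I → ℝ) →ₗ[ℝ] ℝ) (x : I → ℝ) :
    μ x = ∑ i, x i * μ (simpleRoot i) := by
  have h := LinearMap.pi_apply_eq_sum_univ μ x
  rw [h]
  refine Finset.sum_congr rfl fun i _ => ?_
  rw [smul_eq_mul]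
  congr 2
  ext j
  simp [simpleRoot, Pi.single_apply, eq_comm]

theorem nonposRoots_add_subset (cs : CoxeterSystem N G) (μ ν : (I → ℝ) →ₗ[ℝ] ℝ) {a b : ℝ}
    (ha : 0 < a) (hb : 0 < b) :
    nonposRoots cs (a • μ + b • ν) ⊆ nonposRoots cs μ ∪ nonposRoots cs ν := by
  rintro ε ⟨hr, h0, h1⟩
  by_cases h : μ ε ≤ 0
  · exact Or.inl ⟨hr, h0, h⟩
  · refine Or.inr ⟨hr, h0, ?_⟩
    simp only [LinearMap.add_apply, LinearMap.smul_apply, smul_eq_mul] at h1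
    push Not at h
    have := mul_pos ha h
    by_contra! h2
    have := mul_pos hb h2
    linarith

theorem finite_nonposRoots_comp_rep (cs : CoxeterSystem N G) {μ : (I → ℝ) →ₗ[ℝ] ℝ}
    (hμ : (nonposRoots cs μ).Finite) (g : G) :
    (nonposRoots cs (μ ∘ₗ (rep cs g).toLinearMap)).Finite := by
  have hfin : (inversions cs g⁻¹ ∪ rep cs g⁻¹ '' nonposRoots cs μ).Finite :=
    (finite_inversions_s5 cs _).union (hμ.image _)
  refine hfin.subset ?_
  rintro ε ⟨hr, h0, h1⟩
  rcases (hr.rep g).nonneg_or_nonpos with h | h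
  · exact Or.inr ⟨rep cs g ε, ⟨hr.rep g, h, h1⟩, rep_inv_apply_self cs g ε⟩
  · exact Or.inl ⟨hr, h0, by rwa [inv_inv]⟩

theorem finite_nonposRoots_height (cs : CoxeterSystem N G) :
    (nonposRoots cs height).Finite := by
  convert Set.finite_empty
  ext ε
  simp only [Set.mem_empty_iff_false, iff_false]
  rintro ⟨hr, h0, h1⟩
  exact absurd (height_pos h0 hr.ne_zero) (not_lt.mpr h1)

theorem exists_vanishing_combination {E : Type*} [AddCommGroup E] [Module ℝ E]
    {C : Set (E →ₗ[ℝ] ℝ)}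
    (hC : ∀ μ ∈ C, ∀ ν ∈ C, ∀ a b : ℝ, 0 < a → 0 < b → a • μ + b • ν ∈ C) {x y : E}
    (h1 : ∃ μ ∈ C, 0 < μ x ∧ 0 < μ y) (h2 : ∃ μ ∈ C, 0 < μ x ∧ μ y < 0)
    (h3 : ∃ μ ∈ C, μ x < 0 ∧ 0 < μ y) (h4 : ∃ μ ∈ C, μ x < 0 ∧ μ y < 0) :
    ∃ μ ∈ C, μ x = 0 ∧ μ y = 0 := by
  obtain ⟨μ₁, c1, a1, b1⟩ := h1
  obtain ⟨μ₂, c2, a2, b2⟩ := h2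
  obtain ⟨μ₃, c3, a3, b3⟩ := h3
  obtain ⟨μ₄, c4, a4, b4⟩ := h4
  have p1 := hC μ₁ c1 μ₃ c3 (-μ₃ x) (μ₁ x) (by linarith) a1
  have p2 := hC μ₂ c2 μ₄ c4 (-μ₄ x) (μ₂ x) (by linarith) a2
  set ν₁ := (-μ₃ x) • μ₁ + (μ₁ x) • μ₃ with hν₁
  set ν₂ := (-μ₄ x) • μ₂ + (μ₂ x) • μ₄ with hν₂
  have e1 : ν₁ x = 0 := by simp [hν₁]; ring
  have e2 : ν₂ x = 0 := by simp [hν₂]; ring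
  have e3 : 0 < ν₁ y := by
    simp only [hν₁, LinearMap.add_apply, LinearMap.smul_apply, smul_eq_mul]
    nlinarith [mul_pos (neg_pos.mpr a3) b1, mul_pos a1 b3]
  have e4 : ν₂ y < 0 := by
    simp only [hν₂, LinearMap.add_apply, LinearMap.smul_apply, smul_eq_mul]
    nlinarith [mul_pos (neg_pos.mpr a4) (neg_pos.mpr b2), mul_pos a2 (neg_pos.mpr b4)]
  refine ⟨_, hC ν₁ p1 ν₂ p2 (-ν₂ y) (ν₁ y) (by linarith) e3, ?_, ?_⟩
  · simp [e1, e2]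
  · simp; ring

theorem functional_nonneg {μ : (I → ℝ) →ₗ[ℝ] ℝ} (hμ : ∀ i, 0 ≤ μ (simpleRoot i)) {x : I → ℝ}
    (hx : 0 ≤ x) : 0 ≤ μ x := by
  rw [functional_apply_eq_sum]
  exact Finset.sum_nonneg fun i _ => mul_nonneg (hx i) (hμ i)

theorem apply_eq_zero_of_functional_eq_zero {cs : CoxeterSystem N G} {μ : (I → ℝ) →ₗ[ℝ] ℝ}
    (hμ : ∀ i, 0 ≤ μ (simpleRoot i)) {ε : I → ℝ} (hr : IsRoot cs ε) (h : μ ε = 0) {k : I}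
    (hk : μ (simpleRoot k) ≠ 0) : ε k = 0 := by
  have main : ∀ ε : I → ℝ, 0 ≤ ε → μ ε = 0 → ε k = 0 := by
    intro ε h0 h
    rw [functional_apply_eq_sum,
      Finset.sum_eq_zero_iff_of_nonneg fun i _ => mul_nonneg (h0 i) (hμ i)] at h
    exact (mul_eq_zero.mp (h k (Finset.mem_univ k))).resolve_right hk
  rcases hr.nonneg_or_nonpos with h0 | h0
  · exact main ε h0 h
  · have := main (-ε) (neg_nonneg.mpr h0) (by rw [map_neg, h, neg_zero])
    simpa using this

theorem closure_finite_of_functional_eq_zero (cs : CoxeterSystem N G) {μ : (I → ℝ) →ₗ[ℝ] ℝ}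
    (hF : (nonposRoots cs μ).Finite) (hμ : ∀ i, 0 ≤ μ (simpleRoot i)) {J : Set I}
    (hJ : ∀ i ∈ J, μ (simpleRoot i) = 0) :
    Finite (Subgroup.closure (cs.simple '' J)) := by
  have hinv : ∀ v ∈ Subgroup.closure (cs.simple '' J), ∀ x, μ (rep cs v x) = μ x := by
    intro v hv
    induction hv using Subgroup.closure_induction with
    | mem v hv =>
      obtain ⟨i, hi, rfl⟩ := hv
      intro x
      rw [rep_simple_apply, map_sub, map_smul, hJ i hi, smul_zero, sub_zero]
    | one => intro x; rw [rep_one_apply]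
    | mul v w _ _ hv hw => intro x; rw [rep_mul_apply, hv, hw]
    | inv v _ hv => intro x; rw [← hv, rep_apply_inv_self]
  have hsub : ∀ v : Subgroup.closure (cs.simple '' J),
      inversions cs v ∈ {T | T ⊆ nonposRoots cs μ} := by
    rintro ⟨v, hv⟩ ε ⟨hr, h0, h1⟩
    refine ⟨hr, h0, ?_⟩
    have h2 := functional_nonneg hμ (neg_nonneg.mpr h1)
    rw [map_neg, hinv _ (inv_mem hv)] at h2
    linarith
  have hfin : Finite {T | T ⊆ nonposRoots cs μ} := hF.finite_subsets
  refine Finite.of_injective (β := {T | T ⊆ nonposRoots cs μ})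
    (fun v => ⟨inversions cs v, hsub v⟩) ?_
  intro v w h
  simp only [Subtype.mk.injEq] at h
  exact Subtype.ext (inversions_injective cs h)

theorem exists_pairRoots_of_dominant (cs : CoxeterSystem N G) (h2 : TwoDimensional cs)
    {μ : (I → ℝ) →ₗ[ℝ] ℝ} (hF : (nonposRoots cs μ).Finite)
    (hμ : ∀ i, 0 ≤ μ (simpleRoot i)) {β : I → ℝ} (hβ : IsRoot cs β) (h0 : μ β = 0) :
    ∃ i j, (pairRoots cs i j).Finite ∧ ∀ ε, IsRoot cs ε → μ ε = 0 → ε ∈ pairRoots cs i j := by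
  have hi : ∃ i, μ (simpleRoot i) = 0 := by
    by_contra! hcon
    exact hβ.ne_zero (funext fun k => apply_eq_zero_of_functional_eq_zero hμ hβ h0 (hcon k))
  obtain ⟨i, hi⟩ := hi
  have hij : ∃ j, μ (simpleRoot j) = 0 ∧ ∀ k, k ≠ i → k ≠ j → μ (simpleRoot k) ≠ 0 := by
    by_cases hj : ∃ j, j ≠ i ∧ μ (simpleRoot j) = 0
    · obtain ⟨j, hji, hj⟩ := hj
      refine ⟨j, hj, fun k hki hkj hk => ?_⟩
      have hinf := h2 i j k hji.symm hki.symm hkj.symm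
      have hfin := closure_finite_of_functional_eq_zero cs hF hμ (J := {i, j, k}) (by
        rintro l (rfl | rfl | rfl) <;> assumption)
      rw [Set.image_insert_eq, Set.image_pair] at hfin
      exact hinf.not_finite hfin
    · exact ⟨i, hi, fun k hki _ hk => hj ⟨k, hki, hk⟩⟩
  obtain ⟨j, hj, hk⟩ := hij
  refine ⟨i, j, ?_, fun ε hr hε => ⟨hr, fun k hki hkj =>
    apply_eq_zero_of_functional_eq_zero hμ hr hε (hk k hki hkj)⟩⟩
  refine (hF.union (hF.image fun x => -x)).subset ?_
  rintro ε ⟨hr, hε⟩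
  have hz : μ ε = 0 := by
    rw [functional_apply_eq_sum]
    refine Finset.sum_eq_zero fun k _ => ?_
    by_cases hki : k = i
    · rw [hki, hi, mul_zero]
    · by_cases hkj : k = j
      · rw [hkj, hj, mul_zero]
      · rw [hε k hki hkj, zero_mul]
  rcases hr.nonneg_or_nonpos with h | h
  · exact Or.inl ⟨hr, h, hz.le⟩
  · exact Or.inr ⟨-ε, ⟨hr.neg, neg_nonneg.mpr h, by rw [map_neg, hz, neg_zero]⟩, neg_neg ε⟩

theorem exists_pairRoots (cs : CoxeterSystem N G) (h2 : TwoDimensional cs)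
    {μ : (I → ℝ) →ₗ[ℝ] ℝ} (hF : (nonposRoots cs μ).Finite)
    {β : I → ℝ} (hβ : IsRoot cs β) (h0 : μ β = 0) :
    ∃ w i j, (pairRoots cs i j).Finite ∧
      ∀ ε, IsRoot cs ε → μ ε = 0 → rep cs w ε ∈ pairRoots cs i j := by
  induction hn : (nonposRoots cs μ).ncard using Nat.strong_induction_on generalizing μ β with
  | _ n ih =>
  by_cases hμ : ∀ i, 0 ≤ μ (simpleRoot i)
  · obtain ⟨i, j, h3, h4⟩ := exists_pairRoots_of_dominant cs h2 hF hμ hβ h0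
    exact ⟨1, i, j, h3, fun ε hr hε => by rw [rep_one_apply]; exact h4 ε hr hε⟩
  push Not at hμ
  obtain ⟨a, ha⟩ := hμ
  have hss : ∀ x, rep cs (cs.simple a) (rep cs (cs.simple a) x) = x := fun x => by
    rw [← rep_mul_apply, cs.simple_mul_simple_self, rep_one_apply]
  set μ' := μ ∘ₗ (rep cs (cs.simple a)).toLinearMap with hμ'
  have hμ'a : ∀ x, μ' x = μ (rep cs (cs.simple a) x) := fun x => rfl
  have hF' : (nonposRoots cs μ').Finite := finite_nonposRoots_comp_rep cs hF _
  have hαF : simpleRoot a ∈ nonposRoots cs μ :=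
    ⟨isRoot_simpleRoot cs a, simpleRoot_nonneg a, ha.le⟩
  have hsub : rep cs (cs.simple a) '' nonposRoots cs μ' ⊆
      nonposRoots cs μ \ {simpleRoot a} := by
    rintro _ ⟨ε, ⟨hr, hε0, hε1⟩, rfl⟩
    have hne : ε ≠ simpleRoot a := by
      rintro rfl
      rw [hμ'a, rep_simple_simpleRoot, map_neg] at hε1
      linarith
    refine ⟨⟨hr.rep _, hr.rep_simple_nonneg hε0 hne, hε1⟩, ?_⟩
    intro h
    have h : rep cs (cs.simple a) ε = simpleRoot a := h
    have h' := hss ε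
    rw [h, rep_simple_simpleRoot] at h'
    rw [← h'] at hε0
    exact (isRoot_simpleRoot cs a).not_nonpos (simpleRoot_nonneg a) (neg_nonneg.mp hε0)
  have hlt : (nonposRoots cs μ').ncard < n := by
    rw [← Set.ncard_image_of_injective _ (rep cs (cs.simple a)).injective, ← hn]
    refine (Set.ncard_le_ncard hsub hF.sdiff).trans_lt ?_
    exact Set.ncard_sdiff_singleton_lt_of_mem hαF hF
  obtain ⟨w, i, j, h3, h4⟩ := ih _ hlt hF' (hβ.rep (cs.simple a))
    (by rw [hμ'a, hss, h0]) rfl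
  refine ⟨w * cs.simple a, i, j, h3, fun ε hr hε => ?_⟩
  rw [rep_mul_apply]
  exact h4 _ (hr.rep _) (by rw [hμ'a, hss, hε])

theorem HasAllSigns.exists_pairRoots {cs : CoxeterSystem N G} (h2 : TwoDimensional cs)
    {β γ : I → ℝ} (hβ : IsRoot cs β) (hγ : IsRoot cs γ) (h : HasAllSigns cs β γ) :
    ∃ w i j, (pairRoots cs i j).Finite ∧ CoxeterPaper.rep cs w β ∈ pairRoots cs i j ∧
      CoxeterPaper.rep cs w γ ∈ pairRoots cs i j := by
  have hpos : ∀ (ε : I → ℝ) (g : G), IsRoot cs ε → 0 ≤ rep cs g ε →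
      0 < (height ∘ₗ (rep cs g).toLinearMap) ε :=
    fun ε g hr h0 => height_pos h0 (hr.rep g).ne_zero
  have hneg : ∀ (ε : I → ℝ) (g : G), IsRoot cs ε → rep cs g ε ≤ 0 →
      (height ∘ₗ (rep cs g).toLinearMap) ε < 0 := by
    intro ε g hr h0
    have := hpos (-ε) g hr.neg (by rw [map_neg]; exact neg_nonneg.mpr h0)
    rw [map_neg] at this
    linarith
  have hfin : ∀ g, height ∘ₗ (rep cs g).toLinearMap ∈
      {μ : (I → ℝ) →ₗ[ℝ] ℝ | (nonposRoots cs μ).Finite} :=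
    fun g => finite_nonposRoots_comp_rep cs (finite_nonposRoots_height cs) g
  obtain ⟨⟨g1, a1, b1⟩, ⟨g2, a2, b2⟩, ⟨g3, a3, b3⟩, ⟨g4, a4, b4⟩⟩ := h
  obtain ⟨μ, hμF, hμβ, hμγ⟩ := exists_vanishing_combination
    (C := {μ : (I → ℝ) →ₗ[ℝ] ℝ | (nonposRoots cs μ).Finite})
    (fun μ hμ ν hν a b ha hb =>
      (Set.Finite.union hμ hν).subset (nonposRoots_add_subset cs μ ν ha hb))
    ⟨_, hfin g1, hpos β g1 hβ a1, hpos γ g1 hγ b1⟩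
    ⟨_, hfin g2, hpos β g2 hβ a2, hneg γ g2 hγ b2⟩
    ⟨_, hfin g3, hneg β g3 hβ a3, hpos γ g3 hγ b3⟩
    ⟨_, hfin g4, hneg β g4 hβ a4, hneg γ g4 hγ b4⟩
  obtain ⟨w, i, j, h3, h4⟩ := CoxeterPaper.exists_pairRoots cs h2 hμF hβ hμβ
  exact ⟨w, i, j, h3, h4 β hβ hμβ, h4 γ hγ hμγ⟩

/-- The values of the form on pairs of roots lying in a finite dihedral parabolic subsystem. -/
def formValues (cs : CoxeterSystem N G) : Set ℝ :=
  {c | ∃ i j, (pairRoots cs i j).Finite ∧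
    ∃ a ∈ pairRoots cs i j, ∃ b ∈ pairRoots cs i j, form N a b = c}

theorem finite_formValues (cs : CoxeterSystem N G) : (formValues cs).Finite := by
  have h : ∀ i j, {c | (pairRoots cs i j).Finite ∧
      ∃ a ∈ pairRoots cs i j, ∃ b ∈ pairRoots cs i j, form N a b = c}.Finite := by
    intro i j
    by_cases hf : (pairRoots cs i j).Finite
    · refine (Set.Finite.image2 (fun a b => form N a b) hf hf).subset ?_
      rintro c ⟨-, a, ha, b, hb, h⟩
      exact ⟨a, ha, b, hb, h⟩
    · refine Set.finite_empty.subset ?_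
      rintro c ⟨h, -⟩
      exact hf h
  refine (Set.finite_iUnion fun i => Set.finite_iUnion fun j => h i j).subset ?_
  rintro c ⟨i, j, hc⟩
  exact Set.mem_iUnion.mpr ⟨i, Set.mem_iUnion.mpr ⟨j, hc⟩⟩

theorem neg_mem_formValues {cs : CoxeterSystem N G} {c : ℝ} (h : c ∈ formValues cs) :
    -c ∈ formValues cs := by
  obtain ⟨i, j, hf, a, ha, b, hb, rfl⟩ := h
  exact ⟨i, j, hf, -a, ⟨ha.1.neg, fun k h1 h2 => by simp [ha.2 k h1 h2]⟩, b, hb, by simp⟩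

theorem HasAllSigns.form_mem_formValues {cs : CoxeterSystem N G} (h2 : TwoDimensional cs)
    {β γ : I → ℝ} (hβ : IsRoot cs β) (hγ : IsRoot cs γ) (h : HasAllSigns cs β γ) :
    form N β γ ∈ formValues cs := by
  obtain ⟨w, i, j, hf, h3, h4⟩ := h.exists_pairRoots h2 hβ hγ
  exact ⟨i, j, hf, _, h3, _, h4, form_rep cs w β γ⟩

theorem form_simpleRoot_mem_formValues {cs : CoxeterSystem N G} (h2 : TwoDimensional cs)
    {δ : I → ℝ} (hδ : IsRoot cs δ) (hδ0 : 0 ≤ δ) (i : I) (h1 : -1 < form N δ (simpleRoot i))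
    (h3 : form N δ (simpleRoot i) < 1) : form N δ (simpleRoot i) ∈ formValues cs := by
  by_cases h : form N δ (simpleRoot i) ≤ 0
  · exact (hasAllSigns_of_form hδ (isRoot_simpleRoot cs i) hδ0 (simpleRoot_nonneg i) h1
      h).form_mem_formValues h2 hδ (isRoot_simpleRoot cs i)
  · have hne : δ ≠ simpleRoot i := by
      rintro rfl
      rw [form_simpleRoot_self] at h3
      exact lt_irrefl _ h3
    have hs := hδ.rep_simple_nonneg hδ0 hne
    have hv : form N (rep cs (cs.simple i) δ) (simpleRoot i) = -form N δ (simpleRoot i) := by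
      rw [rep_simple_apply, map_sub, map_smul, LinearMap.sub_apply, LinearMap.smul_apply,
        form_simpleRoot_self, form_comm (simpleRoot i)]
      simp
      ring
    have := (hasAllSigns_of_form (hδ.rep (cs.simple i)) (isRoot_simpleRoot cs i) hs
      (simpleRoot_nonneg i) (by rw [hv]; linarith) (by rw [hv]; linarith)).form_mem_formValues h2
      (hδ.rep (cs.simple i)) (isRoot_simpleRoot cs i)
    rw [hv] at this
    simpa using neg_mem_formValues this

end TitsCone

section NearWall

set_option linter.unusedSectionVars false

variable {I : Type} [Fintype I] {G : Type} [Group G] {N : CoxeterMatrix I}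

theorem neg_one_lt_form_of_signs {cs : CoxeterSystem N G} {β γ : I → ℝ} (hβ : IsRoot cs β)
    (hγ : IsRoot cs γ) (h1 : ∃ g, 0 ≤ rep cs g β ∧ 0 ≤ rep cs g γ)
    (h2 : ∃ g, rep cs g β ≤ 0 ∧ rep cs g γ ≤ 0) : -1 < form N β γ := by
  obtain ⟨g, a1, b1⟩ := h1
  obtain ⟨g', a2, b2⟩ := h2
  have e : ∀ x, rep cs (g * g'⁻¹)⁻¹ (rep cs g x) = rep cs g' x := fun x => by
    rw [mul_inv_rev, inv_inv, rep_mul_apply, rep_inv_apply_self]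
  rw [← form_rep cs g β γ]
  exact neg_one_lt_form_of_mem_inversions (g := g * g'⁻¹) ⟨hβ.rep g, a1, by rwa [e]⟩
    ⟨hγ.rep g, b1, by rwa [e]⟩

theorem form_lt_one_of_signs {cs : CoxeterSystem N G} {β γ : I → ℝ} (hβ : IsRoot cs β)
    (hγ : IsRoot cs γ) (h1 : ∃ g, 0 ≤ rep cs g β ∧ rep cs g γ ≤ 0)
    (h2 : ∃ g, rep cs g β ≤ 0 ∧ 0 ≤ rep cs g γ) : form N β γ < 1 := by
  obtain ⟨g, a1, b1⟩ := h1
  obtain ⟨g', a2, b2⟩ := h2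
  have := neg_one_lt_form_of_signs hβ hγ.neg
    ⟨g, a1, by rw [map_neg]; exact neg_nonneg.mpr b1⟩
    ⟨g', a2, by rw [map_neg]; exact neg_nonpos.mpr b2⟩
  rw [map_neg] at this
  linarith

/-- The elements `q` whose chamber is adjacent to the wall of `s`, on the positive side. -/
def wallElements (cs : CoxeterSystem N G) (s : I) : Set G :=
  {q | ∃ x, rep cs q (simpleRoot x) = simpleRoot s}

/-- The elements none of whose inversions is disjoint from the wall of `s`. -/
def shallowElements (cs : CoxeterSystem N G) (s : I) : Set G :=
  {h | ∀ β ∈ inversions cs h, |form N (simpleRoot s) β| < 1}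

theorem simpleRoot_notMem_inversions_of_wall {cs : CoxeterSystem N G} {s : I} {f : G}
    (hf : f ∈ wallElements cs s) : simpleRoot s ∉ inversions cs f := by
  obtain ⟨x, hx⟩ := hf
  rw [← hx]
  exact rep_simpleRoot_notMem_inversions cs f x

theorem rep_simple_neg (cs : CoxeterSystem N G) (s : I) :
    rep cs (cs.simple s) (simpleRoot s) ≤ 0 := by
  rw [rep_simple_simpleRoot]
  exact neg_nonpos.mpr (simpleRoot_nonneg s)

theorem mem_shallowElements_of_subset {cs : CoxeterSystem N G} {s : I} {f h : G}
    (hf : f ∈ wallElements cs s) (hsub : inversions cs h ⊆ inversions cs f) :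
    h ∈ shallowElements cs s := by
  intro β hβ
  have hne : β ≠ simpleRoot s := by
    rintro rfl
    exact simpleRoot_notMem_inversions_of_wall hf (hsub hβ)
  obtain ⟨hr, h0, h1⟩ := hsub hβ
  obtain ⟨x, hx⟩ := hf
  have hs := isRoot_simpleRoot cs s
  have hx' : rep cs f⁻¹ (simpleRoot s) = simpleRoot x := by
    rw [← hx, rep_inv_apply_self]
  have hne' : -rep cs f⁻¹ β ≠ simpleRoot x := by
    intro h
    have : -β = simpleRoot s := by
      rw [← hx, ← h, map_neg, rep_apply_inv_self]
    have h2 := simpleRoot_nonneg s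
    rw [← this] at h2
    exact hr.not_nonpos h0 (neg_nonneg.mp h2)
  rw [abs_lt]
  constructor
  · refine neg_one_lt_form_of_signs hs hr ⟨1, ?_, ?_⟩ ⟨cs.simple x * f⁻¹, ?_, ?_⟩
    · rw [rep_one_apply]; exact simpleRoot_nonneg s
    · rwa [rep_one_apply]
    · rw [rep_mul_apply, hx']; exact rep_simple_neg cs x
    · rw [rep_mul_apply]
      have := (hr.rep f⁻¹).neg.rep_simple_nonneg (neg_nonneg.mpr h1) hne'
      rw [map_neg] at this
      exact neg_nonneg.mp this
  · refine form_lt_one_of_signs hs hr ⟨f⁻¹, ?_, h1⟩ ⟨cs.simple s, rep_simple_neg cs s,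
      hr.rep_simple_nonneg h0 hne⟩
    rw [hx']; exact simpleRoot_nonneg x

theorem rep_inv_nonneg_of_shallow {cs : CoxeterSystem N G} {s : I} {h : G}
    (hh : h ∈ shallowElements cs s) : 0 ≤ rep cs h⁻¹ (simpleRoot s) := by
  have hs := isRoot_simpleRoot cs s
  apply (hs.rep h⁻¹).nonneg_of_not_nonpos
  intro hle
  have := hh _ ⟨hs, simpleRoot_nonneg s, hle⟩
  rw [form_simpleRoot_self] at this
  simp at this

theorem form_rep_inv (cs : CoxeterSystem N G) (g : G) (x y : I → ℝ) :
    form N (rep cs g⁻¹ x) y = form N x (rep cs g y) := by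
  rw [← form_rep cs g, rep_apply_inv_self]

theorem shallow_mul_simple {cs : CoxeterSystem N G} {s i : I} {h : G}
    (hh : h ∈ shallowElements cs s) (hw : h ∉ wallElements cs s)
    (hi : 0 < form N (rep cs h⁻¹ (simpleRoot s)) (simpleRoot i)) :
    h * cs.simple i ∈ shallowElements cs s ∧
      form N (rep cs h⁻¹ (simpleRoot s)) (simpleRoot i) < 1 := by
  have hs := isRoot_simpleRoot cs s
  have hβ := (isRoot_simpleRoot cs i).rep h
  have hδ := rep_inv_nonneg_of_shallow hh
  have hne : rep cs h (simpleRoot i) ≠ simpleRoot s := fun e => hw ⟨i, e⟩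
  have hne' : rep cs h⁻¹ (simpleRoot s) ≠ simpleRoot i := fun e =>
    hne (by rw [← e, rep_apply_inv_self])
  rw [form_rep_inv] at hi ⊢
  rcases hβ.nonneg_or_nonpos with h0 | h0
  · have hlt : form N (simpleRoot s) (rep cs h (simpleRoot i)) < 1 := by
      refine form_lt_one_of_signs hs hβ ⟨cs.simple i * h⁻¹, ?_, ?_⟩
        ⟨cs.simple s, rep_simple_neg cs s, hβ.rep_simple_nonneg h0 hne⟩
      · rw [rep_mul_apply]; exact (hs.rep _).rep_simple_nonneg hδ hne'
      · rw [rep_mul_apply, rep_inv_apply_self]; exact rep_simple_neg cs i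
    refine ⟨fun γ hγ => ?_, hlt⟩
    rw [inversions_mul_simple cs h i h0] at hγ
    rcases hγ with rfl | hγ
    · rw [abs_of_pos hi]; exact hlt
    · exact hh γ hγ
  · have hsub := inversions_mul_simple_subset cs h i h0
    have hmem : -rep cs h (simpleRoot i) ∈ inversions cs h := by
      rw [hsub]; exact Set.mem_insert _ _
    have := hh _ hmem
    rw [map_neg, abs_neg, abs_of_pos hi] at this
    refine ⟨fun γ hγ => hh γ ?_, this⟩
    rw [hsub]; exact Set.mem_insert_of_mem _ hγ

theorem exists_form_simpleRoot_pos {cs : CoxeterSystem N G} {δ : I → ℝ} (hδ : IsRoot cs δ)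
    (h0 : 0 ≤ δ) : ∃ i, 0 < form N δ (simpleRoot i) := by
  by_contra! hcon
  have h1 := hδ.form_self
  rw [functional_apply_eq_sum] at h1
  have : ∑ i, δ i * form N δ (simpleRoot i) ≤ 0 :=
    Finset.sum_nonpos fun i _ => mul_nonpos_of_nonneg_of_nonpos (h0 i) (hcon i)
  linarith

theorem form_ne_one_of_sub_nonneg {cs : CoxeterSystem N G} {s : I} {h : G}
    (hh : h ∈ shallowElements cs s) {δ : I → ℝ} (hδ : IsRoot cs δ) (hδ0 : 0 ≤ δ)
    (hne : rep cs h⁻¹ (simpleRoot s) ≠ δ) (hle : δ ≤ rep cs h⁻¹ (simpleRoot s)) :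
    form N (rep cs h⁻¹ (simpleRoot s)) δ ≠ 1 := by
  intro h1
  rw [form_rep_inv] at h1
  have hε := hδ.rep h
  rcases hε.nonneg_or_nonpos with h0 | h0
  · have hεs : rep cs h δ ≠ simpleRoot s := by
      intro e
      apply hne
      rw [← e, rep_inv_apply_self]
    have hmem : rep cs (cs.simple s) (rep cs h δ) ∈ inversions cs h := by
      refine ⟨hε.rep _, hε.rep_simple_nonneg h0 hεs, ?_⟩
      rw [rep_simple_apply, h1, map_sub, map_smul, rep_inv_apply_self]
      have e : δ - (2 * (1 : ℝ)) • rep cs h⁻¹ (simpleRoot s) =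
          -((rep cs h⁻¹ (simpleRoot s) - δ) + rep cs h⁻¹ (simpleRoot s)) := by module
      rw [e]
      exact neg_nonpos.mpr (add_nonneg (sub_nonneg.mpr hle) (hδ0.trans hle))
    have := hh _ hmem
    rw [rep_simple_apply, h1, map_sub, map_smul, h1, form_simpleRoot_self] at this
    norm_num at this
  · have hmem : -rep cs h δ ∈ inversions cs h := by
      refine ⟨hε.neg, neg_nonneg.mpr h0, ?_⟩
      rw [map_neg, rep_inv_apply_self]
      exact neg_nonpos.mpr hδ0
    have := hh _ hmem
    rw [map_neg, h1] at this
    norm_num at this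

/-- A descending chain of roots whose truncated pairings with the simple roots agree at both
ends has pairing one between its ends. -/
theorem form_eq_one_of_chain {δ : ℕ → I → ℝ} {b : ℕ → ℝ} {i : ℕ → I} {n m : ℕ}
    (hnm : n < m) (hself : form N (δ n) (δ n) = 1) (hself' : form N (δ m) (δ m) = 1)
    (hstep : ∀ l, n ≤ l → l < m → δ (l + 1) = δ l - (2 * b l) • simpleRoot (i l))
    (hb : ∀ l, n ≤ l → l < m → b l = form N (δ l) (simpleRoot (i l)))
    (hb0 : ∀ l, n ≤ l → l < m → 0 < b l) (hb1 : ∀ l, n ≤ l → l < m → b l < 1)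
    (hτ : ∀ j, max (form N (δ n) (simpleRoot j)) (-1) =
      max (form N (δ m) (simpleRoot j)) (-1)) :
    δ n ≠ δ m ∧ δ m ≤ δ n ∧ form N (δ n) (δ m) = 1 := by
  have hdead : ∀ j, form N (δ m) (simpleRoot j) ≤ -1 →
      ∀ l, n ≤ l → l ≤ m → form N (δ l) (simpleRoot j) ≤ -1 := by
    intro j hj l hl hlm
    induction hlm using Nat.decreasingInduction with
    | self => exact hj
    | of_succ l hlm ih =>
      have ih := ih (by omega)
      have hne : i l ≠ j := by
        rintro rfl
        rw [hstep l hl hlm, map_sub, map_smul, LinearMap.sub_apply, LinearMap.smul_apply,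
          form_simpleRoot_self, ← hb l hl hlm] at ih
        have := hb1 l hl hlm
        simp only [smul_eq_mul] at ih
        linarith
      rw [hstep l hl hlm, map_sub, map_smul, LinearMap.sub_apply, LinearMap.smul_apply,
        smul_eq_mul] at ih
      have h1 := form_simpleRoot_nonpos (N := N) hne
      have h2 := mul_nonpos_of_nonneg_of_nonpos (hb0 l hl hlm).le h1
      linarith
  have hused : ∀ l, n ≤ l → l < m →
      form N (δ n - δ m) (simpleRoot (i l)) = 0 := by
    intro l hl hlm
    have h1 : -1 < form N (δ m) (simpleRoot (i l)) := by
      by_contra! hcon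
      have := hdead _ hcon l hl hlm.le
      have h2 := hb0 l hl hlm
      rw [hb l hl hlm] at h2
      linarith
    have h2 := hτ (i l)
    rw [max_eq_left h1.le] at h2
    have h3 : form N (δ n) (simpleRoot (i l)) = form N (δ m) (simpleRoot (i l)) := by
      rcases max_choice (form N (δ n) (simpleRoot (i l))) (-1) with h | h
      · rw [← h2, h]
      · rw [h] at h2; linarith
    rw [map_sub, LinearMap.sub_apply, h3, sub_self]
  have hind : ∀ l, n ≤ l → l ≤ m → 0 ≤ δ n - δ l ∧ (n < l → 0 < height (δ n - δ l)) ∧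
      form N (δ n - δ m) (δ n - δ l) = 0 := by
    intro l hl
    induction l, hl using Nat.le_induction with
    | base => intro _; simp
    | succ l hl ih =>
      intro hlm
      obtain ⟨h1, h2, h3⟩ := ih (by omega)
      have e : δ n - δ (l + 1) = (δ n - δ l) + (2 * b l) • simpleRoot (i l) := by
        rw [hstep l hl hlm]; module
      have hbl := hb0 l hl hlm
      have hh : 0 < height (simpleRoot (i l)) := by
        rw [height_apply]; simp [simpleRoot]
      refine ⟨?_, fun _ => ?_, ?_⟩
      · rw [e]; exact add_nonneg h1 (smul_nonneg (by linarith) (simpleRoot_nonneg _))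
      · rw [e, map_add, map_smul, smul_eq_mul]
        have := height_nonneg h1
        have := mul_pos (show 0 < 2 * b l by linarith) hh
        linarith
      · rw [e, map_add, h3, map_smul, hused l hl hlm, smul_zero, add_zero]
  obtain ⟨h1, h2, h3⟩ := hind m hnm.le le_rfl
  have h2 := h2 hnm
  refine ⟨?_, sub_nonneg.mp h1, ?_⟩
  · intro h
    rw [h, sub_self, map_zero] at h2
    exact lt_irrefl _ h2
  · simp only [map_sub, LinearMap.sub_apply, hself, hself', form_comm (δ m) (δ n)] at h3
    linarith

theorem exists_wallElement_near (cs : CoxeterSystem N G) (h2 : TwoDimensional cs) :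
    ∃ K : ℕ, ∀ s, ∀ h ∈ shallowElements cs s, ∃ q ∈ wallElements cs s,
      cs.length (h⁻¹ * q) ≤ K := by
  let T : Set ℝ := insert (-1) (formValues cs)
  have hT : Finite T := ((finite_formValues cs).insert _).to_subtype
  refine ⟨Nat.card (I → T), fun s h₀ hh₀ => ?_⟩
  set K := Nat.card (I → T) with hK
  by_contra! hcon
  have hpick : ∀ g, ∃ i, g ∈ shallowElements cs s →
      0 < form N (rep cs g⁻¹ (simpleRoot s)) (simpleRoot i) := by
    intro g
    by_cases hg : g ∈ shallowElements cs s
    · obtain ⟨i, hi⟩ := exists_form_simpleRoot_pos ((isRoot_simpleRoot cs s).rep g⁻¹)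
        (rep_inv_nonneg_of_shallow hg)
      exact ⟨i, fun _ => hi⟩
    · exact ⟨s, fun h => absurd h hg⟩
  choose pick hpick using hpick
  let h : ℕ → G := fun n => Nat.rec h₀ (fun _ g => g * cs.simple (pick g)) n
  have hsucc : ∀ n, h (n + 1) = h n * cs.simple (pick (h n)) := fun n => rfl
  have hlen : ∀ n, cs.length (h₀⁻¹ * h n) ≤ n := by
    intro n
    induction n with
    | zero => simp [h]
    | succ n ih =>
      rw [hsucc, ← mul_assoc]
      have := cs.length_mul_le (h₀⁻¹ * h n) (cs.simple (pick (h n)))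
      rw [cs.length_simple] at this
      omega
  have hwall : ∀ n, n ≤ K → h n ∉ wallElements cs s := by
    intro n hn hw
    have h1 := hcon _ hw
    have h2 := hlen n
    omega
  have hsh : ∀ n, n ≤ K → h n ∈ shallowElements cs s := by
    intro n
    induction n with
    | zero => exact fun _ => hh₀
    | succ n ih =>
      intro hn
      have ih := ih (by omega)
      rw [hsucc]
      exact (shallow_mul_simple ih (hwall n (by omega)) (hpick _ ih)).1
  let δ : ℕ → I → ℝ := fun n => rep cs (h n)⁻¹ (simpleRoot s)
  have hδr : ∀ n, IsRoot cs (δ n) := fun n => (isRoot_simpleRoot cs s).rep _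
  have hδ0 : ∀ n, n ≤ K → 0 ≤ δ n := fun n hn => rep_inv_nonneg_of_shallow (hsh n hn)
  have hτmem : ∀ n, n ≤ K → ∀ j, max (form N (δ n) (simpleRoot j)) (-1) ∈ T := by
    intro n hn j
    by_cases h1 : form N (δ n) (simpleRoot j) ≤ -1
    · rw [max_eq_right h1]; exact Set.mem_insert _ _
    · push Not at h1
      rw [max_eq_left h1.le]
      refine Set.mem_insert_of_mem _ ?_
      refine form_simpleRoot_mem_formValues h2 (hδr n) (hδ0 n hn) j h1 ?_
      by_cases h3 : 0 < form N (δ n) (simpleRoot j)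
      · exact (shallow_mul_simple (hsh n hn) (hwall n hn) h3).2
      · linarith
  let τ : Fin (K + 1) → (I → T) := fun n j => ⟨_, hτmem n (by omega) j⟩
  have hτ : ¬ Function.Injective τ := by
    intro hinj
    have := Nat.card_le_card_of_injective τ hinj
    rw [Nat.card_eq_fintype_card, Fintype.card_fin] at this
    omega
  have hpair : ∃ n m : Fin (K + 1), n < m ∧ τ n = τ m := by
    simp only [Function.Injective, not_forall] at hτ
    obtain ⟨a, b, hab, hne⟩ := hτ
    rcases lt_or_gt_of_ne hne with h | h
    · exact ⟨a, b, h, hab⟩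
    · exact ⟨b, a, h, hab.symm⟩
  obtain ⟨n, m, hnm, hτnm⟩ := hpair
  have hchain := form_eq_one_of_chain (N := N) (δ := δ)
    (b := fun l => form N (δ l) (simpleRoot (pick (h l)))) (i := fun l => pick (h l))
    (n := n) (m := m) hnm (hδr n).form_self (hδr m).form_self
    (fun l _ _ => by
      simp only [δ]
      rw [hsucc, mul_inv_rev, cs.inv_simple, rep_mul_apply, rep_simple_apply,
        form_comm (simpleRoot _)])
    (fun l _ _ => rfl)
    (fun l _ hl => hpick _ (hsh l (by omega)))
    (fun l _ hl => (shallow_mul_simple (hsh l (by omega)) (hwall l (by omega))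
      (hpick _ (hsh l (by omega)))).2)
    (fun j => by simpa [τ] using congrArg Subtype.val (congrFun hτnm j))
  exact form_ne_one_of_sub_nonneg (hsh n (by omega)) (hδr m) (hδ0 m (by omega)) hchain.1
    hchain.2.1 hchain.2.2

end NearWall

section Wall

set_option linter.unusedSectionVars false

variable {I : Type} [Fintype I] {G : Type} [Group G] {N : CoxeterMatrix I}

/-- The sum of all coordinates but one. -/
noncomputable def partialHeight (x : I) : (I → ℝ) →ₗ[ℝ] ℝ := height - LinearMap.proj x

theorem partialHeight_simpleRoot (x : I) : partialHeight x (simpleRoot x) = 0 := by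
  simp [partialHeight, height_apply, simpleRoot]

theorem partialHeight_pos {cs : CoxeterSystem N G} {ε : I → ℝ} (hr : IsRoot cs ε)
    (h0 : 0 ≤ ε) {x : I} (hx : ε ≠ simpleRoot x) : 0 < partialHeight x ε := by
  obtain ⟨j, hj, hpos⟩ := hr.exists_pos_apply h0 hx
  have h1 : ε x + ε j ≤ ∑ i, ε i := by
    rw [← Finset.sum_pair hj.symm]
    exact Finset.sum_le_sum_of_subset_of_nonneg (Finset.subset_univ _) fun i _ _ => h0 i
  simp only [partialHeight, LinearMap.sub_apply, height_apply, LinearMap.proj_apply]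
  linarith

theorem finite_nonposRoots_partialHeight (cs : CoxeterSystem N G) (x : I) :
    (nonposRoots cs (partialHeight x)).Finite := by
  refine (Set.finite_singleton (simpleRoot x)).subset ?_
  rintro ε ⟨hr, h0, h1⟩
  by_contra hne
  exact absurd (partialHeight_pos hr h0 hne) (not_lt.mpr h1)

/-- An element adjacent to a wall yields a functional vanishing on the root of the wall
which has the sign prescribed by the element on all other roots. -/
theorem exists_functional_of_wall {cs : CoxeterSystem N G} {s : I} {q : G}
    (hq : q ∈ wallElements cs s) :
    ∃ μ : (I → ℝ) →ₗ[ℝ] ℝ, (nonposRoots cs μ).Finite ∧ μ (simpleRoot s) = 0 ∧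
      (∀ ε, IsRoot cs ε → ε ≠ simpleRoot s → 0 ≤ rep cs q⁻¹ ε → 0 < μ ε) ∧
      (∀ ε, IsRoot cs ε → ε ≠ -simpleRoot s → rep cs q⁻¹ ε ≤ 0 → μ ε < 0) := by
  obtain ⟨x, hx⟩ := hq
  have hx' : rep cs q⁻¹ (simpleRoot s) = simpleRoot x := by
    rw [← hx, rep_inv_apply_self]
  set μ := partialHeight x ∘ₗ (rep cs q⁻¹).toLinearMap
  have hμ : ∀ ε, μ ε = partialHeight x (rep cs q⁻¹ ε) := fun ε => rfl
  have hpos : ∀ ε, IsRoot cs ε → ε ≠ simpleRoot s → 0 ≤ rep cs q⁻¹ ε → 0 < μ ε := by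
    intro ε hr hne h0
    rw [hμ]
    refine partialHeight_pos (hr.rep _) h0 fun h => hne ?_
    rw [← hx, ← h, rep_apply_inv_self]
  refine ⟨μ, finite_nonposRoots_comp_rep cs (finite_nonposRoots_partialHeight cs x) _, ?_,
    hpos, fun ε hr hne h0 => ?_⟩
  · rw [hμ, hx', partialHeight_simpleRoot]
  · have := hpos (-ε) hr.neg (fun h => hne (by rw [← h, neg_neg]))
      (by rw [map_neg]; exact neg_nonneg.mpr h0)
    rw [map_neg] at this
    linarith

theorem exists_relation_of_supported {v : Fin 3 → I → ℝ} {i j : I}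
    (hv : ∀ l k, k ≠ i → k ≠ j → v l k = 0) :
    ∃ c : Fin 3 → ℝ, ∑ l, c l • v l = 0 ∧ ∃ l, c l ≠ 0 := by
  let u : Fin 3 → Fin 2 → ℝ := fun l => ![v l i, v l j]
  have hu : ¬ LinearIndependent ℝ u := by
    intro h
    have := h.fintype_card_le_finrank
    simp at this
  rw [Fintype.not_linearIndependent_iff] at hu
  obtain ⟨c, hc, hne⟩ := hu
  refine ⟨c, ?_, hne⟩
  ext k
  have h0 := congrFun hc 0
  have h1 := congrFun hc 1
  simp only [u, Finset.sum_apply, Pi.smul_apply, Matrix.cons_val_zero, Matrix.cons_val_one,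
    Pi.zero_apply] at h0 h1 ⊢
  by_cases hki : k = i
  · rw [hki]; exact h0
  by_cases hkj : k = j
  · rw [hkj]; exact h1
  exact Finset.sum_eq_zero fun l _ => by rw [hv l k hki hkj, smul_zero]

theorem false_of_wallElements_all_signs {cs : CoxeterSystem N G} (h2 : TwoDimensional cs)
    {s : I} {β γ : I → ℝ} (hβ : IsRoot cs β) (hγ : IsRoot cs γ) (hβ1 : β ≠ simpleRoot s)
    (hβ2 : β ≠ -simpleRoot s) (hγ1 : γ ≠ simpleRoot s) (hγ2 : γ ≠ -simpleRoot s)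
    {q₁ q₂ q₃ q₄ : G} (m₁ : q₁ ∈ wallElements cs s) (m₂ : q₂ ∈ wallElements cs s)
    (m₃ : q₃ ∈ wallElements cs s) (m₄ : q₄ ∈ wallElements cs s)
    (h₁ : 0 ≤ rep cs q₁⁻¹ β ∧ 0 ≤ rep cs q₁⁻¹ γ) (h₂ : 0 ≤ rep cs q₂⁻¹ β ∧ rep cs q₂⁻¹ γ ≤ 0)
    (h₃ : rep cs q₃⁻¹ β ≤ 0 ∧ 0 ≤ rep cs q₃⁻¹ γ)
    (h₄ : rep cs q₄⁻¹ β ≤ 0 ∧ rep cs q₄⁻¹ γ ≤ 0) : False := by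
  obtain ⟨μ₁, f₁, z₁, p₁, -⟩ := exists_functional_of_wall m₁
  obtain ⟨μ₂, f₂, z₂, p₂, n₂⟩ := exists_functional_of_wall m₂
  obtain ⟨μ₃, f₃, z₃, p₃, n₃⟩ := exists_functional_of_wall m₃
  obtain ⟨μ₄, f₄, z₄, -, n₄⟩ := exists_functional_of_wall m₄
  have a₁ := p₁ β hβ hβ1 h₁.1
  have b₁ := p₁ γ hγ hγ1 h₁.2
  have a₂ := p₂ β hβ hβ1 h₂.1
  have b₂ := n₂ γ hγ hγ2 h₂.2
  have hs := isRoot_simpleRoot cs s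
  obtain ⟨μ, ⟨hF, hz⟩, hμβ, hμγ⟩ := exists_vanishing_combination
    (C := {μ : (I → ℝ) →ₗ[ℝ] ℝ | (nonposRoots cs μ).Finite ∧ μ (simpleRoot s) = 0})
    (x := β) (y := γ)
    (fun μ hμ ν hν a b ha hb =>
      ⟨(Set.Finite.union hμ.1 hν.1).subset (nonposRoots_add_subset cs μ ν ha hb), by
        simp [hμ.2, hν.2]⟩)
    ⟨μ₁, ⟨f₁, z₁⟩, a₁, b₁⟩ ⟨μ₂, ⟨f₂, z₂⟩, a₂, b₂⟩
    ⟨μ₃, ⟨f₃, z₃⟩, n₃ β hβ hβ2 h₃.1, p₃ γ hγ hγ1 h₃.2⟩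
    ⟨μ₄, ⟨f₄, z₄⟩, n₄ β hβ hβ2 h₄.1, n₄ γ hγ hγ2 h₄.2⟩
  obtain ⟨w, i, j, -, hw⟩ := exists_pairRoots cs h2 hF hβ hμβ
  obtain ⟨c, hc, hne⟩ := exists_relation_of_supported
    (v := ![rep cs w (simpleRoot s), rep cs w β, rep cs w γ]) (i := i) (j := j) (by
      intro l
      fin_cases l
      · exact (hw _ hs hz).2
      · exact (hw _ hβ hμβ).2
      · exact (hw _ hγ hμγ).2)
  have hrel : c 0 • simpleRoot s + c 1 • β + c 2 • γ = 0 := by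
    apply (rep cs w).injective
    rw [map_zero, ← hc, Fin.sum_univ_three]
    simp
  have e₁ := congrArg μ₁ hrel
  have e₂ := congrArg μ₂ hrel
  simp only [map_add, map_smul, smul_eq_mul, z₁, z₂, map_zero, mul_zero, zero_add] at e₁ e₂
  have c2 : c 2 = 0 := by
    have h : c 2 * (μ₁ γ * μ₂ β - μ₂ γ * μ₁ β) = 0 := by linear_combination μ₂ β * e₁ - μ₁ β * e₂
    have hpos : 0 < μ₁ γ * μ₂ β - μ₂ γ * μ₁ β := by nlinarith [mul_pos b₁ a₂]
    exact (mul_eq_zero.mp h).resolve_right hpos.ne'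
  have c1 : c 1 = 0 := by
    rw [c2, zero_mul, add_zero] at e₁
    exact (mul_eq_zero.mp e₁).resolve_right a₁.ne'
  have c0 : c 0 = 0 := by
    rw [c1, c2, zero_smul, zero_smul, add_zero, add_zero] at hrel
    exact (smul_eq_zero.mp hrel).resolve_right hs.ne_zero
  obtain ⟨l, hl⟩ := hne
  fin_cases l
  · exact hl c0
  · exact hl c1
  · exact hl c2

theorem one_mem_wallElements (cs : CoxeterSystem N G) (s : I) : 1 ∈ wallElements cs s :=
  ⟨s, rep_one_apply cs _⟩

theorem inversions_subset_or_subset {cs : CoxeterSystem N G} (h2 : TwoDimensional cs) {s : I}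
    {f q q' : G} (hf : f ∈ wallElements cs s) (hq : q ∈ wallElements cs s)
    (hq' : q' ∈ wallElements cs s) :
    inversions cs q ∩ inversions cs f ⊆ inversions cs q' ∨
      inversions cs q' ∩ inversions cs f ⊆ inversions cs q := by
  by_contra! hcon
  obtain ⟨h1, h3⟩ := hcon
  rw [Set.not_subset] at h1 h3
  obtain ⟨β, ⟨hβ, hβf⟩, hβ'⟩ := h1
  obtain ⟨γ, ⟨hγ, hγf⟩, hγ'⟩ := h3
  have hpos : ∀ {ε : I → ℝ} {g : G}, IsRoot cs ε → 0 ≤ ε → ε ∉ inversions cs g →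
      0 ≤ rep cs g⁻¹ ε :=
    fun hr h0 hn => (hr.rep _).nonneg_of_not_nonpos fun h => hn ⟨hr, h0, h⟩
  have hne : ∀ {ε : I → ℝ}, ε ∈ inversions cs f → ε ≠ simpleRoot s ∧ ε ≠ -simpleRoot s := by
    intro ε hε
    constructor
    · rintro rfl
      exact simpleRoot_notMem_inversions_of_wall hf hε
    · intro h
      have := hε.2.1
      rw [h] at this
      exact (isRoot_simpleRoot cs s).neg.not_nonneg (neg_nonpos.mpr (simpleRoot_nonneg s)) this
  refine false_of_wallElements_all_signs h2 hβ.1 hγ.1 (hne hβf).1 (hne hβf).2 (hne hγf).1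
    (hne hγf).2 (one_mem_wallElements cs s) hq' hq hf ⟨?_, ?_⟩
    ⟨hpos hβ.1 hβ.2.1 hβ', hγ.2.2⟩ ⟨hβ.2.2, hpos hγ.1 hγ.2.1 hγ'⟩ ⟨hβf.2.2, hγf.2.2⟩
  · rw [inv_one, rep_one_apply]; exact hβ.2.1
  · rw [inv_one, rep_one_apply]; exact hγ.2.1

theorem length_inv_mul_le_add (cs : CoxeterSystem N G) (a b c : G) :
    cs.length (a⁻¹ * c) ≤ cs.length (a⁻¹ * b) + cs.length (b⁻¹ * c) := by
  have := cs.length_mul_le (a⁻¹ * b) (b⁻¹ * c)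
  rwa [mul_assoc, mul_inv_cancel_left] at this

theorem length_inv_mul_comm (cs : CoxeterSystem N G) (a b : G) :
    cs.length (a⁻¹ * b) = cs.length (b⁻¹ * a) := by
  rw [← cs.length_inv, mul_inv_rev, inv_inv]

theorem length_inv_mul_wallElements_le {cs : CoxeterSystem N G} {f h h' q q' : G} {K : ℕ}
    (hh : inversions cs h ⊆ inversions cs f)
    (hq : cs.length (h⁻¹ * q) ≤ K) (hq' : cs.length (h'⁻¹ * q') ≤ K)
    (hlen : cs.length h' ≤ cs.length h + 1)
    (hsub : inversions cs q ∩ inversions cs f ⊆ inversions cs q') :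
    cs.length (q⁻¹ * q') ≤ 4 * K + 1 := by
  have h1 : (inversions cs q \ inversions cs q').ncard ≤
      (inversions cs q \ inversions cs h).ncard := by
    refine Set.ncard_le_ncard ?_ (finite_inversions_s5 cs q).sdiff
    rintro β ⟨hβ, hβ'⟩
    exact ⟨hβ, fun hβh => hβ' (hsub ⟨hβ, hh hβh⟩)⟩
  have h3 := length_inv_mul_eq cs h q
  have h4 := length_inv_mul_eq cs q q'
  have h5 := length_add_ncard_diff cs q q'
  have h6 := length_add_ncard_diff cs h q
  have h7 := length_add_ncard_diff cs h' q'
  have h8 := length_inv_mul_eq cs h' q'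
  omega

theorem length_inv_mul_le_of_subset {cs : CoxeterSystem N G} (h2 : TwoDimensional cs) {K : ℕ}
    (hK : ∀ s, ∀ h ∈ shallowElements cs s, ∃ q ∈ wallElements cs s, cs.length (h⁻¹ * q) ≤ K)
    {s : I} {f h h' : G} (hf : f ∈ wallElements cs s)
    (hh : inversions cs h ⊆ inversions cs f) (hh' : inversions cs h' ⊆ inversions cs f)
    (hlen : cs.length h ≤ cs.length h' + 1) (hlen' : cs.length h' ≤ cs.length h + 1) :
    cs.length (h⁻¹ * h') ≤ 6 * K + 1 := by
  obtain ⟨q, hqw, hq⟩ := hK s h (mem_shallowElements_of_subset hf hh)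
  obtain ⟨q', hqw', hq'⟩ := hK s h' (mem_shallowElements_of_subset hf hh')
  have h1 : cs.length (q⁻¹ * q') ≤ 4 * K + 1 := by
    rcases inversions_subset_or_subset h2 hf hqw hqw' with h | h
    · exact length_inv_mul_wallElements_le hh hq hq' hlen' h
    · rw [length_inv_mul_comm]
      exact length_inv_mul_wallElements_le hh' hq' hq hlen h
  have h3 := length_inv_mul_le_add cs h q h'
  have h4 := length_inv_mul_le_add cs q q' h'
  rw [length_inv_mul_comm cs q' h'] at h4
  omega

theorem simple_mul_eq_mul_simple_s5 {cs : CoxeterSystem N G} {s x : I} {q : G}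
    (h : rep cs q (simpleRoot x) = simpleRoot s) : cs.simple s * q = q * cs.simple x := by
  have hrep : rep cs (cs.simple s * q) = rep cs (q * cs.simple x) := by
    ext1 y
    rw [rep_mul_apply, rep_mul_apply, rep_simple_apply, rep_simple_apply, map_sub, map_smul, h,
      ← h, form_rep]
  apply inversions_injective cs
  simp only [inversions, map_inv, hrep]

theorem length_conj_simple_le {cs : CoxeterSystem N G} {s : I} {h q : G}
    (hq : q ∈ wallElements cs s) :
    cs.length (h⁻¹ * cs.simple s * h) ≤ 2 * cs.length (h⁻¹ * q) + 1 := by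
  obtain ⟨x, hx⟩ := hq
  have e : h⁻¹ * cs.simple s * h = (h⁻¹ * q) * cs.simple x * (q⁻¹ * h) := by
    rw [mul_assoc h⁻¹ q, ← simple_mul_eq_mul_simple_s5 hx]
    group
  rw [e]
  have h1 := cs.length_mul_le ((h⁻¹ * q) * cs.simple x) (q⁻¹ * h)
  have h2 := cs.length_mul_le (h⁻¹ * q) (cs.simple x)
  rw [cs.length_simple] at h2
  rw [length_inv_mul_comm cs q h] at h1
  omega

theorem exists_near_below_wall {cs : CoxeterSystem N G} {K : ℕ}
    (hK : ∀ s, ∀ h ∈ shallowElements cs s, ∃ q ∈ wallElements cs s, cs.length (h⁻¹ * q) ≤ K)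
    {s : I} {f h : G} (hf : f ∈ wallElements cs s)
    (hh : inversions cs h ⊆ inversions cs (cs.simple s * f)) :
    ∃ k, inversions cs k ⊆ inversions cs f ∧ cs.length k ≤ cs.length h ∧
      cs.length h ≤ cs.length k + 1 ∧ cs.length (h⁻¹ * k) ≤ 2 * K + 1 := by
  by_cases hs : simpleRoot s ∈ inversions cs h
  · have hsub : inversions cs (cs.simple s * h) ⊆ inversions cs f := by
      rintro β ⟨hr, h0, h1⟩
      rw [mul_inv_rev, cs.inv_simple, rep_mul_apply] at h1
      have hne : β ≠ simpleRoot s := by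
        rintro rfl
        rw [rep_simple_simpleRoot, map_neg, neg_nonpos] at h1
        exact (hs.1.rep _).not_nonneg hs.2.2 h1
      have hmem := hh ⟨hr.rep (cs.simple s), hr.rep_simple_nonneg h0 hne, h1⟩
      refine ⟨hr, h0, ?_⟩
      have := hmem.2.2
      rwa [mul_inv_rev, cs.inv_simple, ← rep_mul_apply, cs.simple_mul_simple_cancel_right] at this
    have hd : cs.IsRightDescent h⁻¹ s := by
      by_contra hnd
      exact (hs.1.rep _).not_nonneg hs.2.2 (rep_simpleRoot_nonneg cs _ _ hnd)
    have hlen : cs.length (cs.simple s * h) + 1 = cs.length h :=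
      cs.isLeftDescent_iff.mp (cs.isRightDescent_inv_iff.mp hd)
    obtain ⟨q, hq, hqK⟩ := hK s _ (mem_shallowElements_of_subset hf hsub)
    refine ⟨cs.simple s * h, hsub, by omega, by omega, ?_⟩
    have h3 := length_conj_simple_le (h := cs.simple s * h) hq
    have e : (cs.simple s * h)⁻¹ * cs.simple s * (cs.simple s * h) =
        h⁻¹ * (cs.simple s * h) := by
      rw [mul_inv_rev, cs.inv_simple, cs.simple_mul_simple_cancel_right]
    rw [e] at h3
    omega
  · refine ⟨h, fun β hβ => ?_, le_rfl, by omega, by simp⟩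
    obtain ⟨x, hx⟩ := hf
    have hmem := hh hβ
    rw [simple_mul_eq_mul_simple_s5 hx, inversions_mul_simple cs f x
      (by rw [hx]; exact simpleRoot_nonneg s), hx] at hmem
    rcases hmem with rfl | hmem
    · exact absurd hβ hs
    · exact hmem

theorem mem_wallElements_or {cs : CoxeterSystem N G} {s j : I} {f : G}
    (h : f⁻¹ * cs.simple s * f = cs.simple j) :
    f ∈ wallElements cs s ∨ cs.simple s * f ∈ wallElements cs s := by
  have h1 : cs.simple s * f = f * cs.simple j := by
    rw [← h]; group
  have h2 : rep cs (cs.simple s) (rep cs f (simpleRoot j)) = -rep cs f (simpleRoot j) := by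
    rw [← rep_mul_apply, h1, rep_mul_apply, rep_simple_simpleRoot, map_neg]
  have h3 : rep cs f (simpleRoot j) =
      form N (simpleRoot s) (rep cs f (simpleRoot j)) • simpleRoot s := by
    rw [rep_simple_apply] at h2
    have h4 : (2 : ℝ) • rep cs f (simpleRoot j) =
        (2 : ℝ) • (form N (simpleRoot s) (rep cs f (simpleRoot j)) • simpleRoot s) := by
      rw [sub_eq_iff_eq_add, ← sub_eq_iff_eq_add', sub_neg_eq_add] at h2
      rw [two_smul, h2, smul_smul]
    exact smul_right_injective _ (two_ne_zero) h4
  have h5 := ((isRoot_simpleRoot cs j).rep f).form_self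
  rw [h3, map_smul, map_smul, LinearMap.smul_apply, form_simpleRoot_self, smul_eq_mul,
    smul_eq_mul, mul_one, mul_self_eq_one_iff] at h5
  rcases h5 with h5 | h5
  · left
    exact ⟨j, by rw [h3, h5, one_smul]⟩
  · right
    exact ⟨j, by rw [rep_mul_apply, h2, h3, h5, neg_one_smul, neg_neg]⟩

end Wall

/-- **Sublemma.** In a 2-dimensional Coxeter group, any two elements of equal length lying on
geodesics from the identity to an element adjacent to the wall of a generator are uniformly
close. -/
theorem fellow_traveling_along_wall
    (cs : CoxeterSystem M W) (h2 : TwoDimensional cs) :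
    ∃ D : ℕ, 0 < D ∧
      ∀ (i : B) (f : W), (∃ j : B, f⁻¹ * cs.simple i * f = cs.simple j) →
        ∀ h h' : W,
          cs.length h + cs.length (h⁻¹ * f) = cs.length f →
          cs.length h' + cs.length (h'⁻¹ * f) = cs.length f →
          cs.length h = cs.length h' →
          cs.length (h⁻¹ * h') < D := by
  obtain ⟨K, hK⟩ := exists_wallElement_near cs h2
  refine ⟨10 * K + 4, by omega, ?_⟩
  rintro i f ⟨j, hj⟩ h h' hh hh' hlen
  have hs := inversions_subset_of_length_add cs hh
  have hs' := inversions_subset_of_length_add cs hh'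
  rcases mem_wallElements_or hj with hf | hf
  · have := length_inv_mul_le_of_subset h2 hK hf hs hs' (by omega) (by omega)
    omega
  · have e : cs.simple i * (cs.simple i * f) = f := cs.simple_mul_simple_cancel_left i
    rw [← e] at hs hs'
    obtain ⟨k, hk, hk1, hk2, hk3⟩ := exists_near_below_wall hK hf hs
    obtain ⟨k', hk', hk1', hk2', hk3'⟩ := exists_near_below_wall hK hf hs'
    have h3 := length_inv_mul_le_of_subset h2 hK hf hk hk' (by omega) (by omega)
    have h4 := length_inv_mul_le_add cs h k h'
    have h5 := length_inv_mul_le_add cs k k' h'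
    have h6 := length_inv_mul_comm cs h' k'
    omega

end CoxeterPaper
end
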